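/- For every ε with 0 < ε < 1 there exists t₀(ε) such that for every integer t ≥ t₀(ε), the number of pairs of integers (n,m) with 1 ≤ m ≤ n/2, exp((log n)^{2/3+ε}) ≤ m, and C(n,m) = t is at most 2. -/

import Mathlib

namespace Singmaster

open Finset

/-- The number of coincidences between the values of `f` on `S` and those of `g` on `T`. -/
def coinc {α β Γ : Type*} [DecidableEq Γ] (S : Finset α) (f : α → Γ) (T : Finset β) (g : β → Γ) :
    ℕ :=
  #{x ∈ S ×ˢ T | f x.1 = g x.2}

theorem exists_addChar (k : ℕ) (F : Finset (Fin k → ℤ)) :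
    ∃ (n : ℕ) (e : Fin n → AddChar (Fin k → ℤ) ℂ), 0 < n ∧ (∀ ω γ, ‖e ω γ‖ = 1) ∧
      ∀ γ ∈ F, γ ≠ 0 → ∑ ω, e ω γ = 0 := by
  classical
  obtain ⟨B, hB⟩ : ∃ B : ℕ, ∀ γ ∈ F, ∀ j, |γ j| ≤ B := by
    refine ⟨∑ γ ∈ F, ∑ j, (γ j).natAbs, fun γ hγ j => ?_⟩
    have h1 : (γ j).natAbs ≤ ∑ j, (γ j).natAbs :=
      single_le_sum (f := fun j => (γ j).natAbs) (fun _ _ => Nat.zero_le _) (mem_univ j)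
    have h2 : ∑ j, (γ j).natAbs ≤ ∑ γ ∈ F, ∑ j, (γ j).natAbs :=
      single_le_sum (f := fun γ : Fin k → ℤ => ∑ j, (γ j).natAbs) (fun _ _ => Nat.zero_le _) hγ
    rw [Int.abs_eq_natAbs]
    exact_mod_cast h1.trans h2
  let G := Fin k → ZMod (B + 1)
  let π : (Fin k → ℤ) →+ G := (Int.castAddHom (ZMod (B + 1))).compLeft (Fin k)
  have hπ : ∀ γ ∈ F, γ ≠ 0 → π γ ≠ 0 := by
    intro γ hγ h0 hz
    apply h0
    funext j
    have hj : ((γ j : ℤ) : ZMod (B + 1)) = 0 := congrFun hz j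
    rw [ZMod.intCast_zmod_eq_zero_iff_dvd] at hj
    refine Int.eq_zero_of_abs_lt_dvd hj ?_
    have := hB γ hγ j
    push_cast
    omega
  let eq := (Fintype.equivFin (AddChar G ℂ))
  refine ⟨Fintype.card (AddChar G ℂ), fun ω => (eq.symm ω).compAddMonoidHom π, Fintype.card_pos,
    fun ω γ => ?_, fun γ hγ h0 => ?_⟩
  · simp [AddChar.norm_apply]
  · have := AddChar.sum_apply_eq_ite (α := G) (π γ)
    rw [if_neg (hπ γ hγ h0)] at this
    rw [← this]
    exact Fintype.sum_equiv eq.symm _ _ (fun ω => rfl)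

section Characters

variable {k n : ℕ} {e : Fin n → AddChar (Fin k → ℤ) ℂ}

theorem sum_mul_conj_eq_coinc {α β : Type*} (he : ∀ ω γ, ‖e ω γ‖ = 1) {F : Finset (Fin k → ℤ)}
    (hF : ∀ γ ∈ F, γ ≠ 0 → ∑ ω, e ω γ = 0) (S : Finset α) (f : α → Fin k → ℤ) (T : Finset β)
    (g : β → Fin k → ℤ) (h : ∀ x ∈ S, ∀ y ∈ T, f x - g y ∈ F) :
    ∑ ω, (∑ x ∈ S, e ω (f x)) * (starRingEnd ℂ) (∑ y ∈ T, e ω (g y)) = n * coinc S f T g := by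
  have h1 : ∀ ω, (∑ x ∈ S, e ω (f x)) * (starRingEnd ℂ) (∑ y ∈ T, e ω (g y)) =
      ∑ z ∈ S ×ˢ T, e ω (f z.1 - g z.2) := by
    intro ω
    rw [map_sum, sum_mul_sum, sum_product]
    refine sum_congr rfl fun x _ => sum_congr rfl fun y _ => ?_
    rw [sub_eq_add_neg, AddChar.map_add_eq_mul, AddChar.map_neg_eq_inv,
      Complex.inv_eq_conj (he _ _)]
  simp_rw [h1]
  rw [sum_comm]
  have h2 : ∀ z ∈ S ×ˢ T, ∑ ω, e ω (f z.1 - g z.2) = if f z.1 = g z.2 then (n : ℂ) else 0 := by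
    intro z hz
    rw [mem_product] at hz
    split_ifs with hfg
    · simp [hfg]
    · exact hF _ (h _ hz.1 _ hz.2) (sub_ne_zero.2 hfg)
  rw [sum_congr rfl h2, ← sum_filter, sum_const, coinc]
  simp [mul_comm]

theorem sum_norm_sq_eq_coinc {α : Type*} (he : ∀ ω γ, ‖e ω γ‖ = 1) {F : Finset (Fin k → ℤ)}
    (hF : ∀ γ ∈ F, γ ≠ 0 → ∑ ω, e ω γ = 0) (S : Finset α) (f : α → Fin k → ℤ)
    (h : ∀ x ∈ S, ∀ y ∈ S, f x - f y ∈ F) :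
    ∑ ω, ‖∑ x ∈ S, e ω (f x)‖ ^ 2 = n * coinc S f S f := by
  have := sum_mul_conj_eq_coinc he hF S f S f h
  simp_rw [Complex.mul_conj, Complex.normSq_eq_norm_sq] at this
  exact_mod_cast this

theorem sum_piFinset_addChar {ι : Type*} {b : ℕ} (ψ : AddChar (Fin k → ℤ) ℂ)
    (I : Fin b → Finset ι) (φ : ι → Fin k → ℤ) :
    ∑ x ∈ Fintype.piFinset I, ψ (∑ i, φ (x i)) = ∏ i, ∑ x ∈ I i, ψ (φ x) := by
  rw [prod_univ_sum]
  refine sum_congr rfl fun x _ => ?_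
  induction (univ : Finset (Fin b)) using Finset.induction_on with
  | empty => simp
  | insert a s ha ih => rw [sum_insert ha, prod_insert ha, AddChar.map_add_eq_mul, ih]

theorem sum_norm_pow_eq_coinc {ι : Type*} (he : ∀ ω γ, ‖e ω γ‖ = 1) {F : Finset (Fin k → ℤ)}
    (hF : ∀ γ ∈ F, γ ≠ 0 → ∑ ω, e ω γ = 0) (I : Finset ι) (φ : ι → Fin k → ℤ) (b : ℕ)
    (h : ∀ x ∈ Fintype.piFinset fun _ : Fin b => I, ∀ y ∈ Fintype.piFinset fun _ : Fin b => I,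
      (∑ i, φ (x i)) - ∑ i, φ (y i) ∈ F) :
    ∑ ω, ‖∑ x ∈ I, e ω (φ x)‖ ^ (2 * b) =
      n * coinc (Fintype.piFinset fun _ : Fin b => I) (fun x => ∑ i, φ (x i))
        (Fintype.piFinset fun _ : Fin b => I) (fun x => ∑ i, φ (x i)) := by
  rw [← sum_norm_sq_eq_coinc he hF _ _ h]
  refine sum_congr rfl fun ω _ => ?_
  rw [sum_piFinset_addChar, prod_const, card_univ, Fintype.card_fin, norm_pow, ← pow_mul, mul_comm]

theorem norm_sum_collision_le {ι κ : Type*} [DecidableEq κ] [Fintype κ] [DecidableEq ι]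
    (ψ : AddChar (Fin k → ℤ) ℂ) (I : Finset ι) (cls : ι → κ) (φ : ι → Fin k → ℤ) {a : ℕ}
    {i j : Fin a} (hij : i ≠ j) :
    ‖∑ u ∈ Fintype.piFinset (fun _ : Fin a => I) with cls (u i) = cls (u j),
        ψ (∑ l, φ (u l))‖ ≤
      (∑ c, ‖∑ x ∈ I with cls x = c, ψ (φ x)‖ ^ 2) * ‖∑ x ∈ I, ψ (φ x)‖ ^ (a - 2) := by
  rw [← sum_fiberwise (s := Finset.filter _ _) (g := fun u => cls (u i)), sum_mul]
  refine (norm_sum_le _ _).trans (sum_le_sum fun c _ => le_of_eq ?_)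
  have h1 : {u ∈ {u ∈ Fintype.piFinset (fun _ : Fin a => I) | cls (u i) = cls (u j)} |
      cls (u i) = c} =
      Fintype.piFinset (fun l : Fin a => if l ∈ ({i, j} : Finset (Fin a))
        then {x ∈ I | cls x = c} else I) := by
    ext u
    simp only [mem_filter, Fintype.mem_piFinset]
    constructor
    · rintro ⟨⟨h1, h2⟩, h3⟩ l
      split_ifs with hl
      · rw [mem_filter]
        refine ⟨h1 l, ?_⟩
        rcases mem_insert.1 hl with rfl | hl
        · exact h3
        · rw [mem_singleton.1 hl, ← h2, h3]
      · exact h1 l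
    · intro h
      have hi := h i
      have hj := h j
      simp only [mem_insert, mem_singleton, true_or, or_true, if_true, mem_filter] at hi hj
      refine ⟨⟨fun l => ?_, hi.2.trans hj.2.symm⟩, hi.2⟩
      have hl := h l
      split_ifs at hl with hl'
      · exact (mem_filter.1 hl).1
      · exact hl
  rw [h1, sum_piFinset_addChar, norm_prod]
  have h2 : ∀ l : Fin a, ‖∑ x ∈ if l ∈ ({i, j} : Finset (Fin a)) then {x ∈ I | cls x = c} else I,
      ψ (φ x)‖ = if l ∈ ({i, j} : Finset (Fin a)) then ‖∑ x ∈ I with cls x = c, ψ (φ x)‖ else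
        ‖∑ x ∈ I, ψ (φ x)‖ := by
    intro l
    split_ifs <;> rfl
  simp_rw [h2]
  rw [prod_ite, prod_const, prod_const]
  congr 2
  · rw [filter_mem_eq_inter, univ_inter, card_pair hij]
  · rw [filter_not, filter_mem_eq_inter, univ_inter, card_sdiff_of_subset (subset_univ _),
      card_pair hij, card_univ, Fintype.card_fin]

end Characters

theorem coinc_comm {α β Γ : Type*} [DecidableEq Γ] (S : Finset α) (f : α → Γ) (T : Finset β)
    (g : β → Γ) : coinc S f T g = coinc T g S f := by
  unfold coinc
  refine card_bij' (fun z _ => z.swap) (fun z _ => z.swap) ?_ ?_ ?_ ?_ <;>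
  simp +contextual [eq_comm, and_comm]

theorem coinc_add_right_le {α : Type*} {k : ℕ} (S : Finset α) (f : α → Fin k → ℤ)
    (v : Fin k → ℤ) : coinc S f S (fun x => f x + v) ≤ coinc S f S f := by
  classical
  obtain ⟨n, e, hn, he, hF⟩ := exists_addChar k
    (image (fun z : α × α => f z.1 - (f z.2 + v)) (S ×ˢ S) ∪
      image (fun z : α × α => f z.1 - f z.2) (S ×ˢ S))
  have h1 := sum_mul_conj_eq_coinc he hF S f S (fun x => f x + v) fun x hx y hy =>
    mem_union_left _ (mem_image.2 ⟨(x, y), mem_product.2 ⟨hx, hy⟩, rfl⟩)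
  have h2 := sum_norm_sq_eq_coinc he hF S f fun x hx y hy =>
    mem_union_right _ (mem_image.2 ⟨(x, y), mem_product.2 ⟨hx, hy⟩, rfl⟩)
  have h3 : (n : ℝ) * coinc S f S (fun x => f x + v) ≤ n * coinc S f S f := by
    rw [← h2]
    calc (n : ℝ) * coinc S f S (fun x => f x + v)
        = ‖(n : ℂ) * coinc S f S (fun x => f x + v)‖ := by simp
      _ ≤ _ := by
        rw [← h1]
        refine (norm_sum_le _ _).trans (le_of_eq (sum_congr rfl fun ω _ => ?_))
        simp_rw [AddChar.map_add_eq_mul, ← sum_mul]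
        rw [norm_mul, RCLike.norm_conj, norm_mul, he, mul_one, sq]
  have hn' : (0 : ℝ) < n := by exact_mod_cast hn
  exact_mod_cast le_of_mul_le_mul_left h3 hn'

theorem mul_pow_pred_le {A u c : ℝ} (hA : 0 ≤ A) (hu : 0 ≤ u) (hc : 0 ≤ c) {b : ℕ} (hb : 1 ≤ b) :
    c * A * u ^ (b - 1) ≤ u ^ b / 2 + (2 * c * A) ^ b / 2 := by
  obtain ⟨b, rfl⟩ := Nat.exists_eq_add_of_le' hb
  simp only [Nat.add_sub_cancel]
  rcases le_total (2 * c * A) u with h | h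
  · have := mul_le_mul_of_nonneg_right h (pow_nonneg hu b)
    have h2 : 0 ≤ (2 * c * A) ^ (b + 1) := by positivity
    rw [pow_succ u]
    linarith
  · have h1 : u ^ b ≤ (2 * c * A) ^ b := pow_le_pow_left₀ hu h b
    have h2 : 0 ≤ u ^ (b + 1) := by positivity
    have := mul_le_mul_of_nonneg_left h1 (by positivity : 0 ≤ 2 * c * A)
    rw [pow_succ (2 * c * A)]
    linarith

/-- The set of `b`-tuples with entries in `I`. -/
def tuples {ι : Type*} (I : Finset ι) (b : ℕ) : Finset (Fin b → ι) :=
  Fintype.piFinset fun _ => I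

theorem mem_tuples {ι : Type*} {I : Finset ι} {b : ℕ} {x : Fin b → ι} :
    x ∈ tuples I b ↔ ∀ i, x i ∈ I := Fintype.mem_piFinset

theorem tuples_mono {ι : Type*} {I J : Finset ι} (h : I ⊆ J) (b : ℕ) : tuples I b ⊆ tuples J b :=
  Fintype.piFinset_subset _ _ fun _ => h

/-- The number of pairs of `b`-tuples from `I` with equal `φ`-sums. -/
def energy {ι : Type*} {k : ℕ} (I : Finset ι) (φ : ι → Fin k → ℤ) (b : ℕ) : ℕ :=
  coinc (tuples I b) (fun x => ∑ i, φ (x i)) (tuples I b) fun x => ∑ i, φ (x i)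

/-- The sum of `φ` over a pair of tuples. -/
def pairSum {ι : Type*} {k a s : ℕ} (φ : ι → Fin k → ℤ) (z : (Fin a → ι) × (Fin s → ι)) :
    Fin k → ℤ :=
  ∑ i, φ (z.1 i) + ∑ i, φ (z.2 i)

theorem sum_addChar_pairSum {ι : Type*} {k a s : ℕ} (ψ : AddChar (Fin k → ℤ) ℂ) (φ : ι → Fin k → ℤ)
    (S : Finset (Fin a → ι)) (I : Finset ι) :
    ∑ z ∈ S ×ˢ tuples I s, ψ (pairSum φ z) =
      (∑ u ∈ S, ψ (∑ i, φ (u i))) * (∑ x ∈ I, ψ (φ x)) ^ s := by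
  have h : (∑ x ∈ I, ψ (φ x)) ^ s = ∑ w ∈ tuples I s, ψ (∑ i, φ (w i)) := by
    rw [tuples, sum_piFinset_addChar, prod_const, card_univ, Fintype.card_fin]
  rw [h, sum_mul_sum, sum_product]
  refine sum_congr rfl fun u _ => sum_congr rfl fun w _ => ?_
  rw [pairSum, AddChar.map_add_eq_mul]

theorem coinc_le_of_cover {α β Γ : Type*} [DecidableEq α] [DecidableEq Γ] (X D : Finset α)
    (P : Finset β) (B : β → Finset α) (F : α → Γ) (hB : ∀ x ∈ X, x ∈ D ∨ ∃ q ∈ P, x ∈ B q) :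
    coinc X F X F ≤ coinc D F D F + ∑ q ∈ P, 2 * coinc (B q) F X F := by
  have h : {z ∈ X ×ˢ X | F z.1 = F z.2} ⊆ {z ∈ D ×ˢ D | F z.1 = F z.2} ∪
      P.biUnion fun q => {z ∈ B q ×ˢ X | F z.1 = F z.2} ∪ {z ∈ X ×ˢ B q | F z.1 = F z.2} := by
    intro z hz
    rw [mem_filter, mem_product] at hz
    rw [mem_union, mem_biUnion]
    rcases hB _ hz.1.1 with h1 | ⟨q, hq, h1⟩
    · rcases hB _ hz.1.2 with h2 | ⟨q, hq, h2⟩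
      · exact Or.inl (mem_filter.2 ⟨mem_product.2 ⟨h1, h2⟩, hz.2⟩)
      · exact Or.inr ⟨q, hq, mem_union_right _ (mem_filter.2 ⟨mem_product.2 ⟨hz.1.1, h2⟩, hz.2⟩)⟩
    · exact Or.inr ⟨q, hq, mem_union_left _ (mem_filter.2 ⟨mem_product.2 ⟨h1, hz.1.2⟩, hz.2⟩)⟩
  refine (card_le_card h).trans ((card_union_le _ _).trans (Nat.add_le_add_left ?_ _))
  refine card_biUnion_le.trans (sum_le_sum fun q _ => (card_union_le _ _).trans ?_)
  rw [two_mul]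
  exact Nat.add_le_add_left (coinc_comm X F (B q) F).le _

theorem sum_sq_pow_le {κ : Type*} [Fintype κ] (f : κ → ℝ) {b : ℕ} (hb : 1 ≤ b) :
    (∑ c, f c ^ 2) ^ b ≤ (Fintype.card κ : ℝ) ^ (b - 1) * ∑ c, f c ^ (2 * b) := by
  obtain ⟨b, rfl⟩ := Nat.exists_eq_add_of_le' hb
  refine (pow_sum_le_card_mul_sum_pow (fun _ _ => sq_nonneg _) b).trans (le_of_eq ?_)
  simp_rw [← pow_mul, card_univ, Nat.add_sub_cancel]

theorem energy_add_le {ι κ : Type*} [DecidableEq κ] [Fintype κ] {k : ℕ}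
    (I : Finset ι) (cls : ι → κ) (φ : ι → Fin k → ℤ) (a s : ℕ) (hb : 1 ≤ a + s) :
    (energy I φ (a + s) : ℝ) ≤
      2 * coinc ({u ∈ tuples I a | Function.Injective fun i => cls (u i)} ×ˢ tuples I s) (pairSum φ)
        ({u ∈ tuples I a | Function.Injective fun i => cls (u i)} ×ˢ tuples I s) (pairSum φ) +
      (4 * a ^ 2) ^ (a + s) * Fintype.card κ ^ (a + s - 1) *
        ∑ c, (energy {x ∈ I | cls x = c} φ (a + s) : ℝ) := by
  classical
  set b := a + s with hbdef
  set X := tuples I a ×ˢ tuples I s with hX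
  set D := {u ∈ tuples I a | Function.Injective fun i => cls (u i)} ×ˢ tuples I s with hD
  let B : Fin a × Fin a → Finset ((Fin a → ι) × (Fin s → ι)) := fun q =>
    {u ∈ tuples I a | cls (u q.1) = cls (u q.2)} ×ˢ tuples I s
  have hcov := coinc_le_of_cover X D (univ : Finset (Fin a)).offDiag B (pairSum φ) (by
    intro z hz
    rw [hX, mem_product] at hz
    by_cases hinj : Function.Injective fun i => cls (z.1 i)
    · exact Or.inl (mem_product.2 ⟨mem_filter.2 ⟨hz.1, hinj⟩, hz.2⟩)
    · refine Or.inr ?_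
      simp only [Function.Injective, not_forall] at hinj
      obtain ⟨i, j, h, hij⟩ := hinj
      exact ⟨(i, j), by simp [hij], mem_product.2 ⟨mem_filter.2 ⟨hz.1, h⟩, hz.2⟩⟩)
  obtain ⟨F, hF1, hF2⟩ : ∃ F : Finset (Fin k → ℤ),
      (∀ x ∈ X, ∀ y ∈ X, pairSum φ x - pairSum φ y ∈ F) ∧
      ∀ x ∈ tuples I b, ∀ y ∈ tuples I b, (∑ i, φ (x i)) - ∑ i, φ (y i) ∈ F :=
    ⟨image₂ (fun x y => pairSum φ x - pairSum φ y) X X ∪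
      image₂ (fun x y => ∑ i, φ (x i) - ∑ i, φ (y i)) (tuples I b) (tuples I b),
      fun x hx y hy => mem_union_left _ (mem_image₂_of_mem hx hy),
      fun x hx y hy => mem_union_right _ (mem_image₂.2 ⟨x, hx, y, hy, rfl⟩)⟩
  obtain ⟨n, e, hn, he, hF⟩ := exists_addChar k F
  have hn' : (0 : ℝ) < n := by exact_mod_cast hn
  set f : Fin n → ℝ := fun ω => ‖∑ x ∈ I, e ω (φ x)‖ with hf
  set A : Fin n → ℝ := fun ω => ∑ c, ‖∑ x ∈ I with cls x = c, e ω (φ x)‖ ^ 2 with hA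
  have hf0 : ∀ ω, 0 ≤ f ω := fun ω => norm_nonneg _
  have hA0 : ∀ ω, 0 ≤ A ω := fun ω => sum_nonneg fun c _ => sq_nonneg _
  have hXs : ∀ ω, ‖∑ z ∈ X, e ω (pairSum φ z)‖ = f ω ^ b := by
    intro ω
    rw [hX, sum_addChar_pairSum, tuples, sum_piFinset_addChar, prod_const, card_univ,
      Fintype.card_fin, ← pow_add, norm_pow]
  have hJ : ∑ ω, f ω ^ (2 * b) = n * energy I φ b := sum_norm_pow_eq_coinc he hF I φ b hF2
  have hJX : (energy I φ b : ℝ) = coinc X (pairSum φ) X (pairSum φ) := by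
    have := sum_norm_sq_eq_coinc he hF X (pairSum φ) hF1
    simp_rw [hXs, ← pow_mul, mul_comm b 2, hJ] at this
    exact mul_left_cancel₀ hn'.ne' this
  have hJc : ∀ c, ∑ ω, ‖∑ x ∈ I with cls x = c, e ω (φ x)‖ ^ (2 * b) =
      n * energy {x ∈ I | cls x = c} φ b := fun c =>
    sum_norm_pow_eq_coinc he hF _ φ b fun x hx y hy =>
      hF2 x (tuples_mono (filter_subset _ _) b hx) y (tuples_mono (filter_subset _ _) b hy)
  have hBq : ∀ q ∈ (univ : Finset (Fin a)).offDiag,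
      (n : ℝ) * coinc (B q) (pairSum φ) X (pairSum φ) ≤ ∑ ω, A ω * f ω ^ (2 * b - 2) := by
    intro q hq
    have hq' : q.1 ≠ q.2 := (mem_offDiag.1 hq).2.2
    have ha : 2 ≤ a := by
      have h1 := q.1.2
      have h2 := q.2.2
      have h3 : (q.1 : ℕ) ≠ q.2 := fun h => hq' (Fin.ext h)
      omega
    have hsub : B q ⊆ X := product_subset_product_left (filter_subset _ _)
    have := sum_mul_conj_eq_coinc he hF (B q) (pairSum φ) X (pairSum φ) fun x hx y hy =>
      hF1 x (hsub hx) y hy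
    calc (n : ℝ) * coinc (B q) (pairSum φ) X (pairSum φ)
        = ‖(n : ℂ) * coinc (B q) (pairSum φ) X (pairSum φ)‖ := by simp
      _ ≤ _ := by
        rw [← this]
        refine (norm_sum_le _ _).trans (sum_le_sum fun ω _ => ?_)
        rw [norm_mul, RCLike.norm_conj, hXs, sum_addChar_pairSum, norm_mul, norm_pow]
        have h1 := norm_sum_collision_le (e ω) I cls φ hq'
        have h2 : 2 * b - 2 = (a - 2) + s + b := by omega
        rw [h2, pow_add (f ω) (a - 2 + s) b, pow_add (f ω) (a - 2) s, ← mul_assoc, ← mul_assoc]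
        exact mul_le_mul_of_nonneg_right (mul_le_mul_of_nonneg_right h1
          (pow_nonneg (hf0 ω) _)) (pow_nonneg (hf0 ω) _)
  have hcard : ((univ : Finset (Fin a)).offDiag.card : ℝ) ≤ a ^ 2 := by
    rw [offDiag_card, card_univ, Fintype.card_fin]
    have : a * a - a ≤ a ^ 2 := by rw [sq]; exact Nat.sub_le _ _
    exact_mod_cast this
  have hpt : ∀ ω, 2 * a ^ 2 * (A ω * f ω ^ (2 * b - 2)) ≤
      f ω ^ (2 * b) / 2 + (4 * a ^ 2) ^ b * ((Fintype.card κ : ℝ) ^ (b - 1) *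
        ∑ c, ‖∑ x ∈ I with cls x = c, e ω (φ x)‖ ^ (2 * b)) / 2 := by
    intro ω
    have h1 := mul_pow_pred_le (hA0 ω) (sq_nonneg (f ω)) (c := 2 * a ^ 2) (by positivity) hb
    rw [← pow_mul, ← pow_mul, show 2 * (b - 1) = 2 * b - 2 by omega, mul_pow _ (A ω),
      show (2 * (2 * (a : ℝ) ^ 2)) = 4 * a ^ 2 by ring] at h1
    have h2 := sum_sq_pow_le (fun c => ‖∑ x ∈ I with cls x = c, e ω (φ x)‖) hb
    have h3 := mul_le_mul_of_nonneg_left h2 (by positivity : 0 ≤ (4 * (a : ℝ) ^ 2) ^ b)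
    change (4 * (a : ℝ) ^ 2) ^ b * A ω ^ b ≤ _ at h3
    linarith
  have hsum := sum_le_sum fun ω (_ : ω ∈ univ) => hpt ω
  rw [← mul_sum, sum_add_distrib, ← sum_div, ← sum_div, hJ, ← mul_sum, ← mul_sum, sum_comm] at hsum
  simp_rw [hJc] at hsum
  rw [← mul_sum] at hsum
  have hcov' : (energy I φ b : ℝ) ≤ coinc D (pairSum φ) D (pairSum φ) +
      ∑ q ∈ (univ : Finset (Fin a)).offDiag, 2 * (coinc (B q) (pairSum φ) X (pairSum φ) : ℝ) := by
    rw [hJX]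
    exact_mod_cast hcov
  have hq2 : (n : ℝ) * ∑ q ∈ (univ : Finset (Fin a)).offDiag,
      2 * (coinc (B q) (pairSum φ) X (pairSum φ) : ℝ) ≤
      2 * a ^ 2 * ∑ ω, A ω * f ω ^ (2 * b - 2) := by
    rw [mul_sum]
    calc _ ≤ ∑ q ∈ (univ : Finset (Fin a)).offDiag, 2 * ∑ ω, A ω * f ω ^ (2 * b - 2) :=
          sum_le_sum fun q hq => by linarith [hBq q hq]
      _ ≤ _ := by
        rw [sum_const, nsmul_eq_mul]
        have : 0 ≤ ∑ ω, A ω * f ω ^ (2 * b - 2) :=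
          sum_nonneg fun ω _ => mul_nonneg (hA0 ω) (pow_nonneg (hf0 ω) _)
        nlinarith
  refine le_of_mul_le_mul_left ?_ hn'
  have := mul_le_mul_of_nonneg_left hcov' hn'.le
  linarith

theorem coinc_pairSum_le_of_classes {ι κ : Type*} [DecidableEq κ] [Fintype κ] [Nonempty κ]
    {k a s : ℕ} (D : Finset (Fin a → ι)) (I : Finset ι) (cls : ι → κ) (φ : ι → Fin k → ℤ) {M : ℝ}
    (hM : ∀ c, (coinc (D ×ˢ tuples {x ∈ I | cls x = c} s) (pairSum φ)
      (D ×ˢ tuples {x ∈ I | cls x = c} s) (pairSum φ) : ℝ) ≤ M) :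
    (coinc (D ×ˢ tuples I s) (pairSum φ) (D ×ˢ tuples I s) (pairSum φ) : ℝ) ≤
      (Fintype.card κ : ℝ) ^ (2 * s) * M := by
  classical
  rcases Nat.eq_zero_or_pos s with rfl | hs
  · have hM' := hM (Classical.arbitrary κ)
    have h : tuples {x ∈ I | cls x = Classical.arbitrary κ} 0 = tuples I 0 := by
      ext x
      simp [mem_tuples]
    rw [h] at hM'
    simpa using hM'
  obtain ⟨F, hF1⟩ : ∃ F : Finset (Fin k → ℤ),
      (∀ x ∈ D ×ˢ tuples I s, ∀ y ∈ D ×ˢ tuples I s, pairSum φ x - pairSum φ y ∈ F) :=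
    ⟨image₂ (fun x y => pairSum φ x - pairSum φ y) (D ×ˢ tuples I s) (D ×ˢ tuples I s),
      fun x hx y hy => mem_image₂_of_mem hx hy⟩
  obtain ⟨n, e, hn, he, hF⟩ := exists_addChar k F
  have hn' : (0 : ℝ) < n := by exact_mod_cast hn
  have h1 := sum_norm_sq_eq_coinc he hF _ (pairSum φ) hF1
  have h2 : ∀ c, ∑ ω, ‖∑ z ∈ D ×ˢ tuples {x ∈ I | cls x = c} s, e ω (pairSum φ z)‖ ^ 2 =
      n * coinc (D ×ˢ tuples {x ∈ I | cls x = c} s) (pairSum φ)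
        (D ×ˢ tuples {x ∈ I | cls x = c} s) (pairSum φ) := fun c =>
    sum_norm_sq_eq_coinc he hF _ (pairSum φ) fun x hx y hy =>
      hF1 x (product_subset_product_right (tuples_mono (filter_subset _ _) s) hx) y
        (product_subset_product_right (tuples_mono (filter_subset _ _) s) hy)
  simp_rw [sum_addChar_pairSum, norm_mul, mul_pow, norm_pow, ← pow_mul] at h1 h2
  refine le_of_mul_le_mul_left ?_ hn'
  rw [← h1]
  have hpt : ∀ ω, ‖∑ x ∈ I, e ω (φ x)‖ ^ (s * 2) ≤ (Fintype.card κ : ℝ) ^ (2 * s - 1) *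
      ∑ c, ‖∑ x ∈ I with cls x = c, e ω (φ x)‖ ^ (s * 2) := by
    intro ω
    rw [← sum_fiberwise (s := I) (g := cls)]
    refine (pow_le_pow_left₀ (norm_nonneg _) (norm_sum_le _ _) _).trans ?_
    obtain ⟨r, hr⟩ : ∃ r, s * 2 = r + 1 := ⟨s * 2 - 1, by omega⟩
    rw [hr, show 2 * s - 1 = r by omega]
    exact pow_sum_le_card_mul_sum_pow (fun _ _ => norm_nonneg _) r
  calc _ ≤ ∑ ω, ‖∑ u ∈ D, e ω (∑ i, φ (u i))‖ ^ 2 * ((Fintype.card κ : ℝ) ^ (2 * s - 1) *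
        ∑ c, ‖∑ x ∈ I with cls x = c, e ω (φ x)‖ ^ (s * 2)) :=
        sum_le_sum fun ω _ => mul_le_mul_of_nonneg_left (hpt ω) (sq_nonneg _)
    _ = (Fintype.card κ : ℝ) ^ (2 * s - 1) * ∑ c, ∑ ω, ‖∑ u ∈ D, e ω (∑ i, φ (u i))‖ ^ 2 *
          ‖∑ x ∈ I with cls x = c, e ω (φ x)‖ ^ (s * 2) := by
        rw [sum_comm, mul_sum]
        refine sum_congr rfl fun ω _ => ?_
        rw [mul_left_comm, mul_sum]
    _ ≤ (Fintype.card κ : ℝ) ^ (2 * s - 1) * ∑ c : κ, n * M := by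
        simp_rw [h2]
        exact mul_le_mul_of_nonneg_left (sum_le_sum fun c _ =>
          mul_le_mul_of_nonneg_left (hM c) hn'.le) (by positivity)
    _ = _ := by
        rw [sum_const, card_univ, nsmul_eq_mul]
        obtain ⟨r, hr⟩ : ∃ r, 2 * s = r + 1 := ⟨2 * s - 1, by omega⟩
        rw [hr, Nat.add_sub_cancel, pow_succ]
        ring

/-- The vector of the first `k` powers. -/
def powVec (k : ℕ) (x : ℤ) : Fin k → ℤ := fun j => x ^ ((j : ℕ) + 1)

theorem sum_powVec_add_apply {ι : Type*} {k : ℕ} (S : Finset ι) (x : ι → ℤ) (h : ℤ) (j : Fin k) :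
    ∑ i ∈ S, powVec k (x i + h) j =
      ∑ m ∈ range ((j : ℕ) + 2), h ^ ((j : ℕ) + 1 - m) * ((j : ℕ) + 1).choose m *
        ∑ i ∈ S, x i ^ m := by
  simp_rw [powVec, add_pow, mul_sum]
  rw [sum_comm]
  refine sum_congr rfl fun m _ => sum_congr rfl fun i _ => ?_
  ring

/-- Translation invariance of the system of power sums. -/
theorem sum_powVec_add_eq {ι ι' : Type*} {k : ℕ} {S : Finset ι} {S' : Finset ι'} {x : ι → ℤ}
    {y : ι' → ℤ} (hc : #S = #S') (h : ℤ)
    (hxy : ∑ i ∈ S, powVec k (x i) = ∑ i ∈ S', powVec k (y i)) :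
    ∑ i ∈ S, powVec k (x i + h) = ∑ i ∈ S', powVec k (y i + h) := by
  have h0 : ∀ m ≤ k, ∑ i ∈ S, x i ^ m = ∑ i ∈ S', y i ^ m := by
    intro m hm
    rcases m with _ | m
    · simp [hc]
    · have := congrFun hxy ⟨m, hm⟩
      simpa [powVec] using this
  funext j
  rw [Finset.sum_apply, Finset.sum_apply, sum_powVec_add_apply, sum_powVec_add_apply]
  refine sum_congr rfl fun m hm => ?_
  rw [h0 m (by have := mem_range.1 hm; have := j.2; omega)]

theorem coinc_le_coinc_of_injOn {α β Γ Γ' : Type*} [DecidableEq Γ] [DecidableEq Γ']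
    {S : Finset α} {T : Finset β} {f : α → Γ} {g : β → Γ'} (m : α → β) (hm : ∀ x ∈ S, m x ∈ T)
    (hinj : Set.InjOn m S) (h : ∀ x ∈ S, ∀ y ∈ S, f x = f y → g (m x) = g (m y)) :
    coinc S f S f ≤ coinc T g T g := by
  refine card_le_card_of_injOn (fun z => (m z.1, m z.2)) ?_ ?_
  · intro z hz
    simp only [coe_filter, mem_product, Set.mem_ofPred_eq] at hz ⊢
    exact ⟨⟨hm _ hz.1.1, hm _ hz.1.2⟩, h _ hz.1.1 _ hz.1.2 hz.2⟩
  · intro z hz z' hz' heq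
    simp only [coe_filter, mem_product, Set.mem_ofPred_eq] at hz hz'
    simp only [Prod.mk.injEq] at heq
    exact Prod.ext (hinj hz.1.1 hz'.1.1 heq.1) (hinj hz.1.2 hz'.1.2 heq.2)

/-- The Vinogradov mean value: the number of solutions of the system of power sums of degrees
`1, …, k` in `b + b` variables from `[0, N)`. -/
def vmv (k b N : ℕ) : ℕ := energy (range N) (fun x : ℕ => powVec k x) b

theorem energy_class_le {k b N p : ℕ} (hp : 0 < p) (c : ℕ) :
    energy {x ∈ range N | x % p = c} (fun x : ℕ => powVec k x) b ≤ vmv k b (N / p + 1) := by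
  unfold vmv energy
  refine coinc_le_coinc_of_injOn (fun (x : Fin b → ℕ) i => x i / p) ?_ ?_ ?_
  · intro x hx
    rw [mem_tuples] at hx ⊢
    intro i
    have := mem_range.1 (mem_filter.1 (hx i)).1
    exact mem_range.2 (Nat.lt_succ_of_le (Nat.div_le_div_right this.le))
  · intro x hx y hy h
    rw [mem_coe, mem_tuples] at hx hy
    funext i
    have h1 := (mem_filter.1 (hx i)).2
    have h2 := (mem_filter.1 (hy i)).2
    have h3 : x i / p = y i / p := congrFun h i
    rw [← Nat.div_add_mod (x i) p, ← Nat.div_add_mod (y i) p, h1, h2, h3]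
  · intro x hx y hy h
    rw [mem_tuples] at hx hy
    have hshift := sum_powVec_add_eq (S := univ) (S' := univ) rfl (-(c : ℤ)) h
    have hd : ∀ z : Fin b → ℕ, (∀ i, z i ∈ {x ∈ range N | x % p = c}) → ∀ j : Fin k,
        (∑ i, powVec k ((z i : ℤ) + -(c : ℤ))) j =
          (p : ℤ) ^ ((j : ℕ) + 1) * (∑ i, powVec k ((z i / p : ℕ) : ℤ)) j := by
      intro z hz j
      rw [Finset.sum_apply, Finset.sum_apply, mul_sum]
      refine sum_congr rfl fun i _ => ?_
      have h1 := (mem_filter.1 (hz i)).2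
      have h2 := Nat.div_add_mod (z i) p
      rw [h1] at h2
      have h3 : (z i : ℤ) + -(c : ℤ) = p * ((z i / p : ℕ) : ℤ) := by
        rw [← sub_eq_add_neg, sub_eq_iff_eq_add]
        exact_mod_cast h2.symm
      rw [h3, powVec, powVec, mul_pow]
    funext j
    have h1 := congrFun hshift j
    rw [hd x hx j, hd y hy j] at h1
    exact mul_left_cancel₀ (by positivity) h1

section Newton

variable {R : Type*} [CommRing R]

theorem esymm_eq_of_sum_pow_eq {k : ℕ} {x y : Fin k → R} (hu : ∀ j : ℕ, 1 ≤ j → j ≤ k →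
    IsUnit (j : R)) (h : ∀ j, 1 ≤ j → j ≤ k → ∑ i, x i ^ j = ∑ i, y i ^ j) :
    ∀ j ≤ k, MvPolynomial.aeval x (MvPolynomial.esymm (Fin k) R j) =
      MvPolynomial.aeval y (MvPolynomial.esymm (Fin k) R j) := by
  intro j
  induction j using Nat.strong_induction_on with
  | _ j ih =>
    intro hj
    rcases Nat.eq_zero_or_pos j with rfl | hj0
    · simp
    refine (hu j hj0 hj).mul_left_cancel ?_
    have key := MvPolynomial.mul_esymm_eq_sum (Fin k) R j
    have hx := congrArg (MvPolynomial.aeval x) key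
    have hy := congrArg (MvPolynomial.aeval y) key
    simp only [map_mul, map_natCast, map_pow, map_neg, map_one, map_sum] at hx hy
    rw [hx, hy]
    congr 1
    refine sum_congr rfl fun a ha => ?_
    rw [mem_filter, HasAntidiagonal.mem_antidiagonal] at ha
    rw [ih a.1 ha.2 (by omega)]
    congr 1
    simp only [MvPolynomial.psum, map_sum, map_pow, MvPolynomial.aeval_X]
    exact h a.2 (by omega) (by omega)

theorem prod_sub_eq_zero_of_sum_pow_eq {k : ℕ} {x y : Fin k → R} (hu : ∀ j : ℕ, 1 ≤ j → j ≤ k →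
    IsUnit (j : R)) (h : ∀ j, 1 ≤ j → j ≤ k → ∑ i, x i ^ j = ∑ i, y i ^ j) (i : Fin k) :
    ∏ l, (x i - y l) = 0 := by
  have hexp : ∀ z : Fin k → R, ∏ l, (x i - z l) = ∑ j ∈ range (k + 1),
      (-1) ^ j * (MvPolynomial.aeval z (MvPolynomial.esymm (Fin k) R j) * x i ^ (k - j)) := by
    intro z
    have := congrArg (Polynomial.eval (x i))
      (Multiset.prod_X_sub_X_eq_sum_esymm (Finset.univ.val.map z))
    rw [Multiset.map_map] at this
    simp only [Multiset.card_map, card_val, card_univ, Fintype.card_fin] at this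
    rw [Polynomial.eval_multiset_prod, Multiset.map_map, Polynomial.eval_finsetSum] at this
    simp only [Function.comp_def, Polynomial.eval_sub, Polynomial.eval_X, Polynomial.eval_C,
      Polynomial.eval_mul, Polynomial.eval_pow, Polynomial.eval_neg, Polynomial.eval_one] at this
    simp only [MvPolynomial.aeval_esymm_eq_multiset_esymm]
    exact this
  have hxy : ∏ l, (x i - y l) = ∏ l, (x i - x l) := by
    rw [hexp y, hexp x]
    refine sum_congr rfl fun j hj => ?_
    rw [esymm_eq_of_sum_pow_eq hu h j (Nat.lt_succ_iff.1 (mem_range.1 hj))]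
  rw [hxy]
  exact prod_eq_zero (mem_univ i) (sub_self _)

end Newton

theorem card_le_of_power_residues {k p N : ℕ} (hp : p.Prime) (hk : k < p) (hN : N ≤ p ^ k)
    (c : ℤ) (r : Fin k → ZMod (p ^ k)) :
    #{u ∈ tuples (range N) k | (Function.Injective fun i => u i % p) ∧
      ∀ j : Fin k, ∑ i, (((u i : ℤ) - c : ℤ) : ZMod (p ^ k)) ^ ((j : ℕ) + 1) = r j} ≤ k ^ k := by
  rcases Finset.eq_empty_or_nonempty {u ∈ tuples (range N) k | (Function.Injective fun i => u i % p)
      ∧ ∀ j : Fin k, ∑ i, (((u i : ℤ) - c : ℤ) : ZMod (p ^ k)) ^ ((j : ℕ) + 1) = r j}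
      with h0 | ⟨v, hv⟩
  · rw [h0]
    exact Nat.zero_le _
  have hunit : ∀ j : ℕ, 1 ≤ j → j ≤ k → IsUnit (j : ZMod (p ^ k)) := by
    intro j h1 h2
    rw [ZMod.isUnit_iff_coprime]
    exact Nat.Coprime.pow_right k ((Nat.coprime_of_lt_prime (by omega) (h2.trans_lt hk) hp).symm)
  rw [mem_filter, mem_tuples] at hv
  obtain ⟨hv1, hv2, hv3⟩ := hv
  have hsub : {u ∈ tuples (range N) k | (Function.Injective fun i => u i % p) ∧
      ∀ j : Fin k, ∑ i, (((u i : ℤ) - c : ℤ) : ZMod (p ^ k)) ^ ((j : ℕ) + 1) = r j} ⊆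
      tuples (image v univ) k := by
    intro u hu
    rw [mem_filter, mem_tuples] at hu
    obtain ⟨hu1, hu2, hu3⟩ := hu
    rw [mem_tuples]
    intro i
    have hz := prod_sub_eq_zero_of_sum_pow_eq hunit
      (x := fun i => (((u i : ℤ) - c : ℤ) : ZMod (p ^ k)))
      (y := fun i => (((v i : ℤ) - c : ℤ) : ZMod (p ^ k))) (fun j h1 h2 => by
        obtain ⟨j, rfl⟩ := Nat.exists_eq_add_of_le' h1
        rw [hu3 ⟨j, h2⟩, hv3 ⟨j, h2⟩]) i
    have hz' : ((p ^ k : ℕ) : ℤ) ∣ ∏ l, ((u i : ℤ) - v l) := by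
      rw [← ZMod.intCast_zmod_eq_zero_iff_dvd, ← hz]
      push_cast
      exact prod_congr rfl fun l _ => by ring
    by_cases hex : ∃ l, (p : ℤ) ∣ (u i : ℤ) - v l
    · obtain ⟨l, hl⟩ := hex
      have hcop : IsCoprime ((p ^ k : ℕ) : ℤ) (∏ l' ∈ univ.erase l, ((u i : ℤ) - v l')) := by
        rw [Nat.cast_pow]
        refine IsCoprime.pow_left (IsCoprime.prod_right fun l' hl' => ?_)
        rw [Prime.coprime_iff_not_dvd (Nat.prime_iff_prime_int.1 hp)]
        intro hd
        refine (mem_erase.1 hl').1 (hv2 ?_)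
        have := dvd_sub hl hd
        have h3 : (p : ℤ) ∣ (v l' : ℤ) - v l := by convert! this using 1; ring
        exact ((Nat.modEq_iff_dvd).2 h3).symm
      rw [← mul_prod_erase univ _ (mem_univ l)] at hz'
      have hd := hcop.dvd_of_dvd_mul_right hz'
      have h1 := mem_range.1 (hu1 i)
      have h2 := mem_range.1 (hv1 l)
      have h3 : (u i : ℤ) - v l = 0 := by
        refine Int.eq_zero_of_abs_lt_dvd hd ?_
        rw [abs_lt]
        have : (N : ℤ) ≤ (p ^ k : ℕ) := by exact_mod_cast hN
        constructor <;> omega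
      exact mem_image.2 ⟨l, mem_univ _, by omega⟩
    · exfalso
      push Not at hex
      have hk0 : k ≠ 0 := fun h => by subst h; exact i.elim0
      have : (p : ℤ) ∣ ∏ l, ((u i : ℤ) - v l) :=
        (dvd_pow_self (p : ℤ) hk0).trans (by exact_mod_cast hz')
      obtain ⟨l, _, hl⟩ := (Prime.dvd_finsetProd_iff (Nat.prime_iff_prime_int.1 hp) _).1 this
      exact hex l hl
  refine (card_le_card hsub).trans ?_
  rw [tuples, Fintype.card_piFinset, prod_const, card_univ, Fintype.card_fin]
  exact Nat.pow_le_pow_left (card_image_le.trans (by simp)) k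

theorem exists_residues {p k j : ℕ} (hp : p.Prime) (hj : j ≤ k) (r : ℤ) :
    ∃ S : Finset (ZMod (p ^ k)), #S ≤ p ^ (k - j) ∧
      ∀ z : ℤ, (p : ℤ) ^ j ∣ z - r → (z : ZMod (p ^ k)) ∈ S := by
  refine ⟨image (fun i : ℕ => ((r + p ^ j * i : ℤ) : ZMod (p ^ k))) (range (p ^ (k - j))),
    card_image_le.trans (by simp), fun z hz => ?_⟩
  obtain ⟨w, hw⟩ := hz
  have hp0 : (0 : ℤ) < p ^ (k - j) := by have := hp.pos; positivity
  refine mem_image.2 ⟨(w % p ^ (k - j)).toNat, ?_, ?_⟩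
  · rw [mem_range]
    zify
    rw [Int.toNat_of_nonneg (Int.emod_nonneg _ hp0.ne')]
    exact Int.emod_lt_of_pos _ hp0
  · rw [Int.toNat_of_nonneg (Int.emod_nonneg _ hp0.ne'), ← sub_eq_zero, ← Int.cast_sub,
      ZMod.intCast_zmod_eq_zero_iff_dvd]
    refine ⟨-(w / p ^ (k - j)), ?_⟩
    have h1 := Int.emod_add_mul_ediv w (p ^ (k - j))
    have h2 : z = r + p ^ j * w := by linarith
    have h3 : ((p ^ k : ℕ) : ℤ) = p ^ j * p ^ (k - j) := by
      rw [← pow_add, Nat.add_sub_cancel' hj]; push_cast; rfl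
    rw [h2, h3]
    nth_rewrite 2 [← h1]
    ring

/-- Linnik's lemma on the number of solutions of a system of congruences. -/
theorem card_linnik_le {k p N : ℕ} (hp : p.Prime) (hk : k < p) (hN : N ≤ p ^ k)
    (c : ℤ) (r : Fin k → ℤ) :
    #{u ∈ tuples (range N) k | (Function.Injective fun i => u i % p) ∧
      ∀ j : Fin k, (p : ℤ) ^ ((j : ℕ) + 1) ∣ ∑ i, ((u i : ℤ) - c) ^ ((j : ℕ) + 1) - r j} ≤
      k ^ k * p ^ (k * (k - 1) / 2) := by
  classical
  have hS := fun j : Fin k => exists_residues (k := k) (j := (j : ℕ) + 1) hp j.2 (r j)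
  choose S hScard hS using hS
  have hprod : #(Fintype.piFinset S) ≤ p ^ (k * (k - 1) / 2) := by
    rw [Fintype.card_piFinset, ← Finset.sum_range_id, ← Finset.sum_range_reflect,
      ← prod_pow_eq_pow_sum, ← Fin.prod_univ_eq_prod_range (fun j => p ^ (k - 1 - j))]
    refine prod_le_prod' fun j _ => (hScard j).trans (le_of_eq ?_)
    congr 1
    omega
  refine (card_le_mul_card_image_of_maps_to (f := fun (u : Fin k → ℕ) (j : Fin k) =>
    ∑ i, (((u i : ℤ) - c : ℤ) : ZMod (p ^ k)) ^ ((j : ℕ) + 1)) (t := Fintype.piFinset S)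
    ?_ (k ^ k) ?_).trans (Nat.mul_le_mul_left _ hprod)
  · intro u hu
    rw [Fintype.mem_piFinset]
    intro j
    have := hS j _ ((mem_filter.1 hu).2.2 j)
    push_cast at this ⊢
    exact this
  · intro t _
    refine le_trans (card_le_card fun u hu => ?_) (card_le_of_power_residues hp hk hN c t)
    rw [mem_filter, mem_filter] at hu
    exact mem_filter.2 ⟨hu.1.1, hu.1.2.1, fun j => congrFun hu.2 j⟩

theorem coinc_pairSum_class_le {k p N s : ℕ} (hp : p.Prime) (hk : k < p) (hN : N ≤ p ^ k)
    (c : ℕ) (D : Finset (Fin k → ℕ))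
    (hD : ∀ u ∈ D, u ∈ tuples (range N) k ∧ Function.Injective fun i => u i % p) :
    coinc (D ×ˢ tuples {x ∈ range N | x % p = c} s) (pairSum fun x : ℕ => powVec k x)
      (D ×ˢ tuples {x ∈ range N | x % p = c} s) (pairSum fun x : ℕ => powVec k x) ≤
      N ^ k * (k ^ k * p ^ (k * (k - 1) / 2)) * vmv k s (N / p + 1) := by
  classical
  set W := tuples {x ∈ range N | x % p = c} s with hW
  set ψ : (Fin k → ℕ) → Fin k → ℤ := fun u => ∑ i, powVec k (u i) with hψ
  set χ : (Fin s → ℕ) → Fin k → ℤ := fun u => ∑ i, powVec k (u i) with hχ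
  have hshift : ∀ w ∈ W, ∀ j : Fin k,
      (p : ℤ) ^ ((j : ℕ) + 1) ∣ ∑ i, ((w i : ℤ) - c) ^ ((j : ℕ) + 1) := by
    intro w hw j
    refine dvd_sum fun i _ => pow_dvd_pow_of_dvd ?_ _
    have h := (mem_filter.1 (mem_tuples.1 hw i)).2
    rw [← h]
    exact (Nat.modEq_iff_dvd).1 (Nat.mod_modEq _ _)
  set Q : Finset ((Fin k → ℕ) × (Fin k → ℕ)) := {q ∈ D ×ˢ D | ∀ j : Fin k,
    (p : ℤ) ^ ((j : ℕ) + 1) ∣ ∑ i, ((q.1 i : ℤ) - c) ^ ((j : ℕ) + 1) -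
      ∑ i, ((q.2 i : ℤ) - c) ^ ((j : ℕ) + 1)} with hQ
  have hQcard : #Q ≤ N ^ k * (k ^ k * p ^ (k * (k - 1) / 2)) := by
    have hDc : #D ≤ N ^ k := by
      refine (card_le_card fun u hu => (hD u hu).1).trans ?_
      rw [tuples, Fintype.card_piFinset, prod_const, card_univ, Fintype.card_fin, card_range]
    rw [mul_comm]
    refine (card_le_mul_card_image_of_maps_to (f := Prod.snd) (t := D) ?_ _ ?_).trans
      (Nat.mul_le_mul_left _ hDc)
    · exact fun q hq => (mem_product.1 (mem_filter.1 hq).1).2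
    · intro v _
      refine le_trans (card_le_card_of_injOn Prod.fst ?_ ?_) (card_linnik_le hp hk hN c
        fun j => ∑ i, ((v i : ℤ) - c) ^ ((j : ℕ) + 1))
      · intro q hq
        rw [mem_coe, mem_filter] at hq
        obtain ⟨hq, rfl⟩ := hq
        rw [hQ, mem_filter, mem_product] at hq
        rw [mem_coe, mem_filter]
        exact ⟨(hD _ hq.1.1).1, (hD _ hq.1.1).2, hq.2⟩
      · intro q hq q' hq' h
        rw [mem_coe, mem_filter] at hq hq'
        exact Prod.ext h (hq.2.trans hq'.2.symm)
  have hmaps : ∀ z ∈ ({z ∈ (D ×ˢ W) ×ˢ (D ×ˢ W) | pairSum (fun x : ℕ => powVec k x) z.1 =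
      pairSum (fun x : ℕ => powVec k x) z.2} : Finset _), (z.1.1, z.2.1) ∈ Q := by
    intro z hz
    simp only [mem_filter, mem_product] at hz
    obtain ⟨⟨⟨h1, h2⟩, h3, h4⟩, h5⟩ := hz
    refine mem_filter.2 ⟨mem_product.2 ⟨h1, h3⟩, fun j => ?_⟩
    have h6 := sum_powVec_add_eq (k := k) (S := (univ : Finset (Fin k ⊕ Fin s)))
      (S' := (univ : Finset (Fin k ⊕ Fin s)))
      (x := Sum.elim (fun i => (z.1.1 i : ℤ)) fun i => (z.1.2 i : ℤ))
      (y := Sum.elim (fun i => (z.2.1 i : ℤ)) fun i => (z.2.2 i : ℤ)) rfl (-(c : ℤ)) (by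
        rw [Fintype.sum_sum_type, Fintype.sum_sum_type]
        exact h5)
    have h7 := congrFun h6 j
    rw [Finset.sum_apply, Finset.sum_apply, Fintype.sum_sum_type, Fintype.sum_sum_type] at h7
    simp only [Sum.elim_inl, Sum.elim_inr, powVec, ← sub_eq_add_neg] at h7
    have h8 := dvd_sub (hshift _ h4 j) (hshift _ h2 j)
    convert! h8 using 1
    linarith
  refine (card_le_mul_card_image_of_maps_to (f := fun z => (z.1.1, z.2.1)) (t := Q) hmaps
    (vmv k s (N / p + 1)) ?_).trans ?_
  · intro q _
    refine le_trans ?_ ((coinc_add_right_le W χ (ψ q.2 - ψ q.1)).trans (energy_class_le hp.pos c))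
    refine card_le_card_of_injOn (fun z => (z.1.2, z.2.2)) ?_ ?_
    · intro z hz
      rw [mem_coe, mem_filter, mem_filter] at hz
      simp only [mem_product] at hz
      obtain ⟨⟨⟨⟨h1, h2⟩, h3, h4⟩, h5⟩, rfl⟩ := hz
      rw [mem_coe, mem_filter]
      refine ⟨mem_product.2 ⟨h2, h4⟩, ?_⟩
      have h6 : ψ z.1.1 + χ z.1.2 = ψ z.2.1 + χ z.2.2 := h5
      change χ z.1.2 = χ z.2.2 + (ψ z.2.1 - ψ z.1.1)
      rw [eq_sub_of_add_eq' h6]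
      abel
    · intro z hz z' hz' h
      rw [mem_coe, mem_filter] at hz hz'
      have h1 := hz.2.trans hz'.2.symm
      simp only [Prod.mk.injEq] at h h1
      exact Prod.ext (Prod.ext h1.1 h.1) (Prod.ext h1.2 h.2)
  · rw [mul_comm]
    exact Nat.mul_le_mul_right _ hQcard

/-- The recursive inequality for the Vinogradov mean value. -/
theorem vmv_recursion {k p N s : ℕ} (hp : p.Prime) (hk0 : 1 ≤ k) (hk : k < p) (hN : N ≤ p ^ k) :
    (vmv k (k + s) N : ℝ) ≤
      2 * ((p : ℝ) ^ (2 * s) * (N ^ k * (k ^ k * p ^ (k * (k - 1) / 2)) *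
        vmv k s (N / p + 1))) +
      (4 * k ^ 2 * p) ^ (k + s) * vmv k (k + s) (N / p + 1) := by
  have : NeZero p := ⟨hp.ne_zero⟩
  let cls : ℕ → Fin p := fun x => ⟨x % p, Nat.mod_lt _ hp.pos⟩
  have hcls : ∀ c : Fin p, {x ∈ range N | cls x = c} = {x ∈ range N | x % p = (c : ℕ)} := by
    intro c
    refine filter_congr fun x _ => ?_
    exact Fin.ext_iff
  have h1 := energy_add_le (range N) cls (fun x : ℕ => powVec k x) k s (by omega)
  have h2 := coinc_pairSum_le_of_classes (s := s)
    {u ∈ tuples (range N) k | Function.Injective fun i => cls (u i)} (range N) cls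
    (fun x : ℕ => powVec k x) (M := N ^ k * (k ^ k * p ^ (k * (k - 1) / 2)) *
        vmv k s (N / p + 1)) (by
      intro c
      rw [hcls]
      have := coinc_pairSum_class_le (s := s) hp hk hN c
        {u ∈ tuples (range N) k | Function.Injective fun i => cls (u i)} fun u hu => by
          rw [mem_filter] at hu
          exact ⟨hu.1, fun i j hij => hu.2 (Fin.ext hij)⟩
      refine (Nat.cast_le.2 this).trans (le_of_eq ?_)
      push_cast
      rfl)
  have h3 : ∑ c : Fin p, (energy {x ∈ range N | cls x = c} (fun x : ℕ => powVec k x) (k + s) : ℝ)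
      ≤ p * vmv k (k + s) (N / p + 1) := by
    calc _ ≤ ∑ c : Fin p, (vmv k (k + s) (N / p + 1) : ℝ) := by
          refine sum_le_sum fun c _ => ?_
          rw [hcls]
          exact_mod_cast energy_class_le hp.pos c
      _ = _ := by simp
  rw [Fintype.card_fin] at h1 h2
  refine h1.trans (add_le_add (mul_le_mul_of_nonneg_left h2 zero_le_two) ?_)
  refine (mul_le_mul_of_nonneg_left h3 (by positivity)).trans (le_of_eq ?_)
  obtain ⟨r, hr⟩ : ∃ r, k + s = r + 1 := ⟨k + s - 1, by omega⟩
  rw [hr, Nat.add_sub_cancel, mul_pow]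
  ring

theorem vmv_le_pow (k b N : ℕ) : vmv k b N ≤ N ^ (2 * b) := by
  unfold vmv energy coinc
  refine (card_filter_le _ _).trans ?_
  rw [card_product, tuples, Fintype.card_piFinset, prod_const, card_univ, Fintype.card_fin,
    card_range, ← pow_add, two_mul]

theorem exists_prime_near_root {k N : ℕ} (hk : 1 ≤ k) (hN : 1 ≤ N) :
    ∃ p : ℕ, p.Prime ∧ N ≤ p ^ k ∧ (N : ℝ) ^ (1 / (k : ℝ)) ≤ p ∧
      (p : ℝ) ≤ 4 * (N : ℝ) ^ (1 / (k : ℝ)) := by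
  have hN' : (1 : ℝ) ≤ N := by exact_mod_cast hN
  have hk' : (0 : ℝ) < k := by exact_mod_cast hk
  set y : ℝ := (N : ℝ) ^ (1 / (k : ℝ)) with hy
  have hy1 : 1 ≤ y := Real.one_le_rpow hN' (by positivity)
  obtain ⟨p, hp, h1, h2⟩ := Nat.exists_prime_lt_and_le_two_mul ⌈y⌉₊
    (Nat.ceil_pos.2 (by linarith)).ne'
  have h3 : y ≤ p := (Nat.le_ceil y).trans (by exact_mod_cast h1.le)
  refine ⟨p, hp, ?_, h3, ?_⟩
  · have : (N : ℝ) ≤ (p : ℝ) ^ k := by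
      calc (N : ℝ) = y ^ k := by
            rw [hy, ← Real.rpow_natCast, ← Real.rpow_mul (by linarith), one_div,
              inv_mul_cancel₀ hk'.ne', Real.rpow_one]
        _ ≤ _ := pow_le_pow_left₀ (by linarith) h3 k
    exact_mod_cast this
  · have h4 : (p : ℝ) ≤ 2 * ⌈y⌉₊ := by exact_mod_cast h2
    have h5 := Nat.ceil_lt_add_one (by linarith : 0 ≤ y)
    linarith

/-- The exponent in the bound for the Vinogradov mean value with `k * r` variables. -/
noncomputable def vmvExp (k r : ℕ) : ℝ :=
  2 * k * r - k * (k + 1) / 2 + k * (k + 1) / 2 * (1 - 1 / (k : ℝ)) ^ r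

/-- The constant in the bound for the Vinogradov mean value with `k * r` variables. -/
noncomputable def vmvConst (k r : ℕ) : ℝ :=
  (32 * k ^ 2) ^ (4 * k ^ 3) * (4 * k ^ k * 4 ^ k ^ 2) ^ r * 2 ^ (2 * k * r ^ 2)

section Exponent

variable {k : ℕ}

theorem one_sub_inv_mem (hk : 2 ≤ k) : 0 ≤ 1 - 1 / (k : ℝ) ∧ 1 - 1 / (k : ℝ) ≤ 1 := by
  have hk' : (2 : ℝ) ≤ k := by exact_mod_cast hk
  have h1 : 1 / (k : ℝ) ≤ 1 := by rw [div_le_one (by linarith)]; linarith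
  have h2 : 0 ≤ 1 / (k : ℝ) := by positivity
  constructor <;> linarith

theorem vmvExp_le (hk : 2 ≤ k) (r : ℕ) : vmvExp k r ≤ 2 * k * r := by
  have h := one_sub_inv_mem hk
  have h2 := mul_le_mul_of_nonneg_left (pow_le_one₀ h.1 h.2 (n := r))
    (by positivity : (0 : ℝ) ≤ k * (k + 1) / 2)
  unfold vmvExp
  linarith

theorem vmvExp_ge (hk : 2 ≤ k) (r : ℕ) : 2 * k * r - (k + 1) * r / 2 ≤ vmvExp k r := by
  have hk' : (2 : ℝ) ≤ k := by exact_mod_cast hk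
  have h := one_sub_inv_mem hk
  have h1 := one_add_mul_le_pow (show -2 ≤ -(1 / (k : ℝ)) by linarith) r
  rw [← sub_eq_add_neg] at h1
  have h2 := mul_le_mul_of_nonneg_left h1 (by positivity : (0 : ℝ) ≤ k * (k + 1) / 2)
  have h3 : (k : ℝ) * (k + 1) / 2 * (1 + r * -(1 / (k : ℝ))) =
      k * (k + 1) / 2 - (k + 1) * r / 2 := by
    field_simp
    ring
  unfold vmvExp
  linarith

theorem vmvExp_nonneg (hk : 2 ≤ k) (r : ℕ) : 0 ≤ vmvExp k r := by
  have hk' : (2 : ℝ) ≤ k := by exact_mod_cast hk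
  have h := vmvExp_ge hk r
  have : 0 ≤ (r : ℝ) * (3 * k - 1) := mul_nonneg (Nat.cast_nonneg r) (by linarith)
  linarith

theorem vmvExp_succ (hk : 2 ≤ k) (r : ℕ) :
    vmvExp k (r + 1) =
      vmvExp k r + k + (k ^ 2 - (vmvExp k r - 2 * k * r + k * (k + 1) / 2)) / k := by
  have hk' : (2 : ℝ) ≤ k := by exact_mod_cast hk
  unfold vmvExp
  rw [pow_succ]
  push_cast
  field_simp
  ring

end Exponent

theorem vmvConst_pos {k : ℕ} (hk : 2 ≤ k) (r : ℕ) : 0 < vmvConst k r := by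
  have hk' : (2 : ℝ) ≤ k := by exact_mod_cast hk
  unfold vmvConst
  positivity

theorem vmvConst_succ_ge {k : ℕ} (hk : 2 ≤ k) (r : ℕ) :
    4 * (k : ℝ) ^ k * 4 ^ k ^ 2 * 2 ^ (2 * k * r) * vmvConst k r ≤ vmvConst k (r + 1) := by
  have hk' : (2 : ℝ) ≤ k := by exact_mod_cast hk
  unfold vmvConst
  have h1 : (2 : ℝ) ^ (2 * k * r) * 2 ^ (2 * k * r ^ 2) ≤ 2 ^ (2 * k * (r + 1) ^ 2) := by
    rw [← pow_add]
    refine pow_le_pow_right₀ (by norm_num) ?_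
    nlinarith [Nat.zero_le (k * r)]
  calc _ = (32 * (k : ℝ) ^ 2) ^ (4 * k ^ 3) * (4 * k ^ k * 4 ^ k ^ 2) ^ (r + 1) *
        (2 ^ (2 * k * r) * 2 ^ (2 * k * r ^ 2)) := by rw [pow_succ]; ring
    _ ≤ _ := mul_le_mul_of_nonneg_left h1 (by positivity)

theorem vmv_first_term {k r : ℕ} (hk : 2 ≤ k) {N p : ℝ} (hN : 1 ≤ N) (hp : 1 ≤ p)
    (hpN : p ≤ 4 * N ^ (1 / (k : ℝ))) :
    p ^ (2 * (k * r)) * (N ^ k * (k ^ k * p ^ (k * (k - 1) / 2)) *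
      (vmvConst k r * (2 * N / p) ^ vmvExp k r)) ≤
      vmvConst k (r + 1) / 4 * N ^ vmvExp k (r + 1) := by
  have hk' : (2 : ℝ) ≤ k := by exact_mod_cast hk
  have hN0 : 0 < N := by linarith
  have hp0 : 0 < p := by linarith
  have hE := vmvExp_nonneg hk r
  have hE2 := vmvExp_le hk r
  have hm : (((k * (k - 1) / 2 : ℕ)) : ℝ) = k * (k - 1) / 2 := by
    rw [Nat.cast_div (even_iff_two_dvd.1 (Nat.even_mul_pred_self k)) (by norm_num), Nat.cast_mul,
      Nat.cast_sub (by omega)]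
    norm_num
  set L := Real.log N with hL
  set l := Real.log p with hl
  have hL0 : 0 ≤ L := Real.log_nonneg hN
  have hlL : l ≤ Real.log 4 + L / k := by
    have := Real.log_le_log hp0 hpN
    rw [Real.log_mul (by norm_num) (by positivity), Real.log_rpow hN0] at this
    rw [hl, hL]
    convert! this using 2
    ring
  have key : p ^ (2 * (k * r)) * N ^ k * p ^ (k * (k - 1) / 2) * (2 * N / p) ^ vmvExp k r ≤
      4 ^ k ^ 2 * 2 ^ (2 * k * r) * N ^ vmvExp k (r + 1) := by
    rw [← Real.log_le_log_iff (by positivity) (by positivity), Real.log_mul (by positivity)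
      (by positivity), Real.log_mul (by positivity) (by positivity), Real.log_mul (by positivity)
      (by positivity), Real.log_mul (by positivity) (by positivity), Real.log_mul (by positivity)
      (by positivity), Real.log_rpow (by positivity), Real.log_rpow (by positivity),
      Real.log_pow, Real.log_pow, Real.log_pow, Real.log_pow, Real.log_pow,
      Real.log_div (by positivity) hp0.ne', Real.log_mul (by norm_num) hN0.ne', hm, ← hL, ← hl,
      vmvExp_succ hk r]
    push_cast
    set T := vmvExp k r with hT
    have hg : 0 ≤ (k : ℝ) ^ 2 - (T - 2 * k * r + k * (k + 1) / 2) := by nlinarith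
    have h1 := mul_le_mul_of_nonneg_left hlL hg
    have h2 : ((k : ℝ) ^ 2 - (T - 2 * k * r + k * (k + 1) / 2)) * (L / k) =
      ((k : ℝ) ^ 2 - (T - 2 * k * r + k * (k + 1) / 2)) / k * L := by ring
    have h3 : T * Real.log 2 ≤ 2 * k * r * Real.log 2 :=
      mul_le_mul_of_nonneg_right hE2 (Real.log_nonneg (by norm_num))
    have h4 : 0 ≤ (T - 2 * k * r + k * (k + 1) / 2) * Real.log 4 := by
      refine mul_nonneg ?_ (Real.log_nonneg (by norm_num))
      rw [hT, vmvExp]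
      have := pow_nonneg (one_sub_inv_mem hk).1 r
      have : 0 ≤ (k : ℝ) * (k + 1) / 2 * (1 - 1 / (k : ℝ)) ^ r := by positivity
      linarith
    nlinarith
  have hc := vmvConst_succ_ge hk r
  have hc0 := vmvConst_pos hk r
  calc _ = (k : ℝ) ^ k * vmvConst k r * (p ^ (2 * (k * r)) * N ^ k * p ^ (k * (k - 1) / 2) *
        (2 * N / p) ^ vmvExp k r) := by ring
    _ ≤ (k : ℝ) ^ k * vmvConst k r * (4 ^ k ^ 2 * 2 ^ (2 * k * r) * N ^ vmvExp k (r + 1)) :=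
        mul_le_mul_of_nonneg_left key (by positivity)
    _ = (4 * (k : ℝ) ^ k * 4 ^ k ^ 2 * 2 ^ (2 * k * r) * vmvConst k r) / 4 *
        N ^ vmvExp k (r + 1) := by ring
    _ ≤ _ := by gcongr

theorem vmv_second_term {k r : ℕ} (hk : 2 ≤ k) {N p : ℝ} (hN : 1 ≤ N)
    (hp : (32 * (k : ℝ) ^ 2) ^ 4 ≤ p) :
    (4 * (k : ℝ) ^ 2 * p) ^ (k * (r + 1)) * (2 * N / p) ^ vmvExp k (r + 1) ≤
      N ^ vmvExp k (r + 1) / 2 := by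
  have hk' : (2 : ℝ) ≤ k := by exact_mod_cast hk
  have hN0 : 0 < N := by linarith
  have hp0 : 0 < p := lt_of_lt_of_le (by positivity) hp
  have hE2 := vmvExp_le hk (r + 1)
  have hE3 := vmvExp_ge hk (r + 1)
  set T := vmvExp k (r + 1)
  rw [← Real.log_le_log_iff (by positivity) (by positivity), Real.log_mul (by positivity)
      (by positivity), Real.log_div (by positivity) (by norm_num), Real.log_rpow (by positivity),
      Real.log_rpow (by positivity), Real.log_pow, Real.log_div (by positivity) hp0.ne',
      Real.log_mul (by norm_num) hN0.ne', Real.log_mul (by positivity) hp0.ne']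
  push_cast at hE2 hE3 ⊢
  have hl := Real.log_le_log (by positivity) hp
  have h32 : Real.log (32 * (k : ℝ) ^ 2) = 3 * Real.log 2 + Real.log (4 * (k : ℝ) ^ 2) := by
    rw [show (32 * (k : ℝ) ^ 2) = 2 ^ 3 * (4 * (k : ℝ) ^ 2) by ring,
      Real.log_mul (by positivity) (by positivity), Real.log_pow]
    norm_num
  rw [Real.log_pow, h32] at hl
  push_cast at hl
  have h2 : 0 < Real.log 2 := Real.log_pos (by norm_num)
  have h4 : 0 ≤ Real.log (4 * (k : ℝ) ^ 2) := Real.log_nonneg (by nlinarith)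
  have hb : (1 : ℝ) ≤ k * (r + 1) := by nlinarith [Nat.cast_nonneg (α := ℝ) r]
  have hTb : (k : ℝ) * (r + 1) / 4 ≤ T - k * (r + 1) := by
    nlinarith [Nat.cast_nonneg (α := ℝ) r]
  have hp1 : 0 ≤ Real.log p := by linarith
  have e1 := mul_le_mul_of_nonneg_right hTb hp1
  have e2 := mul_le_mul_of_nonneg_left hl (by linarith : 0 ≤ (k : ℝ) * (r + 1) / 4)
  have e3 := mul_le_mul_of_nonneg_right hE2 h2.le
  have e4 := mul_le_mul_of_nonneg_right hb h2.le
  nlinarith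

/-- Vinogradov's mean value theorem. -/
theorem vmv_le {k : ℕ} (hk : 2 ≤ k) (r : ℕ) : ∀ N : ℕ, 1 ≤ N →
    (vmv k (k * r) N : ℝ) ≤ vmvConst k r * (N : ℝ) ^ vmvExp k r := by
  have hk' : (2 : ℝ) ≤ k := by exact_mod_cast hk
  induction r with
  | zero =>
    intro N hN
    have h1 : vmvExp k 0 = 0 := by simp [vmvExp]
    have h2 : (1 : ℝ) ≤ vmvConst k 0 := by
      simp only [vmvConst, pow_zero, mul_one, ne_eq, OfNat.ofNat_ne_zero, not_false_eq_true,
        zero_pow, mul_zero]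
      exact one_le_pow₀ (by nlinarith)
    have h3 : (vmv k (k * 0) N : ℝ) ≤ 1 := by exact_mod_cast vmv_le_pow k 0 N
    rw [h1, Real.rpow_zero, mul_one]
    exact h3.trans h2
  | succ r ih =>
    intro N
    induction N using Nat.strong_induction_on with
    | _ N ihN =>
    intro hN
    have hN' : (1 : ℝ) ≤ N := by exact_mod_cast hN
    have hE := vmvExp_nonneg hk (r + 1)
    have hC := vmvConst_pos hk (r + 1)
    set T := vmvExp k (r + 1) with hT
    by_cases hsmall : (N : ℝ) < (32 * (k : ℝ) ^ 2) ^ (4 * k)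
    · have h1 : (vmv k (k * (r + 1)) N : ℝ) ≤ (N : ℝ) ^ (2 * (k * (r + 1))) := by
        exact_mod_cast vmv_le_pow k (k * (r + 1)) N
      have h2 : (N : ℝ) ^ (2 * (k * (r + 1))) ≤ (N : ℝ) ^ (k ^ 2) * (N : ℝ) ^ T := by
        rw [← Real.rpow_natCast, ← Real.rpow_natCast, ← Real.rpow_add (by linarith)]
        refine Real.rpow_le_rpow_of_exponent_le hN' ?_
        have h3 : 0 ≤ (k : ℝ) * (k + 1) / 2 * (1 - 1 / (k : ℝ)) ^ (r + 1) :=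
          mul_nonneg (by positivity) (pow_nonneg (one_sub_inv_mem hk).1 _)
        rw [hT, vmvExp]
        push_cast
        nlinarith
      have h4 : (N : ℝ) ^ (k ^ 2) ≤ vmvConst k (r + 1) := by
        calc (N : ℝ) ^ (k ^ 2) ≤ ((32 * (k : ℝ) ^ 2) ^ (4 * k)) ^ (k ^ 2) :=
              pow_le_pow_left₀ (by linarith) hsmall.le _
          _ = (32 * (k : ℝ) ^ 2) ^ (4 * k ^ 3) := by rw [← pow_mul]; congr 1; ring
          _ ≤ _ := by
            unfold vmvConst
            rw [mul_assoc]
            refine le_mul_of_one_le_right (by positivity) (one_le_mul_of_one_le_of_one_le ?_ ?_)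
            · refine one_le_pow₀ (one_le_mul_of_one_le_of_one_le (one_le_mul_of_one_le_of_one_le
                (by norm_num) (one_le_pow₀ (by linarith))) (one_le_pow₀ (by norm_num)))
            · exact one_le_pow₀ (by norm_num)
      exact h1.trans (h2.trans (mul_le_mul_of_nonneg_right h4 (by positivity)))
    · push Not at hsmall
      obtain ⟨p, hp, hNp, hp1, hp2⟩ := exists_prime_near_root (by omega : 1 ≤ k) hN
      have hkinv : (4 * k : ℕ) * (1 / (k : ℝ)) = 4 := by
        push_cast
        field_simp
      have hroot : (32 * (k : ℝ) ^ 2) ^ 4 ≤ (N : ℝ) ^ (1 / (k : ℝ)) := by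
        have := Real.rpow_le_rpow (by positivity) hsmall (by positivity : 0 ≤ 1 / (k : ℝ))
        rw [← Real.rpow_natCast, ← Real.rpow_mul (by positivity), hkinv] at this
        exact_mod_cast this
      have hpbig : (32 * (k : ℝ) ^ 2) ^ 4 ≤ p := hroot.trans hp1
      have h32 : 128 ≤ 32 * (k : ℝ) ^ 2 := by nlinarith
      have hbase : 32 * (k : ℝ) ^ 2 ≤ (32 * (k : ℝ) ^ 2) ^ 4 :=
        le_self_pow₀ (by linarith) (by norm_num)
      have hp0 : (128 : ℝ) ≤ p := by linarith
      have hkp : k < p := by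
        have : (k : ℝ) < p := by nlinarith
        exact_mod_cast this
      have hpN : (p : ℝ) ≤ N := by
        have h1 : (N : ℝ) = ((N : ℝ) ^ (1 / (k : ℝ))) ^ k := by
          rw [← Real.rpow_natCast, ← Real.rpow_mul (by linarith), one_div,
            inv_mul_cancel₀ (by linarith), Real.rpow_one]
        have h2 : ((N : ℝ) ^ (1 / (k : ℝ))) ^ 2 ≤ ((N : ℝ) ^ (1 / (k : ℝ))) ^ k :=
          pow_le_pow_right₀ (by linarith) hk
        nlinarith
      set N₁ := N / p + 1 with hN₁
      have hN₁le : (N₁ : ℝ) ≤ 2 * N / p := by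
        rw [hN₁, Nat.cast_add, Nat.cast_one]
        have h1 : ((N / p : ℕ) : ℝ) ≤ N / p := Nat.cast_div_le
        have h2 : 1 ≤ (N : ℝ) / p := by rw [one_le_div (by linarith)]; exact hpN
        rw [mul_div_assoc]
        linarith
      have hN₁lt : N₁ < N := by
        have : (N₁ : ℝ) < N := by
          refine hN₁le.trans_lt ?_
          rw [div_lt_iff₀ (by linarith)]
          nlinarith
        exact_mod_cast this
      have hstep := vmv_recursion (s := k * r) hp (by omega) hkp hNp
      have hkr : k + k * r = k * (r + 1) := by ring
      rw [hkr] at hstep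
      have hA := ih N₁ (Nat.le_add_left 1 _)
      have hB := ihN N₁ hN₁lt (Nat.le_add_left 1 _)
      have hN₁0 : (0 : ℝ) ≤ N₁ := Nat.cast_nonneg _
      have hA' : (vmv k (k * r) N₁ : ℝ) ≤ vmvConst k r * (2 * N / p) ^ vmvExp k r :=
        hA.trans (mul_le_mul_of_nonneg_left (Real.rpow_le_rpow hN₁0 hN₁le (vmvExp_nonneg hk r))
          (vmvConst_pos hk r).le)
      have hB' : (vmv k (k * (r + 1)) N₁ : ℝ) ≤ vmvConst k (r + 1) * (2 * N / p) ^ T :=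
        hB.trans (mul_le_mul_of_nonneg_left (Real.rpow_le_rpow hN₁0 hN₁le hE) hC.le)
      have t1 := vmv_first_term (r := r) hk hN' (by linarith : (1 : ℝ) ≤ p) hp2
      have t2 := vmv_second_term (r := r) hk hN' hpbig
      have s1 : (p : ℝ) ^ (2 * (k * r)) * (N ^ k * (k ^ k * p ^ (k * (k - 1) / 2)) *
          vmv k (k * r) N₁) ≤ vmvConst k (r + 1) / 4 * (N : ℝ) ^ T := by
        refine le_trans ?_ t1
        gcongr
      have s2 : (4 * (k : ℝ) ^ 2 * p) ^ (k * (r + 1)) * vmv k (k * (r + 1)) N₁ ≤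
          vmvConst k (r + 1) * ((N : ℝ) ^ T / 2) := by
        refine (mul_le_mul_of_nonneg_left hB' (by positivity)).trans ?_
        rw [mul_left_comm]
        exact mul_le_mul_of_nonneg_left t2 hC.le
      linarith

theorem vmvConst_le {k A : ℕ} (hk : 2 ≤ k) :
    vmvConst k (A * k) ≤ Real.exp ((16 + 4 * A + 2 * A ^ 2) * k ^ 4) := by
  have hk' : (2 : ℝ) ≤ k := by exact_mod_cast hk
  have hA : (0 : ℝ) ≤ A := Nat.cast_nonneg A
  rw [← Real.log_le_iff_le_exp (vmvConst_pos hk _)]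
  unfold vmvConst
  rw [Real.log_mul (by positivity) (by positivity), Real.log_mul (by positivity) (by positivity),
    Real.log_pow, Real.log_pow, Real.log_pow, Real.log_mul (by positivity) (by positivity),
    Real.log_mul (by positivity) (by positivity), Real.log_mul (by positivity) (by positivity),
    Real.log_pow, Real.log_pow, Real.log_pow, show (32 : ℝ) = 2 ^ 5 by norm_num,
    show (4 : ℝ) = 2 ^ 2 by norm_num, Real.log_pow, Real.log_pow]
  have h2 : Real.log 2 ≤ 0.7 := by linarith [Real.log_two_lt_d9]
  have h20 : 0 ≤ Real.log 2 := Real.log_nonneg (by norm_num)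
  have hlk : Real.log k ≤ k - 1 := Real.log_le_sub_one_of_pos (by linarith)
  have hlk0 : 0 ≤ Real.log k := Real.log_nonneg (by linarith)
  push_cast
  have e1 : 4 * (k : ℝ) ^ 3 * (5 * Real.log 2 + 2 * Real.log k) ≤ 4 * (k : ℝ) ^ 3 * (4 * k) := by
    gcongr
    linarith
  have e2 : 2 * Real.log 2 + k * Real.log k + k ^ 2 * (2 * Real.log 2) ≤ 4 * (k : ℝ) ^ 2 := by
    nlinarith
  have e3 := mul_le_mul_of_nonneg_left e2 (by positivity : 0 ≤ (A : ℝ) * k)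
  have e4 : 2 * (k : ℝ) * (A * k) ^ 2 * Real.log 2 ≤ 2 * (k : ℝ) * (A * k) ^ 2 * 1 := by
    gcongr
    linarith
  have e5 : (k : ℝ) ^ 3 ≤ k ^ 4 := pow_le_pow_right₀ (by linarith) (by norm_num)
  have e6 := mul_le_mul_of_nonneg_left e5 (by positivity : 0 ≤ 4 * (A : ℝ) + 2 * A ^ 2)
  nlinarith

theorem vmv_le_exp {k : ℕ} (hk : 2 ≤ k) (A : ℕ) {N : ℕ} (hN : 1 ≤ N) :
    (vmv k (A * k ^ 2) N : ℝ) ≤ Real.exp ((16 + 4 * A + 2 * A ^ 2) * k ^ 4) *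
      (N : ℝ) ^ (2 * A * (k : ℝ) ^ 2 - k * (k + 1) / 2 +
        k * (k + 1) / 2 * Real.exp (-(A : ℝ))) := by
  have hk' : (2 : ℝ) ≤ k := by exact_mod_cast hk
  have hN' : (1 : ℝ) ≤ N := by exact_mod_cast hN
  have h := vmv_le hk (A * k) N hN
  rw [show k * (A * k) = A * k ^ 2 by ring] at h
  refine h.trans (mul_le_mul (vmvConst_le hk) ?_ (by positivity) (by positivity))
  refine Real.rpow_le_rpow_of_exponent_le hN' ?_
  have hpow : (1 - 1 / (k : ℝ)) ^ (A * k) ≤ Real.exp (-(A : ℝ)) := by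
    have h1 : 1 - 1 / (k : ℝ) ≤ Real.exp (-(1 / (k : ℝ))) := by
      linarith [Real.add_one_le_exp (-(1 / (k : ℝ)))]
    refine (pow_le_pow_left₀ (one_sub_inv_mem hk).1 h1 _).trans (le_of_eq ?_)
    rw [← Real.exp_nat_mul]
    congr 1
    push_cast
    field_simp
  unfold vmvExp
  have := mul_le_mul_of_nonneg_left hpow (by positivity : (0 : ℝ) ≤ k * (k + 1) / 2)
  push_cast
  linarith

/-- The additive character `x ↦ exp (2πix)` of the real line. -/
noncomputable def e : AddChar ℝ ℂ where
  toFun x := Complex.exp ((2 * Real.pi * x : ℝ) * Complex.I)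
  map_zero_eq_one' := by simp
  map_add_eq_mul' x y := by rw [← Complex.exp_add]; congr 1; push_cast; ring

theorem e_apply (x : ℝ) : e x = Complex.exp ((2 * Real.pi * x : ℝ) * Complex.I) := rfl

@[simp]
theorem norm_e (x : ℝ) : ‖e x‖ = 1 := by
  rw [e_apply, Complex.norm_exp_ofReal_mul_I]

theorem norm_sum_e_le {ι : Type*} (S : Finset ι) (f : ι → ℝ) : ‖∑ x ∈ S, e (f x)‖ ≤ #S :=
  (norm_sum_le _ _).trans (by simp)

/-- The character `u ↦ e (∑ j, α j * v j * u j)`. -/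
noncomputable def bichar {k : ℕ} (α : Fin k → ℝ) (v : Fin k → ℤ) : AddChar (Fin k → ℤ) ℂ where
  toFun u := e (∑ j, α j * v j * u j)
  map_zero_eq_one' := by simp
  map_add_eq_mul' x y := by
    rw [← AddChar.map_add_eq_mul, ← sum_add_distrib]
    congr 1
    exact sum_congr rfl fun j _ => by simp [mul_add]

theorem bichar_apply {k : ℕ} (α : Fin k → ℝ) (v u : Fin k → ℤ) :
    bichar α v u = e (∑ j, α j * v j * u j) := rfl

theorem bichar_comm {k : ℕ} (α : Fin k → ℝ) (v u : Fin k → ℤ) : bichar α v u = bichar α u v := by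
  rw [bichar_apply, bichar_apply]
  congr 1
  exact sum_congr rfl fun j _ => by ring

theorem norm_bichar {k : ℕ} (α : Fin k → ℝ) (v u : Fin k → ℤ) : ‖bichar α v u‖ = 1 := by
  rw [bichar_apply, norm_e]

theorem norm_sum_pow_eq {ι : Type*} {k : ℕ} (ψ : AddChar (Fin k → ℤ) ℂ) (hψ : ∀ u, ‖ψ u‖ = 1)
    (I : Finset ι) (φ : ι → Fin k → ℤ) (s : ℕ) :
    ((‖∑ x ∈ I, ψ (φ x)‖ ^ (2 * s) : ℝ) : ℂ) =
      ∑ z ∈ tuples I s ×ˢ tuples I s, ψ (∑ i, φ (z.1 i) - ∑ i, φ (z.2 i)) := by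
  have h1 : ∑ z ∈ tuples I s ×ˢ tuples I s, ψ (∑ i, φ (z.1 i) - ∑ i, φ (z.2 i)) =
      (∑ x ∈ tuples I s, ψ (∑ i, φ (x i))) *
        (starRingEnd ℂ) (∑ x ∈ tuples I s, ψ (∑ i, φ (x i))) := by
    rw [map_sum, sum_mul_sum, sum_product]
    refine sum_congr rfl fun x _ => sum_congr rfl fun y _ => ?_
    rw [sub_eq_add_neg, AddChar.map_add_eq_mul, AddChar.map_neg_eq_inv,
      Complex.inv_eq_conj (hψ _)]
  rw [h1, Complex.mul_conj, Complex.normSq_eq_norm_sq, tuples, sum_piFinset_addChar, prod_const,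
    card_univ, Fintype.card_fin, norm_pow, ← pow_mul, mul_comm s]

theorem sum_sub_le_energy_mul {ι : Type*} {k : ℕ} (I : Finset ι) (φ : ι → Fin k → ℤ) (s : ℕ)
    (F : Finset (Fin k → ℤ)) (g : (Fin k → ℤ) → ℝ) (hg : ∀ u, 0 ≤ g u)
    (hF : ∀ x ∈ tuples I s, ∀ y ∈ tuples I s, ∑ i, φ (x i) - ∑ i, φ (y i) ∈ F) :
    ∑ z ∈ tuples I s ×ˢ tuples I s, g (∑ i, φ (z.1 i) - ∑ i, φ (z.2 i)) ≤
      energy I φ s * ∑ u ∈ F, g u := by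
  rw [← sum_fiberwise_of_maps_to (t := F)
    (g := fun z : (Fin s → ι) × (Fin s → ι) => ∑ i, φ (z.1 i) - ∑ i, φ (z.2 i))
    (fun z hz => hF _ (mem_product.1 hz).1 _ (mem_product.1 hz).2), mul_sum]
  refine sum_le_sum fun u _ => ?_
  rw [sum_congr rfl (g := fun _ => g u) fun z hz => by rw [(mem_filter.1 hz).2], sum_const,
    nsmul_eq_mul]
  refine mul_le_mul_of_nonneg_right ?_ (hg u)
  have h := coinc_add_right_le (tuples I s) (fun x => ∑ i, φ (x i)) u
  refine Nat.cast_le.2 (le_trans (le_of_eq ?_) h)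
  rw [coinc]
  congr 1
  refine filter_congr fun z _ => ?_
  rw [sub_eq_iff_eq_add, add_comm]

/-- The box of vectors whose `j`-th entry is at most `R j` in absolute value. -/
noncomputable def box {k : ℕ} (R : Fin k → ℕ) : Finset (Fin k → ℤ) :=
  Fintype.piFinset fun j => Icc (-(R j : ℤ)) (R j)

theorem sum_box_bichar {k : ℕ} (α : Fin k → ℝ) (R : Fin k → ℕ) (v : Fin k → ℤ) :
    ∑ u ∈ box R, bichar α v u =
      ∏ j, ∑ l ∈ Icc (-(R j : ℤ)) (R j), e (α j * v j * l) := by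
  rw [prod_univ_sum]
  refine sum_congr rfl fun u _ => ?_
  rw [bichar_apply]
  induction (univ : Finset (Fin k)) using Finset.induction_on with
  | empty => simp
  | insert a s ha ih => rw [sum_insert ha, prod_insert ha, AddChar.map_add_eq_mul, ih]

/-- The double sum of a bilinear phase over a symmetric square. -/
noncomputable def squareSum (β : ℝ) (R : ℕ) : ℝ :=
  ∑ m ∈ Icc (-(R : ℤ)) R, ‖∑ l ∈ Icc (-(R : ℤ)) R, e (β * m * l)‖

theorem sum_box_norm_sum_box {k : ℕ} (α : Fin k → ℝ) (R : Fin k → ℕ) :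
    ∑ v ∈ box R, ‖∑ u ∈ box R, bichar α v u‖ = ∏ j, squareSum (α j) (R j) := by
  simp_rw [squareSum]
  rw [prod_univ_sum]
  refine sum_congr rfl fun v _ => ?_
  rw [sum_box_bichar, norm_prod]

theorem powVec_sum_sub_mem_box {k s M : ℕ} {x y : Fin s → ℕ} (hx : x ∈ tuples (range M) s)
    (hy : y ∈ tuples (range M) s) :
    ∑ i, powVec k (x i : ℤ) - ∑ i, powVec k (y i : ℤ) ∈
      box fun j : Fin k => s * M ^ (j.1 + 1) := by
  rw [box, Fintype.mem_piFinset]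
  intro j
  have h : ∀ x ∈ tuples (range M) s, 0 ≤ (∑ i, powVec k (x i : ℤ)) j ∧
      (∑ i, powVec k (x i : ℤ)) j ≤ s * (M : ℤ) ^ (j.1 + 1) := by
    intro x hx
    rw [Finset.sum_apply]
    constructor
    · exact sum_nonneg fun i _ => by simp only [powVec]; positivity
    · calc _ ≤ ∑ i : Fin s, (M : ℤ) ^ (j.1 + 1) := sum_le_sum fun i _ => by
            simp only [powVec]
            have := mem_range.1 (mem_tuples.1 hx i)
            gcongr
        _ = _ := by simp
  have h1 := h x hx
  have h2 := h y hy
  rw [mem_Icc, Pi.sub_apply]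
  push_cast
  omega

theorem norm_bilinear_pow_le {k : ℕ} (α : Fin k → ℝ) (s M : ℕ) (hs : 1 ≤ s) :
    ‖∑ a ∈ range M, ∑ b ∈ range M, e (∑ j : Fin k, α j * ((a * b : ℕ) : ℝ) ^ (j.1 + 1))‖ ^
        (4 * s ^ 2) ≤
      (M : ℝ) ^ (8 * s ^ 2 - 4 * s) * (vmv k s M : ℝ) ^ 2 *
        ∏ j : Fin k, squareSum (α j) (s * M ^ (j.1 + 1)) := by
  set I := range M with hI
  set φ : ℕ → Fin k → ℤ := fun x => powVec k x with hφ
  set T := tuples I s ×ˢ tuples I s with hT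
  set J : ℝ := (vmv k s M : ℝ) with hJ
  set F : Finset (Fin k → ℤ) := box fun j : Fin k => s * M ^ (j.1 + 1) with hF
  have hJe : J = energy I φ s := rfl
  have hbox : ∀ x ∈ tuples I s, ∀ y ∈ tuples I s, ∑ i, φ (x i) - ∑ i, φ (y i) ∈ F :=
    fun x hx y hy => powVec_sum_sub_mem_box hx hy
  set V : (Fin k → ℤ) → ℝ := fun u => ‖∑ a ∈ I, bichar α u (φ a)‖ with hV
  have hcardT : (#T : ℝ) = (M : ℝ) ^ (2 * s) := by
    rw [hT, card_product, tuples, Fintype.card_piFinset]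
    simp [hI, ← pow_add, two_mul]
  -- rewriting the phase
  have h0 : ∑ a ∈ I, ∑ b ∈ I, e (∑ j : Fin k, α j * ((a * b : ℕ) : ℝ) ^ (j.1 + 1)) =
      ∑ a ∈ I, ∑ b ∈ I, bichar α (φ a) (φ b) := by
    refine sum_congr rfl fun a _ => sum_congr rfl fun b _ => ?_
    rw [bichar_apply]
    congr 1
    refine sum_congr rfl fun j _ => ?_
    simp only [hφ, powVec]
    push_cast
    ring
  rw [h0]
  set U : ℝ := ∑ a ∈ I, V (φ a) ^ (2 * s) with hU
  have hU0 : 0 ≤ U := sum_nonneg fun _ _ => by positivity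
  obtain ⟨r, hr⟩ : ∃ r, 2 * s = r + 1 := ⟨2 * s - 1, by omega⟩
  have h1 : ‖∑ a ∈ I, ∑ b ∈ I, bichar α (φ a) (φ b)‖ ^ (2 * s) ≤ (M : ℝ) ^ (2 * s - 1) * U := by
    calc _ ≤ (∑ a ∈ I, V (φ a)) ^ (2 * s) := by
          gcongr
          exact norm_sum_le _ _
      _ ≤ (#I : ℝ) ^ (2 * s - 1) * U := by
          rw [hU, hr, Nat.add_sub_cancel]
          exact pow_sum_le_card_mul_sum_pow (fun _ _ => norm_nonneg _) r
      _ = _ := by simp [hI]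
  have h2 : U ≤ ∑ z ∈ T, V (∑ i, φ (z.1 i) - ∑ i, φ (z.2 i)) := by
    have h : (U : ℂ) = ∑ z ∈ T, ∑ a ∈ I, bichar α (∑ i, φ (z.1 i) - ∑ i, φ (z.2 i)) (φ a) := by
      rw [sum_comm, hU, Complex.ofReal_sum]
      refine sum_congr rfl fun a _ => ?_
      rw [norm_sum_pow_eq _ (norm_bichar α (φ a)) I φ s]
      exact sum_congr rfl fun z _ => bichar_comm _ _ _
    rw [← Complex.norm_of_nonneg hU0, h]
    exact norm_sum_le _ _
  have h3 : U ^ (2 * s) ≤ ((M : ℝ) ^ (2 * s)) ^ (2 * s - 1) * (J * ∑ u ∈ F, V u ^ (2 * s)) := by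
    calc U ^ (2 * s) ≤ (∑ z ∈ T, V (∑ i, φ (z.1 i) - ∑ i, φ (z.2 i))) ^ (2 * s) := by gcongr
      _ ≤ (#T : ℝ) ^ (2 * s - 1) * ∑ z ∈ T, V (∑ i, φ (z.1 i) - ∑ i, φ (z.2 i)) ^ (2 * s) := by
          rw [hr, Nat.add_sub_cancel]
          exact pow_sum_le_card_mul_sum_pow (fun _ _ => norm_nonneg _) r
      _ ≤ _ := by
          rw [hcardT]
          gcongr
          exact sum_sub_le_energy_mul I φ s F (fun u => V u ^ (2 * s)) (fun _ => by positivity) hbox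
  have h4 : ∑ u ∈ F, V u ^ (2 * s) ≤
      ∑ z ∈ T, ‖∑ u ∈ F, bichar α (∑ i, φ (z.1 i) - ∑ i, φ (z.2 i)) u‖ := by
    have h : ((∑ u ∈ F, V u ^ (2 * s) : ℝ) : ℂ) =
        ∑ z ∈ T, ∑ u ∈ F, bichar α (∑ i, φ (z.1 i) - ∑ i, φ (z.2 i)) u := by
      rw [sum_comm, Complex.ofReal_sum]
      refine sum_congr rfl fun u _ => ?_
      rw [norm_sum_pow_eq _ (norm_bichar α u) I φ s]
      exact sum_congr rfl fun z _ => bichar_comm _ _ _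
    rw [← Complex.norm_of_nonneg (sum_nonneg fun u _ => by positivity : 0 ≤ ∑ u ∈ F, V u ^ (2 * s)),
      h]
    exact norm_sum_le _ _
  have h5 : ∑ u ∈ F, V u ^ (2 * s) ≤ J * ∏ j : Fin k, squareSum (α j) (s * M ^ (j.1 + 1)) := by
    rw [← sum_box_norm_sum_box]
    exact h4.trans (sum_sub_le_energy_mul I φ s F (fun u => ‖∑ w ∈ F, bichar α u w‖)
      (fun _ => norm_nonneg _) hbox)
  calc _ = (‖∑ a ∈ I, ∑ b ∈ I, bichar α (φ a) (φ b)‖ ^ (2 * s)) ^ (2 * s) := by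
        rw [← pow_mul]; congr 1; ring
    _ ≤ ((M : ℝ) ^ (2 * s - 1) * U) ^ (2 * s) := by gcongr
    _ = ((M : ℝ) ^ (2 * s - 1)) ^ (2 * s) * U ^ (2 * s) := mul_pow _ _ _
    _ ≤ ((M : ℝ) ^ (2 * s - 1)) ^ (2 * s) * (((M : ℝ) ^ (2 * s)) ^ (2 * s - 1) * (J * (J *
          ∏ j : Fin k, squareSum (α j) (s * M ^ (j.1 + 1))))) := by
        gcongr
        exact h3.trans (by gcongr)
    _ = _ := by
        have : 8 * s ^ 2 - 4 * s = (2 * s - 1) * (2 * s) + (2 * s) * (2 * s - 1) := by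
          obtain ⟨q, rfl⟩ : ∃ q, s = q + 1 := ⟨s - 1, by omega⟩
          have : 2 * (q + 1) - 1 = 2 * q + 1 := by omega
          rw [this, Nat.sub_eq_iff_eq_add (by nlinarith)]
          ring
        rw [this, pow_add, ← pow_mul, ← pow_mul]
        ring

/-- Half the cotangent of `πx`. -/
noncomputable def halfCot (x : ℝ) : ℝ := Real.cos (Real.pi * x) / (2 * Real.sin (Real.pi * x))

theorem two_mul_le_sin {x : ℝ} (h0 : 0 ≤ x) (h1 : x ≤ 1 / 2) : 2 * x ≤ Real.sin (Real.pi * x) := by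
  have hp := Real.pi_pos
  have h := Real.mul_le_sin (x := Real.pi * x) (by positivity) (by nlinarith)
  calc 2 * x = 2 / Real.pi * (Real.pi * x) := by field_simp
    _ ≤ _ := h

theorem halfCot_antitone {x y : ℝ} (hx : 0 < x) (hxy : x ≤ y) (hy : y ≤ 1 / 2) :
    halfCot y ≤ halfCot x := by
  have hp := Real.pi_pos
  have h1 : Real.cos (Real.pi * y) ≤ Real.cos (Real.pi * x) :=
    Real.cos_le_cos_of_nonneg_of_le_pi (by positivity) (by nlinarith) (by gcongr)
  have h2 : Real.sin (Real.pi * x) ≤ Real.sin (Real.pi * y) :=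
    Real.sin_le_sin_of_le_of_le_pi_div_two (by nlinarith) (by nlinarith) (by gcongr)
  have h3 := two_mul_le_sin hx.le (hxy.trans hy)
  have h4 : 0 ≤ Real.cos (Real.pi * y) :=
    Real.cos_nonneg_of_neg_pi_div_two_le_of_le (by nlinarith) (by nlinarith)
  rw [halfCot, halfCot]
  gcongr
  · exact h4.trans h1
  · linarith

theorem halfCot_nonneg {x : ℝ} (hx : 0 < x) (hx1 : x ≤ 1 / 2) : 0 ≤ halfCot x := by
  have h := halfCot_antitone hx hx1 le_rfl
  rwa [halfCot, show Real.pi * (1 / 2) = Real.pi / 2 by ring, Real.cos_pi_div_two, zero_div] at h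

theorem halfCot_le {x : ℝ} (hx : 0 < x) (hx1 : x ≤ 1 / 2) : halfCot x ≤ 1 / (4 * x) := by
  have h := two_mul_le_sin hx.le hx1
  rw [halfCot]
  exact div_le_div₀ zero_le_one (Real.cos_le_one _) (by positivity) (by linarith)

theorem halfCot_mul_sub {x : ℝ} (hx : 0 < x) (hx1 : x ≤ 1 / 2) :
    (1 / 2 + halfCot x * Complex.I) * (1 - e x) = 1 := by
  have h := two_mul_le_sin hx.le hx1
  have hs : Real.sin (Real.pi * x) ≠ 0 := by linarith
  have h1 : e x = ((1 - 2 * Real.sin (Real.pi * x) ^ 2 : ℝ) : ℂ) +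
      ((2 * Real.sin (Real.pi * x) * Real.cos (Real.pi * x) : ℝ) : ℂ) * Complex.I := by
    rw [e_apply, Complex.exp_mul_I, ← Complex.ofReal_cos, ← Complex.ofReal_sin,
      show 2 * Real.pi * x = 2 * (Real.pi * x) by ring, Real.sin_two_mul, Real.cos_two_mul']
    rw [Real.cos_sq']
    ring_nf
  have h2 := Real.sin_sq_add_cos_sq (Real.pi * x)
  rw [h1, halfCot]
  generalize Real.sin (Real.pi * x) = S at *
  generalize Real.cos (Real.pi * x) = C at *
  have hs' : (S : ℂ) ≠ 0 := by exact_mod_cast hs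
  have h3 : (S : ℂ) ^ 2 + (C : ℂ) ^ 2 = 1 := by exact_mod_cast h2
  push_cast
  field_simp
  linear_combination 2 * S * h3 - 2 * S * (C : ℂ) ^ 2 * Complex.I_sq

/-- The Kusmin-Landau inequality for a phase with decreasing increments in `[θ, 1/2]`. -/
theorem norm_sum_e_le_of_antitone (f : ℕ → ℝ) {θ : ℝ} (hθ : 0 < θ) (N : ℕ)
    (h1 : ∀ n < N, θ ≤ f (n + 1) - f n) (h2 : ∀ n < N, f (n + 1) - f n ≤ 1 / 2)
    (h3 : ∀ n, n + 1 < N → f (n + 2) - f (n + 1) ≤ f (n + 1) - f n) :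
    ‖∑ n ∈ range N, e (f n)‖ ≤ 2 / θ := by
  obtain _ | N := N
  · simp; positivity
  set g : ℕ → ℝ := fun n => f (n + 1) - f n with hg
  set c : ℕ → ℂ := fun n => 1 / 2 + halfCot (g n) * Complex.I with hc
  have hg0 : ∀ n < N + 1, 0 < g n := fun n hn => hθ.trans_le (h1 n hn)
  have key : ∀ n < N + 1, e (f n) = c n * (e (f n) - e (f (n + 1))) := by
    intro n hn
    have h := halfCot_mul_sub (hg0 n hn) (h2 n hn)
    have h' : e (f (n + 1)) = e (f n) * e (g n) := by
      rw [← AddChar.map_add_eq_mul]; congr 1; simp [hg]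
    rw [h']
    linear_combination -(e (f n)) * h
  have main : ∀ n < N + 1, ‖∑ i ∈ range (n + 1), e (f i) - c 0 * e (f 0) + c n * e (f (n + 1))‖ ≤
      halfCot (g n) - halfCot (g 0) := by
    intro n
    induction n with
    | zero =>
      intro h
      have := key 0 h
      rw [zero_add, sum_range_one, sub_self]
      refine le_of_eq (norm_eq_zero.2 ?_)
      linear_combination this
    | succ n ih =>
      intro h
      have h' := key (n + 1) h
      have hm : halfCot (g n) ≤ halfCot (g (n + 1)) :=
        halfCot_antitone (hg0 _ h) (h3 n h) (h2 n (by omega))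
      rw [sum_range_succ]
      have h5 : ∑ i ∈ range (n + 1), e (f i) + e (f (n + 1)) - c 0 * e (f 0) +
          c (n + 1) * e (f (n + 1 + 1)) = (∑ i ∈ range (n + 1), e (f i) - c 0 * e (f 0) +
          c n * e (f (n + 1))) + (c (n + 1) - c n) * e (f (n + 1)) := by
        linear_combination h'
      have h6 : ‖(c (n + 1) - c n) * e (f (n + 1))‖ = halfCot (g (n + 1)) - halfCot (g n) := by
        rw [norm_mul, norm_e, mul_one]
        have : c (n + 1) - c n = ((halfCot (g (n + 1)) - halfCot (g n) : ℝ) : ℂ) * Complex.I := by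
          simp only [hc]; push_cast; ring
        rw [this, norm_mul, Complex.norm_I, mul_one, Complex.norm_real,
          Real.norm_of_nonneg (by linarith)]
      rw [h5]
      have := norm_add_le (∑ i ∈ range (n + 1), e (f i) - c 0 * e (f 0) + c n * e (f (n + 1)))
        ((c (n + 1) - c n) * e (f (n + 1)))
      linarith [ih (by omega)]
  have hcn : ∀ n < N + 1, ‖c n‖ ≤ 1 / 2 + halfCot (g n) := by
    intro n hn
    refine (norm_add_le _ _).trans (le_of_eq ?_)
    rw [norm_mul, Complex.norm_I, mul_one, Complex.norm_real,
      Real.norm_of_nonneg (halfCot_nonneg (hg0 n hn) (h2 n hn))]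
    norm_num
  have hk : ∀ n < N + 1, halfCot (g n) ≤ 1 / (4 * θ) := fun n hn =>
    (halfCot_le (hg0 n hn) (h2 n hn)).trans (by
      have := h1 n hn
      gcongr)
  have h7 := main N (by omega)
  have h8 := hcn 0 (by omega)
  have h9 := hcn N (by omega)
  have h10 := hk 0 (by omega)
  have h11 := hk N (by omega)
  have h12 : θ ≤ 1 / 2 := (h1 0 (by omega)).trans (h2 0 (by omega))
  have h13 : (1 : ℝ) ≤ 2 * (1 / (4 * θ)) := by
    rw [← mul_div_assoc, le_div_iff₀ (by positivity)]
    linarith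
  have h14 : ∑ i ∈ range (N + 1), e (f i) = (∑ i ∈ range (N + 1), e (f i) - c 0 * e (f 0) +
      c N * e (f (N + 1))) + c 0 * e (f 0) - c N * e (f (N + 1)) := by ring
  rw [h14]
  refine (norm_sub_le _ _).trans ?_
  have h15 := norm_add_le (∑ i ∈ range (N + 1), e (f i) - c 0 * e (f 0) +
      c N * e (f (N + 1))) (c 0 * e (f 0))
  have h16 : ‖c 0 * e (f 0)‖ = ‖c 0‖ := by simp
  have h17 : ‖c N * e (f (N + 1))‖ = ‖c N‖ := by simp
  have h18 : 2 / θ = 8 * (1 / (4 * θ)) := by field_simp; norm_num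
  have h19 := halfCot_nonneg (hg0 0 (by omega)) (h2 0 (by omega))
  rw [h17, h18]
  linarith

theorem conj_e (x : ℝ) : (starRingEnd ℂ) (e x) = e (-x) := by
  rw [AddChar.map_neg_eq_inv, Complex.inv_eq_conj (norm_e x)]

theorem norm_sum_e_neg {ι : Type*} (S : Finset ι) (f : ι → ℝ) :
    ‖∑ x ∈ S, e (-f x)‖ = ‖∑ x ∈ S, e (f x)‖ := by
  rw [← Complex.norm_conj, map_sum]
  simp [conj_e]

theorem norm_sum_Icc_e_le {x : ℝ} (hx : x ≠ 0) (hx1 : |x| ≤ 1 / 2) (R : ℕ) :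
    ‖∑ l ∈ Icc (-(R : ℤ)) R, e (x * l)‖ ≤ 2 / |x| := by
  have h : ∀ y : ℝ, 0 < y → y ≤ 1 / 2 → ‖∑ l ∈ Icc (-(R : ℤ)) R, e (y * l)‖ ≤ 2 / y := by
    intro y hy hy1
    have : ∑ l ∈ Icc (-(R : ℤ)) R, e (y * l) =
        ∑ i ∈ range (R + 1 - -(R : ℤ)).toNat, e (y * (-(R : ℤ) + i)) := by
      change ∑ l ∈ Finset.map _ _, _ = _
      rw [sum_map]
      simp
    rw [this]
    refine norm_sum_e_le_of_antitone _ hy _ (fun n _ => ?_) (fun n _ => ?_) fun n _ => ?_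
    · push_cast; ring_nf; exact le_rfl
    · push_cast; ring_nf; linarith
    · push_cast; ring_nf; exact le_rfl
  rcases lt_or_gt_of_ne hx with h0 | h0
  · rw [abs_of_neg h0] at hx1 ⊢
    have := h (-x) (by linarith) hx1
    simp only [neg_mul] at this
    rwa [norm_sum_e_neg] at this
  · rw [abs_of_pos h0] at hx1 ⊢
    exact h x h0 hx1

theorem squareSum_nonneg (β : ℝ) (R : ℕ) : 0 ≤ squareSum β R := sum_nonneg fun _ _ => norm_nonneg _

theorem card_Icc_neg_self (R : ℕ) : (#(Icc (-(R : ℤ)) R) : ℝ) = 2 * R + 1 := by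
  rw [Int.card_Icc]
  have : ((R : ℤ) + 1 - -(R : ℤ)).toNat = 2 * R + 1 := by omega
  rw [this]
  push_cast
  ring

theorem squareSum_le_sq (β : ℝ) {R : ℕ} (hR : 1 ≤ R) : squareSum β R ≤ (3 * R) ^ 2 := by
  have hR' : (1 : ℝ) ≤ R := by exact_mod_cast hR
  calc squareSum β R ≤ ∑ m ∈ Icc (-(R : ℤ)) R, (2 * (R : ℝ) + 1) := sum_le_sum fun m _ =>
        (norm_sum_e_le _ _).trans (card_Icc_neg_self R).le
    _ = (2 * R + 1) ^ 2 := by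
        rw [sum_const, nsmul_eq_mul, card_Icc_neg_self]; ring
    _ ≤ _ := by gcongr; linarith

theorem squareSum_le {β : ℝ} (hβ : β ≠ 0) {R : ℕ} (hR : 1 ≤ R) (hβR : |β| * R ≤ 1 / 2) :
    squareSum β R ≤ 3 * R + 4 / |β| * (1 + Real.log R) := by
  have hR' : (1 : ℝ) ≤ R := by exact_mod_cast hR
  have hb : 0 < |β| := abs_pos.2 hβ
  have h1 : ∀ m ∈ Icc (-(R : ℤ)) R, ‖∑ l ∈ Icc (-(R : ℤ)) R, e (β * m * l)‖ ≤
      if m = 0 then 3 * (R : ℝ) else 2 / (|β| * |(m : ℝ)|) := by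
    intro m hm
    rw [mem_Icc, ← abs_le] at hm
    split_ifs with h0
    · refine (norm_sum_e_le _ _).trans ?_
      rw [card_Icc_neg_self]
      linarith
    · rw [← abs_mul]
      refine norm_sum_Icc_e_le (mul_ne_zero hβ (by exact_mod_cast h0)) ?_ R
      rw [abs_mul]
      have : |(m : ℝ)| ≤ R := by exact_mod_cast hm
      nlinarith
  have h2 : ∀ R : ℕ, ∑ m ∈ Icc (-(R : ℤ)) R, (if m = 0 then (0 : ℝ) else 2 / (|β| * |(m : ℝ)|)) =
      4 / |β| * (harmonic R : ℚ) := by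
    intro R
    induction R with
    | zero => simp
    | succ R ih =>
      have : Icc (-((R + 1 : ℕ) : ℤ)) ((R + 1 : ℕ) : ℤ) =
          insert (-((R : ℤ) + 1)) (insert ((R : ℤ) + 1) (Icc (-(R : ℤ)) R)) := by
        ext x; simp only [mem_Icc, mem_insert]; push_cast; omega
      rw [this, sum_insert (by simp only [mem_insert, mem_Icc]; omega),
        sum_insert (by simp only [mem_Icc]; omega), ih, harmonic_succ, if_neg (by omega),
        if_neg (by omega)]
      have h3 : |((-((R : ℤ) + 1) : ℤ) : ℝ)| = R + 1 := by
        push_cast; rw [abs_neg, abs_of_pos (by positivity)]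
      have h4 : |(((R : ℤ) + 1 : ℤ) : ℝ)| = R + 1 := by
        push_cast; rw [abs_of_pos (by positivity)]
      rw [h3, h4]
      push_cast
      field_simp
      ring
  calc squareSum β R ≤ ∑ m ∈ Icc (-(R : ℤ)) R,
        ((if m = 0 then 3 * (R : ℝ) else 0) + if m = 0 then (0 : ℝ) else 2 / (|β| * |(m : ℝ)|)) :=
        sum_le_sum fun m hm => (h1 m hm).trans (le_of_eq (by split_ifs <;> simp))
    _ = 3 * R + 4 / |β| * (harmonic R : ℚ) := by
        rw [sum_add_distrib, h2, sum_ite_eq' , if_pos (by simp)]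
    _ ≤ _ := by
        gcongr
        exact harmonic_le_one_add_log R

theorem squareSum_le_of_size {β L σ l : ℝ} {i s M : ℕ} (hβ1 : |β| ≤ Real.exp ((σ - i) * L))
    (hβ2 : Real.exp ((σ - i) * L - (i + 1)) ≤ |β|) (hs : 100 ≤ s) (hs2 : Real.log (2 * s) ≤ 22 * σ)
    (hM : (M : ℝ) = Real.exp l) (hl : l ≤ 23 / 48 * L) (hl' : 23 / 48 * L - 1 ≤ l) (hL : 1000 ≤ L)
    (hσ : 1 / 2 ≤ σ) (hi : 2 * σ ≤ i) (hi' : i ≤ 12 * σ) :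
    squareSum β (s * M ^ i) ≤ (3 * (s * (M : ℝ) ^ i)) ^ 2 * Real.exp (-(i / 50) * l) := by
  have hs' : (100 : ℝ) ≤ s := by exact_mod_cast hs
  have hi0 : (1 : ℝ) ≤ i := by linarith
  have hl0 : 0 < l := by linarith
  have hM1 : (1 : ℝ) ≤ M := by rw [hM]; exact Real.one_le_exp hl0.le
  have hMi : (M : ℝ) ^ i = Real.exp (i * l) := by rw [hM, ← Real.exp_nat_mul]
  have hb : 0 < |β| := (Real.exp_pos _).trans_le hβ2
  have hR1 : 1 ≤ s * M ^ i := Nat.mul_pos (by omega) (Nat.pow_pos (by exact_mod_cast hM1))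
  have hsl : Real.log s ≤ s - 1 := Real.log_le_sub_one_of_pos (by linarith)
  have hsexp : (s : ℝ) = Real.exp (Real.log s) := (Real.exp_log (by linarith)).symm
  have hs2' : Real.log 2 + Real.log s ≤ 22 * σ := by
    rwa [← Real.log_mul (by norm_num) (by linarith)]
  have hbR : |β| * ((s * M ^ i : ℕ) : ℝ) ≤ 1 / 2 := by
    have : (1 / 2 : ℝ) = Real.exp (- Real.log 2) := by rw [Real.exp_neg, Real.exp_log] <;> norm_num
    push_cast
    rw [hMi, this]
    calc _ ≤ Real.exp ((σ - i) * L) * (Real.exp (Real.log s) * Real.exp (i * l)) := by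
          rw [← hsexp]; gcongr
      _ = Real.exp ((σ - i) * L + (Real.log s + i * l)) := by simp only [Real.exp_add]
      _ ≤ _ := by
          gcongr
          have h1 : (i : ℝ) * l ≤ i * (23 / 48 * L) := by gcongr
          have h2 : (2 * σ) * (25 / 48 * L) ≤ i * (25 / 48 * L) := by gcongr
          have h3 : σ * 1000 ≤ σ * L := by gcongr
          linarith
  refine (squareSum_le (abs_pos.1 hb) hR1 hbR).trans ?_
  push_cast
  set R : ℝ := s * (M : ℝ) ^ i with hR
  have hE : Real.exp (-(i / 50) * l) ≤ 1 := Real.exp_le_one_iff.2 (by nlinarith)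
  have hR0 : 0 < R := by rw [hR]; positivity
  have hRE : 1 ≤ R * Real.exp (-(i / 50) * l) := by
    have h1 : (1 : ℝ) ≤ Real.exp (i * l) * Real.exp (-(i / 50) * l) := by
      rw [← Real.exp_add]; exact Real.one_le_exp (by nlinarith)
    rw [hR, hMi, mul_assoc]
    nlinarith
  have hlog : 1 + Real.log R ≤ s * (100 * Real.exp (i / 100 * l)) := by
    rw [hR, hMi, Real.log_mul (by positivity) (by positivity), Real.log_exp]
    have := Real.add_one_le_exp (i / 100 * l)
    have h2 : s * (1 + (i : ℝ) * l) ≤ s * (100 * Real.exp (i / 100 * l)) := by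
      gcongr
      linarith
    have : 0 ≤ (i : ℝ) * l := by positivity
    nlinarith
  have hmain : 4 / |β| * (1 + Real.log R) ≤ 4 * R ^ 2 * Real.exp (-(i / 50) * l) := by
    have h1 : 4 / |β| ≤ 4 * Real.exp ((i - σ) * L + (i + 1)) := by
      rw [div_eq_mul_inv]
      gcongr
      rw [inv_le_comm₀ hb (Real.exp_pos _), ← Real.exp_neg]
      convert! hβ2 using 2
      ring
    calc _ ≤ 4 * Real.exp ((i - σ) * L + (i + 1)) * (s * (100 * Real.exp (i / 100 * l))) := by
          have : 0 ≤ Real.log R := Real.log_nonneg (by rw [hR]; exact_mod_cast hR1)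
          gcongr
      _ = 4 * s * 100 * Real.exp ((i - σ) * L + (i + 1) + i / 100 * l) := by
          simp only [Real.exp_add]; ring
      _ ≤ 4 * s * s * Real.exp (2 * (i * l) + -(i / 50) * l) := by
          refine mul_le_mul (by nlinarith) (Real.exp_le_exp.2 ?_)
            (Real.exp_pos _).le (by positivity)
          have h1 : (i : ℝ) * (23 / 48 * L - 1) ≤ i * l := by gcongr
          have h2 : (i : ℝ) * L ≤ (12 * σ) * L := by gcongr
          have h3 : σ * 1000 ≤ σ * L := by gcongr
          linarith
      _ = _ := by
          rw [hR, hMi, Real.exp_add, two_mul, Real.exp_add]; ring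
  have h4 : 3 * R ≤ 3 * R ^ 2 * Real.exp (-(i / 50) * l) := by nlinarith
  have h5 : 0 ≤ R ^ 2 * Real.exp (-(i / 50) * l) := by positivity
  nlinarith

theorem exists_card_good {σ : ℝ} (hσ : 1 / 2 ≤ σ) {k : ℕ} (hk : 24 * σ ≤ k) :
    16 * σ ^ 2 ≤ ∑ i ∈ range k, if 2 * σ ≤ (i + 1 : ℕ) ∧ ((i + 1 : ℕ) : ℝ) ≤ 12 * σ
      then ((i + 1 : ℕ) : ℝ) else 0 := by
  rw [← sum_filter]
  set G := {i ∈ range k | 2 * σ ≤ (i + 1 : ℕ) ∧ ((i + 1 : ℕ) : ℝ) ≤ 12 * σ} with hG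
  have h1 : 8 * σ ≤ #G := by
    have h2 : Ico (⌈2 * σ⌉₊ - 1) ⌊12 * σ⌋₊ ⊆ G := by
      intro i hi
      rw [mem_Ico] at hi
      have h3 : ((i + 1 : ℕ) : ℝ) ≤ 12 * σ :=
        (Nat.cast_le.2 (Nat.succ_le_of_lt hi.2)).trans (Nat.floor_le (by linarith))
      rw [hG, mem_filter, mem_range]
      refine ⟨?_, ?_, h3⟩
      · have : ((i + 1 : ℕ) : ℝ) ≤ k := h3.trans (by linarith)
        have : i + 1 ≤ k := by exact_mod_cast this
        omega
      · refine (Nat.le_ceil _).trans (Nat.cast_le.2 ?_)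
        omega
    have h4 := card_le_card h2
    rw [Nat.card_Ico] at h4
    have h5 := Nat.ceil_lt_add_one (show 0 ≤ 2 * σ by linarith)
    have h6 := Nat.lt_floor_add_one (12 * σ)
    have h7 : ⌊12 * σ⌋₊ + 1 ≤ #G + ⌈2 * σ⌉₊ := by
      have : 1 ≤ ⌈2 * σ⌉₊ := Nat.one_le_ceil_iff.2 (by linarith)
      omega
    have h8 : (⌊12 * σ⌋₊ : ℝ) + 1 ≤ #G + ⌈2 * σ⌉₊ := by exact_mod_cast h7
    linarith
  calc 16 * σ ^ 2 = 8 * σ * (2 * σ) := by ring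
    _ ≤ #G * (2 * σ) := by gcongr
    _ = ∑ i ∈ G, 2 * σ := by simp
    _ ≤ _ := sum_le_sum fun i hi => (mem_filter.1 hi).2.1

theorem log_two_mul_le {σ : ℝ} {k s : ℕ} (hσ : 1 / 2 ≤ σ) (hk12 : (12 : ℝ) ≤ k)
    (hk' : k ≤ 26 * σ) (hsr : (s : ℝ) = 10 * (k : ℝ) ^ 2) : Real.log (2 * s) ≤ 22 * σ := by
  have hs0 : (0 : ℝ) < s := by rw [hsr]; positivity
  have h : (2 * s : ℝ) ≤ Real.exp 11 * σ ^ 2 := by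
    have he : (2.7 : ℝ) ≤ Real.exp 1 := by linarith [Real.exp_one_gt_d9]
    have : (2.7 : ℝ) ^ 11 ≤ Real.exp 11 := by
      calc _ ≤ Real.exp 1 ^ 11 := by gcongr
        _ = _ := by rw [← Real.exp_nat_mul]; norm_num
    have h3 : (20 * 676 : ℝ) ≤ Real.exp 11 := le_trans (by norm_num) this
    have h4 : (k : ℝ) ^ 2 ≤ 676 * σ ^ 2 := by nlinarith
    rw [hsr]
    nlinarith [sq_nonneg σ]
  have h3 := Real.log_le_sub_one_of_pos (show 0 < σ by linarith)
  calc _ ≤ Real.log (Real.exp 11 * σ ^ 2) := Real.log_le_log (by positivity) h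
    _ = 11 + 2 * Real.log σ := by
        rw [Real.log_mul (by positivity) (by positivity), Real.log_exp, Real.log_pow]; norm_num
    _ ≤ _ := by linarith

theorem prod_squareSum_le {L σ l : ℝ} {k M s : ℕ} (α : ℕ → ℝ)
    (h1 : ∀ i : ℕ, 1 ≤ i → |α i| ≤ Real.exp ((σ - i) * L))
    (h2 : ∀ i : ℕ, 1 ≤ i → Real.exp ((σ - i) * L - (i + 1)) ≤ |α i|)
    (hM : (M : ℝ) = Real.exp l) (hl : l ≤ 23 / 48 * L) (hl' : 23 / 48 * L - 1 ≤ l) (hL : 1000 ≤ L)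
    (hσ : 1 / 2 ≤ σ) (hk : 24 * σ ≤ k) (hs100 : 100 ≤ s)
    (hsr : (s : ℝ) = 10 * (k : ℝ) ^ 2) (hs2 : Real.log (2 * s) ≤ 22 * σ) :
    ∏ j : Fin k, squareSum (α (j + 1)) (s * M ^ (j.1 + 1)) ≤
      Real.exp (60 * k ^ 4 + k * (k + 1) * l - 16 * σ ^ 2 / 50 * l) := by
  have hl0 : 0 < l := by linarith
  have hM1 : (1 : ℝ) ≤ M := by rw [hM]; exact Real.one_le_exp hl0.le
  have hM1' : 1 ≤ M := by exact_mod_cast hM1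
  rw [Fin.prod_univ_eq_prod_range (fun i => squareSum (α (i + 1)) (s * M ^ (i + 1))) k]
  have hterm : ∀ i ∈ range k, squareSum (α (i + 1)) (s * M ^ (i + 1)) ≤
      Real.exp (2 * (3 * s) + 2 * ((i + 1 : ℕ) * l) -
        (if 2 * σ ≤ (i + 1 : ℕ) ∧ ((i + 1 : ℕ) : ℝ) ≤ 12 * σ then ((i + 1 : ℕ) : ℝ) else 0) *
          (l / 50)) := by
    intro i _
    have h3s : 3 * (s * (M : ℝ) ^ (i + 1)) ≤ Real.exp (3 * s + (i + 1 : ℕ) * l) := by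
      rw [Real.exp_add, hM, ← Real.exp_nat_mul, ← mul_assoc]
      gcongr
      linarith [Real.add_one_le_exp (3 * s : ℝ)]
    have h3s' : (3 * (s * (M : ℝ) ^ (i + 1))) ^ 2 ≤
        Real.exp (2 * (3 * s) + 2 * ((i + 1 : ℕ) * l)) := by
      calc _ ≤ Real.exp (3 * s + (i + 1 : ℕ) * l) ^ 2 := by gcongr
        _ = _ := by rw [← Real.exp_nat_mul]; congr 1; push_cast; ring
    split_ifs with hg
    · refine (squareSum_le_of_size (h1 (i + 1) (by omega)) (h2 (i + 1) (by omega)) hs100 hs2 hM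
        hl hl' hL hσ hg.1 hg.2).trans ?_
      rw [sub_eq_add_neg, Real.exp_add]
      refine mul_le_mul h3s' (le_of_eq ?_) (Real.exp_pos _).le (Real.exp_pos _).le
      congr 1
      ring
    · have hR : 1 ≤ s * M ^ (i + 1) :=
        Nat.mul_pos (lt_of_lt_of_le (by norm_num) hs100) (Nat.pow_pos hM1')
      have := squareSum_le_sq (α (i + 1)) hR
      push_cast at this
      rw [zero_mul, sub_zero]
      exact this.trans h3s'
  refine (prod_le_prod (fun i _ => squareSum_nonneg _ _) hterm).trans ?_
  rw [← Real.exp_sum]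
  gcongr
  rw [sum_sub_distrib, sum_add_distrib, sum_const, card_range, nsmul_eq_mul, ← mul_sum, ← sum_mul,
    ← sum_mul]
  have h3 := exists_card_good hσ hk
  have h4 : ∀ k : ℕ, ∑ i ∈ range k, ((i + 1 : ℕ) : ℝ) = k * (k + 1) / 2 := by
    intro k
    induction k with
    | zero => simp
    | succ k ih => rw [sum_range_succ, ih]; push_cast; ring
  rw [h4]
  have h5 : (k : ℝ) * (2 * (3 * s)) ≤ 60 * k ^ 4 := by
    rw [hsr]
    nlinarith [pow_pos (show (0 : ℝ) < k by linarith) 3]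
  have h6 : 16 * σ ^ 2 * (l / 50) ≤ (∑ i ∈ range k, if 2 * σ ≤ (i + 1 : ℕ) ∧
      ((i + 1 : ℕ) : ℝ) ≤ 12 * σ then ((i + 1 : ℕ) : ℝ) else 0) * (l / 50) := by gcongr
  linarith

theorem bilinear_exponent_le {L σ l : ℝ} {k s : ℕ} (hl' : 23 / 48 * L - 1 ≤ l) (hL : 1000 ≤ L)
    (hσ : 1 / 2 ≤ σ) (hk12 : (12 : ℝ) ≤ k) (hk' : k ≤ 26 * σ) (hsr : (s : ℝ) = 10 * (k : ℝ) ^ 2) :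
    8 * s ^ 2 * l + 572 * k ^ 4 + k * (k + 1) * Real.exp (-10) * l - 16 * σ ^ 2 / 50 * l ≤
      (4 * s ^ 2 : ℕ) * (2 * l + (2 - L / (4 * 10 ^ 9 * σ ^ 2))) := by
  have hl0 : 0 < l := by linarith
  have he10 : Real.exp (-10) ≤ 1 / 20000 := by
    rw [Real.exp_neg, one_div]
    gcongr
    have he : (2.7 : ℝ) ≤ Real.exp 1 := by linarith [Real.exp_one_gt_d9]
    calc (20000 : ℝ) ≤ 2.7 ^ 10 := by norm_num
      _ ≤ Real.exp 1 ^ 10 := by gcongr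
      _ = _ := by rw [← Real.exp_nat_mul]; norm_num
  have h4 : (k : ℝ) ^ 2 ≤ 676 * σ ^ 2 := by nlinarith
  have h5 : (k : ℝ) * (k + 1) * Real.exp (-10) ≤ 0.07 * σ ^ 2 := by
    have : (k : ℝ) * (k + 1) ≤ 2 * (676 * σ ^ 2) := by nlinarith
    calc _ ≤ 2 * (676 * σ ^ 2) * (1 / 20000) := by gcongr
      _ ≤ _ := by nlinarith [sq_nonneg σ]
  have h6 : (k : ℝ) * (k + 1) * Real.exp (-10) * l ≤ 0.07 * σ ^ 2 * l := by gcongr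
  have h7 : ((4 * s ^ 2 : ℕ) : ℝ) = 400 * (k : ℝ) ^ 4 := by
    push_cast; rw [hsr]; ring
  have h8 : (8 : ℝ) * s ^ 2 = 800 * (k : ℝ) ^ 4 := by rw [hsr]; ring
  rw [h7, h8]
  have h9 : 400 * (k : ℝ) ^ 4 * (L / (4 * 10 ^ 9 * σ ^ 2)) ≤ 0.25 * σ ^ 2 * l := by
    have h10 : (k : ℝ) ^ 4 ≤ (676 * σ ^ 2) ^ 2 := by
      calc (k : ℝ) ^ 4 = ((k : ℝ) ^ 2) ^ 2 := by ring
        _ ≤ _ := by gcongr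
    calc _ ≤ 400 * (676 * σ ^ 2) ^ 2 * (L / (4 * 10 ^ 9 * σ ^ 2)) := by
          gcongr
      _ = (400 * 676 ^ 2 / (4 * 10 ^ 9)) * σ ^ 2 * L := by field_simp
      _ ≤ 0.25 * σ ^ 2 * (23 / 48 * L - 1) := by nlinarith [sq_nonneg σ]
      _ ≤ _ := by gcongr
  have h10 : 0 ≤ (k : ℝ) ^ 4 := by positivity
  nlinarith [mul_nonneg (sq_nonneg σ) hl0.le]

theorem norm_bilinear_le {L σ l : ℝ} {k M : ℕ} (α : ℕ → ℝ)
    (h1 : ∀ i : ℕ, 1 ≤ i → |α i| ≤ Real.exp ((σ - i) * L))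
    (h2 : ∀ i : ℕ, 1 ≤ i → Real.exp ((σ - i) * L - (i + 1)) ≤ |α i|)
    (hM : (M : ℝ) = Real.exp l) (hl : l ≤ 23 / 48 * L) (hl' : 23 / 48 * L - 1 ≤ l) (hL : 1000 ≤ L)
    (hσ : 1 / 2 ≤ σ) (hk : 24 * σ ≤ k) (hk' : k ≤ 26 * σ) :
    ‖∑ a ∈ range M, ∑ b ∈ range M, e (∑ j : Fin k, α (j + 1) * ((a * b : ℕ) : ℝ) ^ (j.1 + 1))‖ ≤
      (M : ℝ) ^ 2 * Real.exp (2 - L / (4 * 10 ^ 9 * σ ^ 2)) := by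
  have hl0 : 0 < l := by linarith
  have hM1 : (1 : ℝ) ≤ M := by rw [hM]; exact Real.one_le_exp hl0.le
  have hM1' : 1 ≤ M := by exact_mod_cast hM1
  have hk12 : (12 : ℝ) ≤ k := by linarith
  have hk12' : 12 ≤ k := by exact_mod_cast hk12
  obtain ⟨s, hs⟩ : ∃ s, s = 10 * k ^ 2 := ⟨_, rfl⟩
  have hs100 : 100 ≤ s := by nlinarith
  have hsr : (s : ℝ) = 10 * (k : ℝ) ^ 2 := by rw [hs]; push_cast; ring
  have hs0 : (0 : ℝ) < s := by rw [hsr]; positivity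
  have hs2 := log_two_mul_le hσ hk12 hk' hsr
  have hbil := norm_bilinear_pow_le (fun j : Fin k => α (j + 1)) s M (by omega)
  rw [← pow_le_pow_iff_left₀ (norm_nonneg _) (by positivity) (show 4 * s ^ 2 ≠ 0 by positivity)]
  refine hbil.trans ?_
  have hprod := prod_squareSum_le α h1 h2 hM hl hl' hL hσ hk hs100 hsr hs2
  have hv := vmv_le_exp (k := k) (by omega) 10 hM1'
  rw [← hs] at hv
  have hv' : (vmv k s M : ℝ) ≤
      Real.exp (256 * k ^ 4 + (2 * s - k * (k + 1) / 2 + k * (k + 1) / 2 * Real.exp (-10)) * l) := by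
    refine hv.trans (le_of_eq ?_)
    rw [hM, ← Real.exp_mul, ← Real.exp_add, hsr]
    congr 1
    push_cast
    ring
  have hMp : (M : ℝ) ^ (8 * s ^ 2 - 4 * s) = Real.exp ((8 * s ^ 2 - 4 * s) * l) := by
    rw [hM, ← Real.exp_nat_mul]
    congr 2
    rw [Nat.cast_sub (by nlinarith)]
    push_cast
    ring
  calc _ ≤ Real.exp ((8 * s ^ 2 - 4 * s) * l) * Real.exp (256 * k ^ 4 +
        (2 * s - k * (k + 1) / 2 + k * (k + 1) / 2 * Real.exp (-10)) * l) ^ 2 *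
        Real.exp (60 * k ^ 4 + k * (k + 1) * l - 16 * σ ^ 2 / 50 * l) := by
        rw [← hMp]
        gcongr
        exact prod_nonneg fun _ _ => squareSum_nonneg _ _
    _ = Real.exp (8 * s ^ 2 * l + 572 * k ^ 4 + k * (k + 1) * Real.exp (-10) * l -
        16 * σ ^ 2 / 50 * l) := by
        rw [← Real.exp_nat_mul, ← Real.exp_add, ← Real.exp_add]
        congr 1
        push_cast
        ring
    _ ≤ Real.exp ((4 * s ^ 2 : ℕ) * (2 * l + (2 - L / (4 * 10 ^ 9 * σ ^ 2)))) := by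
        gcongr
        exact bilinear_exponent_le hl' hL hσ hk12 hk' hsr
    _ = _ := by
        rw [Real.exp_nat_mul, Real.exp_add, hM, ← Real.exp_nat_mul]
        norm_num

theorem norm_e_sub_le (x y : ℝ) : ‖e x - e y‖ ≤ 7 * |x - y| := by
  have h : e x - e y = e y * (e (x - y) - 1) := by
    rw [mul_sub, ← AddChar.map_add_eq_mul]; simp
  rw [h, norm_mul, norm_e, one_mul, e_apply, mul_comm _ Complex.I]
  refine (Real.norm_exp_I_mul_ofReal_sub_one_le).trans ?_
  rw [Real.norm_eq_abs, abs_mul, abs_of_pos (by positivity)]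
  gcongr
  linarith [Real.pi_lt_d2]

theorem div_add_eq_taylor (T n y : ℝ) (hn : 0 < n) (hy : 0 ≤ y) (k : ℕ) :
    T / (n + y) = T / n + ∑ j : Fin k, T * (-1) ^ (j.1 + 1) / n ^ (j.1 + 2) * y ^ (j.1 + 1) +
      T * (-y) ^ (k + 1) / (n ^ (k + 1) * (n + y)) := by
  have hny : n + y ≠ 0 := by positivity
  rw [Fin.sum_univ_eq_sum_range (fun j => T * (-1) ^ (j + 1) / n ^ (j + 2) * y ^ (j + 1)) k]
  induction k with
  | zero => simp; field_simp; ring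
  | succ k ih =>
    rw [ih, sum_range_succ]
    have : T * (-y) ^ (k + 1) / (n ^ (k + 1) * (n + y)) =
        T * (-1) ^ (k + 1) / n ^ (k + 2) * y ^ (k + 1) +
          T * (-y) ^ (k + 1 + 1) / (n ^ (k + 1 + 1) * (n + y)) := by
      rw [neg_pow y (k + 1), neg_pow y (k + 1 + 1)]
      field_simp
      ring
    rw [this]
    ring

theorem norm_sum_shift_sub_le (F : ℕ → ℂ) (hF : ∀ n, ‖F n‖ ≤ 1) (a b y : ℕ) :
    ‖∑ n ∈ Ico a b, F n - ∑ n ∈ Ico a b, F (n + y)‖ ≤ 2 * y := by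
  induction y with
  | zero => simp
  | succ y ih =>
    have h : ‖∑ n ∈ Ico a b, F (n + y) - ∑ n ∈ Ico a b, F (n + (y + 1))‖ ≤ 2 := by
      rw [← sum_sub_distrib, sum_Ico_eq_sum_range]
      have := sum_range_sub' (fun i => F (a + i + y)) (b - a)
      simp only [← add_assoc] at this ⊢
      simp_rw [add_right_comm _ y 1, this]
      exact (norm_sub_le _ _).trans (by linarith [hF (a + 0 + y), hF (a + (b - a) + y)])
    have h2 := norm_add_le (∑ n ∈ Ico a b, F n - ∑ n ∈ Ico a b, F (n + y))
      (∑ n ∈ Ico a b, F (n + y) - ∑ n ∈ Ico a b, F (n + (y + 1)))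
    rw [sub_add_sub_cancel] at h2
    push_cast
    linarith

theorem norm_sum_le_of_bilinear (F : ℕ → ℂ) (hF : ∀ n, ‖F n‖ ≤ 1) (a b M : ℕ) (hM : 1 ≤ M)
    {B : ℝ} (hB : ∀ n ∈ Ico a b, ‖∑ x ∈ range M, ∑ y ∈ range M, F (n + x * y)‖ ≤ M ^ 2 * B) :
    ‖∑ n ∈ Ico a b, F n‖ ≤ ((b - a : ℕ) : ℝ) * B + 2 * M ^ 2 := by
  have hM' : (0 : ℝ) < M := by exact_mod_cast hM
  have h1 : ((M : ℂ) ^ 2) * ∑ n ∈ Ico a b, F n = ∑ n ∈ Ico a b, ∑ x ∈ range M, ∑ y ∈ range M,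
      F (n + x * y) + ∑ x ∈ range M, ∑ y ∈ range M,
        (∑ n ∈ Ico a b, F n - ∑ n ∈ Ico a b, F (n + x * y)) := by
    simp_rw [sum_sub_distrib]
    rw [sum_comm]
    simp_rw [sum_comm (s := Ico a b) (t := range M)]
    simp
    ring
  have h2 : ‖∑ x ∈ range M, ∑ y ∈ range M,
      (∑ n ∈ Ico a b, F n - ∑ n ∈ Ico a b, F (n + x * y))‖ ≤ M ^ 2 * (2 * M ^ 2) := by
    calc _ ≤ ∑ x ∈ range M, ∑ y ∈ range M, (2 * (M : ℝ) ^ 2) := by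
          refine (norm_sum_le _ _).trans (sum_le_sum fun x hx => ?_)
          refine (norm_sum_le _ _).trans (sum_le_sum fun y hy => ?_)
          refine (norm_sum_shift_sub_le F hF a b _).trans ?_
          have := (mem_range.1 hx).le
          have := (mem_range.1 hy).le
          push_cast
          rw [sq]
          gcongr
      _ = _ := by simp; ring
  have h3 : ‖∑ n ∈ Ico a b, ∑ x ∈ range M, ∑ y ∈ range M, F (n + x * y)‖ ≤
      ((b - a : ℕ) : ℝ) * (M ^ 2 * B) := by
    refine (norm_sum_le _ _).trans ((sum_le_sum hB).trans (le_of_eq ?_))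
    simp
  have h4 := norm_add_le (∑ n ∈ Ico a b, ∑ x ∈ range M, ∑ y ∈ range M, F (n + x * y))
    (∑ x ∈ range M, ∑ y ∈ range M, (∑ n ∈ Ico a b, F n - ∑ n ∈ Ico a b, F (n + x * y)))
  rw [← h1, norm_mul, norm_pow, Complex.norm_natCast] at h4
  refine le_of_mul_le_mul_left (h4.trans ((add_le_add h3 h2).trans (le_of_eq ?_)))
    (show (0 : ℝ) < M ^ 2 by positivity)
  ring

theorem norm_sum_e_div_le_high {X T σ : ℝ} {a b : ℕ} (hX : 0 < X) (hL : 1000 ≤ Real.log X)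
    (ha : X ≤ a) (hb : b ≤ 2 * X) (hσ : 1 / 2 ≤ σ) (hT : |T| = X ^ (1 + σ)) :
    ‖∑ n ∈ Ico a b, e (T / n)‖ ≤ 100 * X * Real.exp (-(Real.log X / (4 * 10 ^ 9 * σ ^ 2))) := by
  set L := Real.log X with hLdef
  have hXL : X = Real.exp L := (Real.exp_log hX).symm
  have hTL : |T| = Real.exp ((1 + σ) * L) := by rw [hT, Real.rpow_def_of_pos hX, mul_comm]
  set M := ⌊Real.exp (23 / 48 * L)⌋₊ with hMdef
  have hbig : 2 ≤ Real.exp (23 / 48 * L) := by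
    linarith [Real.add_one_le_exp (23 / 48 * L)]
  have hM1 : (M : ℝ) ≤ Real.exp (23 / 48 * L) := Nat.floor_le (by positivity)
  have hM2 : Real.exp (23 / 48 * L) < M + 1 := Nat.lt_floor_add_one _
  have hM0 : (1 : ℝ) ≤ M := by linarith
  have hMn : 1 ≤ M := by exact_mod_cast hM0
  set l := Real.log M with hl
  have hMl : (M : ℝ) = Real.exp l := (Real.exp_log (by linarith)).symm
  have hl1 : l ≤ 23 / 48 * L := by rw [hl, Real.log_le_iff_le_exp (by linarith)]; exact hM1
  have hl2 : 23 / 48 * L - 1 ≤ l := by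
    rw [hl, Real.le_log_iff_exp_le (by linarith), Real.exp_sub]
    rw [div_le_iff₀ (Real.exp_pos _)]
    have : (2 : ℝ) ≤ Real.exp 1 := by linarith [Real.add_one_le_exp (1 : ℝ)]
    nlinarith
  have hMsq : (M : ℝ) ^ 2 ≤ X * Real.exp (-(L / 24)) := by
    calc (M : ℝ) ^ 2 ≤ Real.exp (23 / 48 * L) ^ 2 := by gcongr
      _ = _ := by
          rw [← Real.exp_nat_mul, hXL, ← Real.exp_add]; congr 1; push_cast; ring
  set k := ⌈24 * σ⌉₊ with hk
  have hk1 : 24 * σ ≤ k := Nat.le_ceil _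
  have hk2 : (k : ℝ) ≤ 26 * σ := by
    have := Nat.ceil_lt_add_one (show 0 ≤ 24 * σ by linarith)
    linarith
  set E := Real.exp (-(L / (4 * 10 ^ 9 * σ ^ 2))) with hE
  have hE' : Real.exp (-(L / 24)) ≤ E := by
    rw [hE]
    gcongr
    nlinarith
  have hpt : ∀ n ∈ Ico a b, ‖∑ x ∈ range M, ∑ y ∈ range M, e (T / ((n + x * y : ℕ) : ℝ))‖ ≤
      M ^ 2 * (15 * E) := by
    intro n hn
    rw [mem_Ico] at hn
    have hnX : X ≤ n := ha.trans (Nat.cast_le.2 hn.1)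
    have hnX2 : (n : ℝ) ≤ 2 * X := (Nat.cast_le.2 hn.2.le).trans hb
    have hn0 : (0 : ℝ) < n := hX.trans_le hnX
    set α : ℕ → ℝ := fun i => T * (-1) ^ i / (n : ℝ) ^ (i + 1) with hα
    have habs : ∀ i, |α i| = Real.exp ((1 + σ) * L) / (n : ℝ) ^ (i + 1) := by
      intro i
      rw [hα]
      simp only
      rw [abs_div, abs_mul, abs_pow, abs_neg, abs_one, one_pow, mul_one, hTL,
        abs_of_pos (by positivity)]
    have h1 : ∀ i : ℕ, 1 ≤ i → |α i| ≤ Real.exp ((σ - i) * L) := by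
      intro i _
      rw [habs, div_le_iff₀ (by positivity)]
      calc _ = Real.exp ((σ - i) * L) * X ^ (i + 1) := by
            rw [hXL, ← Real.exp_nat_mul, ← Real.exp_add]; congr 1; push_cast; ring
        _ ≤ _ := by gcongr
    have h2 : ∀ i : ℕ, 1 ≤ i → Real.exp ((σ - i) * L - (i + 1)) ≤ |α i| := by
      intro i _
      rw [habs, le_div_iff₀ (by positivity)]
      calc _ ≤ Real.exp ((σ - i) * L - (i + 1)) * (Real.exp 1 * X) ^ (i + 1) := by
            gcongr
            refine hnX2.trans ?_
            gcongr
            linarith [Real.add_one_le_exp (1 : ℝ)]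
        _ = _ := by
            rw [hXL, ← Real.exp_add, ← Real.exp_nat_mul, ← Real.exp_add]
            congr 1; push_cast; ring
    have hbil := norm_bilinear_le (k := k) α h1 h2 hMl hl1 hl2 hL hσ hk1 hk2
    have hterm : ∀ x ∈ range M, ∀ y ∈ range M, ‖e (T / ((n + x * y : ℕ) : ℝ)) -
        e (T / n) * e (∑ j : Fin k, α (j + 1) * ((x * y : ℕ) : ℝ) ^ (j.1 + 1))‖ ≤ 7 * E := by
      intro x hx y hy
      rw [← AddChar.map_add_eq_mul]
      refine (norm_e_sub_le _ _).trans ?_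
      have hxy : ((x * y : ℕ) : ℝ) ≤ M ^ 2 := by
        have := (mem_range.1 hx).le
        have := (mem_range.1 hy).le
        push_cast
        rw [sq]
        gcongr
      rw [Nat.cast_add, div_add_eq_taylor T n ((x * y : ℕ) : ℝ) hn0 (Nat.cast_nonneg _) k,
        add_sub_cancel_left]
      gcongr
      rw [abs_div, abs_mul, abs_pow, abs_neg,
        abs_of_nonneg (Nat.cast_nonneg (α := ℝ) (x * y)), hTL,
        abs_of_pos (by positivity)]
      refine le_trans ?_ hE'
      rw [div_le_iff₀ (by positivity)]
      calc _ ≤ Real.exp ((1 + σ) * L) * (X * Real.exp (-(L / 24))) ^ (k + 1) := by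
            gcongr
            exact hxy.trans hMsq
        _ = Real.exp ((1 + σ) * L - (k + 1) * (L / 24)) * X ^ (k + 1) := by
            rw [mul_pow, ← Real.exp_nat_mul, sub_eq_add_neg, Real.exp_add]
            push_cast
            rw [mul_neg]
            ring
        _ ≤ Real.exp (-(L / 24) + L) * X ^ (k + 1) := by
            gcongr
            nlinarith
        _ = Real.exp (-(L / 24)) * (X ^ (k + 1) * X) := by
            rw [Real.exp_add, ← hXL]; ring
        _ ≤ _ := by
            gcongr
            have : (0 : ℝ) ≤ ((x * y : ℕ) : ℝ) := Nat.cast_nonneg _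
            linarith
    have hsplit : ∑ x ∈ range M, ∑ y ∈ range M, e (T / ((n + x * y : ℕ) : ℝ)) =
        ∑ x ∈ range M, ∑ y ∈ range M, (e (T / ((n + x * y : ℕ) : ℝ)) -
          e (T / n) * e (∑ j : Fin k, α (j + 1) * ((x * y : ℕ) : ℝ) ^ (j.1 + 1))) +
        e (T / n) * ∑ x ∈ range M, ∑ y ∈ range M,
          e (∑ j : Fin k, α (j + 1) * ((x * y : ℕ) : ℝ) ^ (j.1 + 1)) := by
      simp_rw [sum_sub_distrib, mul_sum]
      ring
    rw [hsplit]
    have he2 : Real.exp 2 ≤ 8 := by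
      have : Real.exp 2 = Real.exp 1 ^ 2 := by rw [← Real.exp_nat_mul]; norm_num
      rw [this]
      nlinarith [Real.exp_one_lt_d9, Real.exp_pos 1]
    calc _ ≤ ∑ x ∈ range M, ∑ y ∈ range M, 7 * E + M ^ 2 * (8 * E) := by
          refine (norm_add_le _ _).trans (add_le_add ?_ ?_)
          · refine (norm_sum_le _ _).trans (sum_le_sum fun x hx => ?_)
            exact (norm_sum_le _ _).trans (sum_le_sum fun y hy => hterm x hx y hy)
          · rw [norm_mul, norm_e, one_mul]
            refine hbil.trans ?_
            rw [sub_eq_add_neg, Real.exp_add]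
            gcongr
      _ = _ := by simp; ring
  refine (norm_sum_le_of_bilinear (fun n => e (T / n)) (fun n => (norm_e _).le) a b M hMn
    hpt).trans ?_
  have hba : ((b - a : ℕ) : ℝ) ≤ X := by
    rcases le_total a b with h | h
    · rw [Nat.cast_sub h]; linarith
    · rw [Nat.sub_eq_zero_of_le h, Nat.cast_zero]; exact hX.le
  have hE0 : 0 < E := Real.exp_pos _
  have : (M : ℝ) ^ 2 ≤ X * E := hMsq.trans (by gcongr)
  nlinarith [mul_le_mul_of_nonneg_right hba hE0.le, mul_pos hX hE0]

/-- The Kusmin-Landau range. -/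
theorem norm_sum_e_div_le_low {X T : ℝ} {a b : ℕ} (hX : 0 < X) (ha : X ≤ a) (hb : b ≤ 2 * X)
    (hT0 : T ≠ 0) (hT : |T| ≤ X ^ 2 / 2) :
    ‖∑ n ∈ Ico a b, e (T / n)‖ ≤ 8 * X ^ 2 / |T| := by
  have key : ∀ S : ℝ, 0 < S → S ≤ X ^ 2 / 2 → ‖∑ n ∈ Ico a b, e (-(S / n))‖ ≤ 8 * X ^ 2 / S := by
    intro S hS hS2
    rw [sum_Ico_eq_sum_range]
    have hstep : ∀ n : ℕ, -(S / ((a + (n + 1) : ℕ) : ℝ)) - -(S / ((a + n : ℕ) : ℝ)) =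
        S / ((a + n : ℝ) * (a + n + 1)) := by
      intro n
      have : (0 : ℝ) < a + n := by linarith [Nat.cast_nonneg (α := ℝ) n]
      push_cast
      field_simp
      ring
    have := norm_sum_e_le_of_antitone (fun n => -(S / ((a + n : ℕ) : ℝ)))
      (θ := S / (4 * X ^ 2)) (by positivity) (b - a) ?_ ?_ ?_
    · refine this.trans (le_of_eq ?_)
      field_simp
      norm_num
    · intro n hn
      rw [hstep]
      have h1 : (0 : ℝ) < a + n := by linarith [Nat.cast_nonneg (α := ℝ) n]
      have h2 : (a + n + 1 : ℝ) ≤ b := by exact_mod_cast (by omega : a + n + 1 ≤ b)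
      refine div_le_div_of_nonneg_left hS.le (by positivity) ?_
      nlinarith
    · intro n hn
      rw [hstep, div_le_iff₀ (by nlinarith [Nat.cast_nonneg (α := ℝ) n])]
      have : (0 : ℝ) ≤ n := Nat.cast_nonneg n
      nlinarith
    · intro n hn
      rw [hstep (n + 1), hstep]
      have : (0 : ℝ) ≤ n := Nat.cast_nonneg n
      have h1 : (0 : ℝ) < a := by linarith
      push_cast
      gcongr <;> linarith
  rcases lt_or_gt_of_ne hT0 with h | h
  · rw [abs_of_neg h] at hT ⊢
    have := key (-T) (by linarith) hT
    simpa [neg_div] using this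
  · rw [abs_of_pos h] at hT ⊢
    have := key T h hT
    rwa [norm_sum_e_neg] at this

/-- Vinogradov's bound for `∑ e (T / n)` over a subinterval of `[X, 2X]`. -/
theorem norm_sum_e_div_le {X T κ : ℝ} {a b : ℕ} (hX : 1 ≤ X) (ha : X ≤ a) (hb : b ≤ 2 * X)
    (hκ : 1 ≤ κ) (hT1 : X ≤ |T|) (hT2 : |T| ≤ X ^ κ) :
    ‖∑ n ∈ Ico a b, e (T / n)‖ ≤
      100 * X * Real.exp (-(Real.log X / (4 * 10 ^ 9 * κ ^ 2))) + 8 * X ^ 2 / |T| := by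
  have hX0 : 0 < X := by linarith
  have hT0 : 0 < |T| := hX0.trans_le hT1
  rcases lt_or_ge (Real.log X) 1000 with hL | hL
  · have hba : ((#(Ico a b) : ℕ) : ℝ) ≤ X := by
      rw [Nat.card_Ico]
      rcases le_total a b with h | h
      · rw [Nat.cast_sub h]; linarith
      · rw [Nat.sub_eq_zero_of_le h, Nat.cast_zero]; exact hX0.le
    refine (norm_sum_e_le _ _).trans (hba.trans ?_)
    have h1 : Real.log X / (4 * 10 ^ 9 * κ ^ 2) ≤ 1 / 2 := by
      rw [div_le_iff₀ (by positivity)]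
      nlinarith
    have h2 := Real.add_one_le_exp (-(Real.log X / (4 * 10 ^ 9 * κ ^ 2)))
    have h3 : 0 ≤ 8 * X ^ 2 / |T| := by positivity
    nlinarith
  · set σ := Real.log |T| / Real.log X - 1 with hσ
    have hTσ : |T| = X ^ (1 + σ) := by
      rw [Real.rpow_def_of_pos hX0, hσ, add_sub_cancel, mul_div_cancel₀ _ (by linarith),
        Real.exp_log hT0]
    rcases lt_or_ge σ (1 / 2) with h | h
    · refine le_trans (norm_sum_e_div_le_low hX0 ha hb (abs_pos.1 hT0) ?_)
        (le_add_of_nonneg_left (by positivity))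
      rw [hTσ, Real.rpow_def_of_pos hX0]
      have hX2 : X ^ 2 / 2 = Real.exp (2 * Real.log X - Real.log 2) := by
        rw [Real.exp_sub, Real.exp_log (by norm_num), two_mul, Real.exp_add, Real.exp_log hX0, sq]
      rw [hX2]
      gcongr
      have := Real.log_two_lt_d9
      nlinarith
    · have hσκ : σ ≤ κ := by
        have h1 : X ^ (1 + σ) ≤ X ^ κ := hTσ ▸ hT2
        have h2 := (Real.rpow_le_rpow_left_iff (x := X)
          (by rw [← Real.log_pos_iff hX0.le]; linarith)).1 h1
        linarith
      refine (norm_sum_e_div_le_high hX0 hL ha hb h hTσ).trans ?_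
      have h3 : 0 ≤ 8 * X ^ 2 / |T| := by positivity
      refine le_add_of_le_of_nonneg ?_ h3
      gcongr

theorem sum_inv_le_one_add_log (N : ℕ) : ∑ n ∈ Icc 1 N, (1 : ℝ) / n ≤ 1 + Real.log N := by
  have h := harmonic_le_one_add_log N
  rw [harmonic_eq_sum_Icc] at h
  push_cast at h
  simpa [one_div] using h

theorem card_divisors_sq_le {n N : ℕ} (hn : n ∈ Icc 1 N) :
    #n.divisors ^ 2 ≤
      #{t ∈ Icc 1 N ×ˢ Icc 1 N ×ˢ Icc 1 N | t.1 * t.2.1 * t.2.2 ∣ n} := by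
  rw [mem_Icc] at hn
  rw [sq, ← card_product]
  refine card_le_card_of_injOn
    (fun d => (d.1.gcd d.2, d.1 / d.1.gcd d.2, d.2 / d.1.gcd d.2)) ?_ ?_
  · rintro ⟨a, b⟩ h
    simp only [coe_product, Set.mem_prod, mem_coe, Nat.mem_divisors] at h
    obtain ⟨⟨ha, hn0⟩, hb, -⟩ := h
    have ha0 : 0 < a := Nat.pos_of_dvd_of_pos ha hn.1
    have hb0 : 0 < b := Nat.pos_of_dvd_of_pos hb hn.1
    have hg : 0 < a.gcd b := Nat.gcd_pos_of_pos_left _ ha0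
    have haN : a ≤ N := (Nat.le_of_dvd hn.1 ha).trans hn.2
    have hbN : b ≤ N := (Nat.le_of_dvd hn.1 hb).trans hn.2
    have hga := Nat.le_of_dvd ha0 (Nat.gcd_dvd_left a b)
    have hgb := Nat.le_of_dvd hb0 (Nat.gcd_dvd_right a b)
    simp only [coe_filter, mem_product, mem_Icc, Set.mem_ofPred_eq]
    refine ⟨⟨⟨hg, hga.trans haN⟩, ⟨Nat.div_pos hga hg, (Nat.div_le_self _ _).trans haN⟩,
      Nat.div_pos hgb hg, (Nat.div_le_self _ _).trans hbN⟩, ?_⟩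
    have : a.gcd b * (a / a.gcd b) * (b / a.gcd b) = a.lcm b := by
      rw [Nat.mul_div_cancel' (Nat.gcd_dvd_left a b), Nat.lcm,
        Nat.mul_div_assoc _ (Nat.gcd_dvd_right a b)]
    rw [this]
    exact Nat.lcm_dvd ha hb
  · rintro ⟨a, b⟩ - ⟨a', b'⟩ - h
    simp only [Prod.mk.injEq] at h
    obtain ⟨h1, h2, h3⟩ := h
    rw [Prod.mk.injEq]
    constructor
    · rw [← Nat.mul_div_cancel' (Nat.gcd_dvd_left a b), h2, h1,
        Nat.mul_div_cancel' (Nat.gcd_dvd_left a' b')]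
    · rw [← Nat.mul_div_cancel' (Nat.gcd_dvd_right a b), h3, h1,
        Nat.mul_div_cancel' (Nat.gcd_dvd_right a' b')]

theorem sum_card_divisors_sq_le (N : ℕ) :
    ∑ n ∈ Icc 1 N, (#n.divisors : ℝ) ^ 2 ≤ N * (1 + Real.log N) ^ 3 := by
  calc ∑ n ∈ Icc 1 N, (#n.divisors : ℝ) ^ 2
      ≤ ∑ n ∈ Icc 1 N, ∑ t ∈ Icc 1 N ×ˢ Icc 1 N ×ˢ Icc 1 N,
          if t.1 * t.2.1 * t.2.2 ∣ n then (1 : ℝ) else 0 := by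
        refine sum_le_sum fun n hn => ?_
        rw [sum_boole]
        exact_mod_cast card_divisors_sq_le hn
    _ = ∑ t ∈ Icc 1 N ×ˢ Icc 1 N ×ˢ Icc 1 N, ((N / (t.1 * t.2.1 * t.2.2) : ℕ) : ℝ) := by
        rw [sum_comm]
        refine sum_congr rfl fun t _ => ?_
        rw [sum_boole, ← Nat.Ioc_filter_dvd_card_eq_div]
        rfl
    _ ≤ ∑ t ∈ Icc 1 N ×ˢ Icc 1 N ×ˢ Icc 1 N,
          (N : ℝ) * ((1 / t.1) * ((1 / t.2.1) * (1 / t.2.2))) := by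
        refine sum_le_sum fun t _ => Nat.cast_div_le.trans (le_of_eq ?_)
        push_cast
        ring
    _ = N * (∑ n ∈ Icc 1 N, (1 : ℝ) / n) ^ 3 := by
        rw [← mul_sum, sum_product]
        simp_rw [sum_product]
        simp only [← mul_sum, ← sum_mul]
        ring
    _ ≤ _ := by
        refine mul_le_mul_of_nonneg_left ?_ (Nat.cast_nonneg N)
        exact pow_le_pow_left₀ (sum_nonneg fun _ _ => by positivity) (sum_inv_le_one_add_log N) 3

/-- Summation by parts for a monotone weight. -/
theorem norm_sum_sub_smul_le {w : ℕ → ℝ} (hw : Monotone w) {f : ℕ → ℂ} {a b : ℕ} {B : ℝ}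
    (hab : a ≤ b) (hB : ∀ c, a ≤ c → c ≤ b → ‖∑ n ∈ Ioc c b, f n‖ ≤ B) :
    ‖∑ n ∈ Ioc a b, (w n - w a : ℝ) * f n‖ ≤ (w b - w a) * B := by
  induction hab using Nat.decreasingInduction with
  | self => simp
  | of_succ k hk ih =>
    have h1 := ih fun c hc hcb => hB c (by omega) hcb
    have h2 := hB k le_rfl hk.le
    have e1 : ∑ n ∈ Ioc k b, (w n - w k : ℝ) * f n
        = ∑ n ∈ Ioc (k + 1) b, (w n - w (k + 1) : ℝ) * f n
          + (w (k + 1) - w k : ℝ) * ∑ n ∈ Ioc k b, f n := by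
      have e2 (g : ℕ → ℂ) : ∑ n ∈ Ioc k b, g n = g (k + 1) + ∑ n ∈ Ioc (k + 1) b, g n := by
        rw [← Finset.insert_Ioc_add_one_left_eq_Ioc hk, sum_insert (by simp)]
      rw [e2, e2 f, mul_add, add_left_comm, mul_sum, ← sum_add_distrib]
      congr 1
      refine sum_congr rfl fun n _ => ?_
      push_cast
      ring
    rw [e1]
    have h3 : ‖((w (k + 1) - w k : ℝ) : ℂ) * ∑ n ∈ Ioc k b, f n‖ ≤ (w (k + 1) - w k) * B := by
      rw [norm_mul, Complex.norm_real, Real.norm_of_nonneg (sub_nonneg.2 (hw (Nat.le_succ k)))]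
      exact mul_le_mul_of_nonneg_left h2 (sub_nonneg.2 (hw (Nat.le_succ k)))
    refine (norm_add_le _ _).trans ((add_le_add h1 h3).trans (le_of_eq ?_))
    ring

theorem norm_sum_smul_le {w : ℕ → ℝ} (hw : Monotone w) {f : ℕ → ℂ} {a b : ℕ} {B : ℝ}
    (hw0 : 0 ≤ w a) (hab : a ≤ b) (hB : ∀ c, a ≤ c → c ≤ b → ‖∑ n ∈ Ioc c b, f n‖ ≤ B) :
    ‖∑ n ∈ Ioc a b, (w n : ℂ) * f n‖ ≤ w b * B := by
  have h1 := norm_sum_sub_smul_le hw hab hB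
  have h2 : ‖(w a : ℂ) * ∑ n ∈ Ioc a b, f n‖ ≤ w a * B := by
    rw [norm_mul, Complex.norm_real, Real.norm_of_nonneg hw0]
    exact mul_le_mul_of_nonneg_left (hB a le_rfl hab) hw0
  have e1 : ∑ n ∈ Ioc a b, (w n : ℂ) * f n
      = ∑ n ∈ Ioc a b, (w n - w a : ℝ) * f n + (w a : ℂ) * ∑ n ∈ Ioc a b, f n := by
    rw [mul_sum, ← sum_add_distrib]
    refine sum_congr rfl fun n _ => ?_
    push_cast
    ring
  rw [e1]
  refine (norm_add_le _ _).trans ((add_le_add h1 h2).trans (le_of_eq ?_))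
  ring

/-- The saving factor in exponential sums over intervals and over primes. -/
noncomputable def saving (P k : ℝ) : ℝ := Real.exp (-(Real.log P / (3 * 10 ^ 11 * k ^ 2)))

theorem saving_pos (P k : ℝ) : 0 < saving P k := Real.exp_pos _

theorem norm_sum_Ioc_e_div_le {P X T k : ℝ} {a b : ℕ} (hP : 1 ≤ P) (hX1 : 1 ≤ X)
    (hX : Real.log P ≤ 4 * Real.log X)
    (ha : X ≤ a + 1) (hb : b ≤ 2 * X) (hk : 1 ≤ k) (hT0 : T ≠ 0) (hT : |T| ≤ P ^ k) :
    ‖∑ n ∈ Ioc a b, e (T / n)‖ ≤ 101 * X * saving P k + 8 * X ^ 2 / |T| := by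
  have hX0 : 0 < X := by linarith
  have hs := saving_pos P k
  have hT0' : 0 < |T| := abs_pos.2 hT0
  rcases lt_or_ge |T| X with h | h
  · have h1 : ‖∑ n ∈ Ioc a b, e (T / n)‖ ≤ 2 * X := by
      refine (norm_sum_e_le _ _).trans (le_trans ?_ hb)
      simp
    have h2 : 2 * X ≤ 8 * X ^ 2 / |T| := by
      rw [le_div_iff₀ hT0']
      nlinarith
    have := mul_pos (mul_pos (by norm_num : (0 : ℝ) < 101) hX0) hs
    linarith
  · have hlogP : 0 ≤ Real.log P := Real.log_nonneg hP
    have hT2 : |T| ≤ X ^ (4 * k) := by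
      refine hT.trans ?_
      rw [Real.rpow_def_of_pos (by linarith), Real.rpow_def_of_pos hX0]
      exact Real.exp_le_exp.2 (by nlinarith)
    have hexp : Real.exp (-(Real.log X / (4 * 10 ^ 9 * (4 * k) ^ 2))) ≤ saving P k := by
      refine Real.exp_le_exp.2 (neg_le_neg ?_)
      rw [div_le_div_iff₀ (by positivity) (by positivity)]
      have : 0 ≤ k ^ 2 := by positivity
      nlinarith
    have hXs : 1 ≤ X * saving P k := by
      rw [← Real.exp_log hX0, saving, ← Real.exp_add]
      refine Real.one_le_exp ?_
      have : Real.log P / (3 * 10 ^ 11 * k ^ 2) ≤ Real.log P / 4 := by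
        refine div_le_div_of_nonneg_left hlogP (by norm_num) ?_
        nlinarith
      linarith
    have key (b' : ℕ) (hb' : b' ≤ 2 * X) : ‖∑ n ∈ Ico (a + 1) b', e (T / n)‖
        ≤ 100 * X * saving P k + 8 * X ^ 2 / |T| := by
      refine (norm_sum_e_div_le (κ := 4 * k) hX1 (by exact_mod_cast ha) hb' (by linarith) h
        hT2).trans ?_
      gcongr
    rcases le_or_gt b a with hab | hab
    · rw [Ioc_eq_empty_of_le hab, sum_empty, norm_zero]
      positivity
    · have e1 : Ioc a b = insert b (Ico (a + 1) b) := by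
        ext n
        simp only [mem_Ioc, mem_insert, mem_Ico]
        omega
      rw [e1, sum_insert (by simp)]
      refine (norm_add_le _ _).trans ?_
      rw [norm_e]
      linarith [key b hb]

theorem sum_Ioc_mul_apply (f g : ArithmeticFunction ℝ) (F : ℕ → ℂ) (P Q : ℕ) :
    ∑ n ∈ Ioc P Q, ((f * g) n : ℂ) * F n
      = ∑ a ∈ Icc 1 Q, ∑ b ∈ Ioc (P / a) (Q / a), (f a : ℂ) * ((g b : ℂ) * F (a * b)) := by
  simp_rw [ArithmeticFunction.mul_apply]
  push_cast
  simp_rw [sum_mul]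
  rw [sum_sigma', sum_sigma']
  refine sum_nbij' (fun t => ⟨t.2.1, t.2.2⟩) (fun t => ⟨t.1 * t.2, (t.1, t.2)⟩) ?_ ?_ ?_ ?_ ?_
  · rintro ⟨n, a, b⟩ h
    simp only [mem_sigma, mem_Ioc, Nat.mem_divisorsAntidiagonal, mem_Icc] at h ⊢
    obtain ⟨⟨h1, h2⟩, h3, h4⟩ := h
    subst h3
    have ha : 0 < a := Nat.pos_of_ne_zero (left_ne_zero_of_mul h4)
    have hb : 0 < b := Nat.pos_of_ne_zero (right_ne_zero_of_mul h4)
    refine ⟨⟨ha, (Nat.le_mul_of_pos_right a hb).trans h2⟩, ?_, ?_⟩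
    · rwa [Nat.div_lt_iff_lt_mul ha, mul_comm]
    · rwa [Nat.le_div_iff_mul_le ha, mul_comm]
  · rintro ⟨a, b⟩ h
    simp only [mem_sigma, mem_Ioc, Nat.mem_divisorsAntidiagonal, mem_Icc] at h ⊢
    obtain ⟨⟨h1, h2⟩, h3, h4⟩ := h
    rw [Nat.div_lt_iff_lt_mul h1, mul_comm] at h3
    rw [Nat.le_div_iff_mul_le h1, mul_comm] at h4
    exact ⟨⟨h3, h4⟩, trivial, by omega⟩
  · rintro ⟨n, a, b⟩ h
    simp only [mem_sigma, Nat.mem_divisorsAntidiagonal] at h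
    obtain ⟨-, h3, -⟩ := h
    subst h3
    rfl
  · rintro ⟨a, b⟩ -
    rfl
  · rintro ⟨n, a, b⟩ h
    simp only [mem_sigma, Nat.mem_divisorsAntidiagonal] at h
    obtain ⟨-, h3, -⟩ := h
    subst h3
    simp only [mul_assoc]

/-- Type I estimate: one variable is short and the other carries a monotone weight. -/
theorem norm_sum_mul_e_div_le {f g : ArithmeticFunction ℝ} {w : ℕ → ℝ} {P V : ℕ} {T k A : ℝ}
    (hV : 1 ≤ V) (hVP : V ≤ P) (hlog : Real.log P ≤ 4 * Real.log (P / V)) (hk : 1 ≤ k)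
    (hT0 : T ≠ 0) (hT : |T| ≤ (P : ℝ) ^ k) (hA : ∀ n, |f n| ≤ A) (hf : ∀ n, V < n → f n = 0)
    (hw : Monotone w) (hw0 : ∀ n, 0 ≤ w n) (hg : ∀ n, 1 ≤ n → g n = w n) :
    ‖∑ n ∈ Ioc P (2 * P), ((f * g) n : ℂ) * e (T / n)‖
      ≤ A * w (2 * P) * (1 + Real.log V) * (101 * P * saving P k + 8 * P ^ 2 / |T|) := by
  have hT0' : 0 < |T| := abs_pos.2 hT0
  have hA0 : 0 ≤ A := (abs_nonneg _).trans (hA 0)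
  have hP : (1 : ℝ) ≤ P := by exact_mod_cast hV.trans hVP
  have hsv := saving_pos P k
  rw [sum_Ioc_mul_apply f g (fun n => e (T / n))]
  have h1 : ∑ a ∈ Icc 1 (2 * P), ∑ b ∈ Ioc (P / a) (2 * P / a),
      (f a : ℂ) * ((g b : ℂ) * e (T / (a * b : ℕ)))
      = ∑ a ∈ Icc 1 V, (f a : ℂ) * ∑ b ∈ Ioc (P / a) (2 * P / a),
        (w b : ℂ) * e (T / a / b) := by
    symm
    refine (sum_subset (Icc_subset_Icc_right (by omega)) fun a _ ha => ?_).trans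
      (sum_congr rfl fun a _ => ?_)
    · rw [mem_Icc] at *
      rw [hf a (by omega)]
      simp
    · rw [mul_sum]
      refine sum_congr rfl fun b hb => ?_
      rw [mem_Ioc] at hb
      rw [hg b (Nat.one_le_of_lt hb.1)]
      push_cast
      rw [div_div]
  rw [h1]
  have h2 (a : ℕ) (ha : a ∈ Icc 1 V) : ‖(f a : ℂ) * ∑ b ∈ Ioc (P / a) (2 * P / a),
        (w b : ℂ) * e (T / a / b)‖
      ≤ A * w (2 * P) * (101 * P * saving P k + 8 * P ^ 2 / |T|) * (1 / a) := by
    rw [mem_Icc] at ha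
    have ha0 : (0 : ℝ) < a := by exact_mod_cast ha.1
    have haV : (a : ℝ) ≤ V := by exact_mod_cast ha.2
    have hX1 : (1 : ℝ) ≤ P / a := by
      rw [le_div_iff₀ ha0, one_mul]
      exact_mod_cast ha.2.trans hVP
    have hP0 : (0 : ℝ) < P := by linarith
    have hTa : T / a ≠ 0 := div_ne_zero hT0 ha0.ne'
    have hs (c : ℕ) (hc : P / a ≤ c) : ‖∑ b ∈ Ioc c (2 * P / a), e (T / a / b)‖
        ≤ (101 * P * saving P k + 8 * P ^ 2 / |T|) * (1 / a) := by
      refine (norm_sum_Ioc_e_div_le (X := P / a) hP hX1 (hlog.trans ?_) ?_ ?_ hk hTa ?_).trans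
        (le_of_eq ?_)
      · have := Real.log_le_log (by positivity)
          (div_le_div_of_nonneg_left hP0.le ha0 haV)
        linarith
      · have : (P : ℝ) / a < (P / a : ℕ) + 1 := by
          rw [div_lt_iff₀ ha0]
          exact_mod_cast Nat.lt_mul_of_div_lt (Nat.lt_succ_self (P / a)) ha.1
        have hc' : ((P / a : ℕ) : ℝ) ≤ c := by exact_mod_cast hc
        linarith
      · refine Nat.cast_div_le.trans (le_of_eq ?_)
        push_cast
        ring
      · refine le_trans ?_ hT
        rw [abs_div, Nat.abs_cast]
        exact div_le_self (abs_nonneg _) (by exact_mod_cast ha.1)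
      · rw [abs_div, Nat.abs_cast]
        field_simp
    have hle : P / a ≤ 2 * P / a := Nat.div_le_div_right (by omega)
    have h3 := norm_sum_smul_le hw (hw0 _) hle (fun c hc _ => hs c hc)
    have h4 : w (2 * P / a) ≤ w (2 * P) := hw (Nat.div_le_self _ _)
    rw [norm_mul, Complex.norm_real, Real.norm_eq_abs]
    calc _ ≤ A * (w (2 * P) * ((101 * P * saving P k + 8 * P ^ 2 / |T|) * (1 / a))) := by
          refine mul_le_mul (hA a) (h3.trans ?_) (norm_nonneg _) hA0
          exact mul_le_mul_of_nonneg_right h4 (by positivity)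
      _ = _ := by ring
  refine (norm_sum_le _ _).trans ((sum_le_sum h2).trans ?_)
  rw [← mul_sum]
  have h5 := sum_inv_le_one_add_log V
  have h6 : 0 ≤ A * w (2 * P) * (101 * P * saving P k + 8 * P ^ 2 / |T|) :=
    mul_nonneg (mul_nonneg hA0 (hw0 _)) (by positivity)
  refine (mul_le_mul_of_nonneg_left h5 h6).trans (le_of_eq ?_)
  ring

theorem norm_sum_sum_sq_le (S R : Finset ℕ) (α β : ℕ → ℝ) (G : ℕ → ℕ → ℂ) :
    ‖∑ b ∈ R, (β b : ℂ) * ∑ a ∈ S, (α a : ℂ) * G a b‖ ^ 2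
      ≤ (∑ b ∈ R, β b ^ 2) *
        ∑ a ∈ S, ∑ a' ∈ S, |α a| * |α a'| * ‖∑ b ∈ R, G a b * (starRingEnd ℂ) (G a' b)‖ := by
  have h1 : ‖∑ b ∈ R, (β b : ℂ) * ∑ a ∈ S, (α a : ℂ) * G a b‖
      ≤ ∑ b ∈ R, |β b| * ‖∑ a ∈ S, (α a : ℂ) * G a b‖ := by
    refine (norm_sum_le _ _).trans (le_of_eq (sum_congr rfl fun b _ => ?_))
    rw [norm_mul, Complex.norm_real, Real.norm_eq_abs]
  have h2 := sum_mul_sq_le_sq_mul_sq R (fun b => |β b|) (fun b => ‖∑ a ∈ S, (α a : ℂ) * G a b‖)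
  simp only [sq_abs] at h2
  refine (pow_le_pow_left₀ (norm_nonneg _) h1 2).trans (h2.trans ?_)
  refine mul_le_mul_of_nonneg_left ?_ (sum_nonneg fun _ _ => sq_nonneg _)
  have h3 : ((∑ b ∈ R, ‖∑ a ∈ S, (α a : ℂ) * G a b‖ ^ 2 : ℝ) : ℂ)
      = ∑ a ∈ S, ∑ a' ∈ S, (α a * α a' : ℝ) * ∑ b ∈ R, G a b * (starRingEnd ℂ) (G a' b) := by
    push_cast
    simp_rw [← Complex.mul_conj', map_sum, sum_mul_sum, mul_sum]
    rw [sum_comm]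
    refine sum_congr rfl fun a _ => ?_
    rw [sum_comm]
    refine sum_congr rfl fun a' _ => sum_congr rfl fun b _ => ?_
    simp only [map_mul, Complex.conj_ofReal]
    ring
  have h4 : ∑ b ∈ R, ‖∑ a ∈ S, (α a : ℂ) * G a b‖ ^ 2
      = ‖((∑ b ∈ R, ‖∑ a ∈ S, (α a : ℂ) * G a b‖ ^ 2 : ℝ) : ℂ)‖ := by
    rw [Complex.norm_real, Real.norm_of_nonneg (sum_nonneg fun _ _ => sq_nonneg _)]
  rw [h4, h3]
  refine (norm_sum_le _ _).trans (sum_le_sum fun a _ => (norm_sum_le _ _).trans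
    (le_of_eq (sum_congr rfl fun a' _ => ?_)))
  rw [norm_mul, Complex.norm_real, Real.norm_eq_abs, abs_mul]

theorem sum_inv_abs_sub_le (N : ℕ) {a : ℕ} (ha : a ∈ Icc 1 N) :
    ∑ a' ∈ (Icc 1 N).erase a, 1 / |(a : ℝ) - a'| ≤ 2 * (1 + Real.log N) := by
  rw [mem_Icc] at ha
  have e1 : (Icc 1 N).erase a = Ico 1 a ∪ Ioc a N := by
    ext x
    simp only [mem_erase, mem_Icc, mem_union, mem_Ico, mem_Ioc]
    omega
  have hd : Disjoint (Ico 1 a) (Ioc a N) := by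
    rw [disjoint_left]
    intro x hx hx'
    rw [mem_Ico] at hx
    rw [mem_Ioc] at hx'
    omega
  rw [e1, sum_union hd, two_mul]
  refine add_le_add (le_trans ?_ (sum_inv_le_one_add_log N))
    (le_trans ?_ (sum_inv_le_one_add_log N))
  · have e2 : ∑ x ∈ Ico 1 a, 1 / |(a : ℝ) - x| = ∑ x ∈ Ico 1 a, 1 / (x : ℝ) := by
      refine sum_nbij' (fun x => a - x) (fun x => a - x) ?_ ?_ ?_ ?_ ?_
      all_goals intro x hx; rw [mem_Ico] at hx
      · rw [mem_Ico]; omega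
      · rw [mem_Ico]; omega
      · omega
      · omega
      · rw [Nat.cast_sub hx.2.le, abs_of_nonneg]
        exact sub_nonneg.2 (by exact_mod_cast hx.2.le)
    rw [e2]
    refine sum_le_sum_of_subset_of_nonneg ?_ fun _ _ _ => by positivity
    intro x hx
    rw [mem_Ico] at hx
    rw [mem_Icc]
    omega
  · have e2 : ∑ x ∈ Ioc a N, 1 / |(a : ℝ) - x| = ∑ x ∈ Icc 1 (N - a), 1 / (x : ℝ) := by
      refine sum_nbij' (fun x => x - a) (fun x => x + a) ?_ ?_ ?_ ?_ ?_
      · intro x hx; rw [mem_Ioc] at hx; rw [mem_Icc]; omega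
      · intro x hx; rw [mem_Icc] at hx; rw [mem_Ioc]; omega
      · intro x hx; rw [mem_Ioc] at hx; omega
      · intro x hx; omega
      · intro x hx
        rw [mem_Ioc] at hx
        rw [Nat.cast_sub hx.1.le, abs_sub_comm, abs_of_nonneg]
        exact sub_nonneg.2 (by exact_mod_cast hx.1.le)
    rw [e2]
    refine sum_le_sum_of_subset_of_nonneg ?_ fun _ _ _ => by positivity
    exact Icc_subset_Icc_right (by omega)

/-- The kernel of the bilinear sums with `P < a * b ≤ 2 * P`. -/
noncomputable def hyperbolaKernel (P : ℕ) (T : ℝ) (a b : ℕ) : ℂ :=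
  if P < a * b ∧ a * b ≤ 2 * P then e (T / (a * b)) else 0

theorem norm_hyperbolaKernel_le (P : ℕ) (T : ℝ) (a b : ℕ) : ‖hyperbolaKernel P T a b‖ ≤ 1 := by
  rw [hyperbolaKernel]
  split_ifs <;> simp

theorem norm_sum_hyperbolaKernel_le {P B N a a' : ℕ} {T k : ℝ} (hP : 1 ≤ P) (hB : 1 ≤ B)
    (hlog : Real.log P ≤ 4 * Real.log B) (hk : 1 ≤ k) (hT0 : T ≠ 0) (hT : |T| ≤ (P : ℝ) ^ k)
    (ha : a ∈ Icc 1 N) (ha' : a' ∈ Icc 1 N) (hne : a ≠ a') :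
    ‖∑ b ∈ Ioc B (2 * B), hyperbolaKernel P T a b * (starRingEnd ℂ) (hyperbolaKernel P T a' b)‖
      ≤ 101 * B * saving P k + 8 * B ^ 2 * N ^ 2 / |T| * (1 / |(a : ℝ) - a'|) := by
  rw [mem_Icc] at ha ha'
  have ha0 : (0 : ℝ) < a := by exact_mod_cast ha.1
  have ha0' : (0 : ℝ) < a' := by exact_mod_cast ha'.1
  have ha1 : (1 : ℝ) ≤ a := by exact_mod_cast ha.1
  have ha1' : (1 : ℝ) ≤ a' := by exact_mod_cast ha'.1
  have haN : (a : ℝ) ≤ N := by exact_mod_cast ha.2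
  have haN' : (a' : ℝ) ≤ N := by exact_mod_cast ha'.2
  have hT0' : 0 < |T| := abs_pos.2 hT0
  have hsub : (a : ℝ) - a' ≠ 0 := sub_ne_zero.2 (by exact_mod_cast hne)
  have hsub' : 0 < |(a : ℝ) - a'| := abs_pos.2 hsub
  have e0 : (1 : ℝ) / a - 1 / a' = -(a - a') / (a * a') := by
    field_simp
    ring
  have habs : |(1 : ℝ) / a - 1 / a'| = |(a : ℝ) - a'| / (a * a') := by
    rw [e0, abs_div, abs_neg, abs_of_pos (mul_pos ha0 ha0')]
  have hne' : T * (1 / a - 1 / a') ≠ 0 := by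
    rw [e0]
    exact mul_ne_zero hT0 (div_ne_zero (neg_ne_zero.2 hsub) (by positivity))
  have e1 : ∑ b ∈ Ioc B (2 * B),
        hyperbolaKernel P T a b * (starRingEnd ℂ) (hyperbolaKernel P T a' b)
      = ∑ b ∈ Ioc (max B (max (P / a) (P / a'))) (min (2 * B) (min (2 * P / a) (2 * P / a'))),
        e (T * (1 / a - 1 / a') / b) := by
    symm
    refine (sum_congr rfl fun b hb => ?_).trans (sum_subset (fun b hb => ?_) fun b hb hb' => ?_)
    · simp only [mem_Ioc, max_lt_iff, le_min_iff, Nat.div_lt_iff_lt_mul ha.1,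
        Nat.div_lt_iff_lt_mul ha'.1, Nat.le_div_iff_mul_le ha.1,
        Nat.le_div_iff_mul_le ha'.1] at hb
      rw [hyperbolaKernel, hyperbolaKernel, if_pos (by grind), if_pos (by grind), conj_e,
        ← AddChar.map_add_eq_mul]
      have hb0 : (b : ℝ) ≠ 0 := by
        have : 0 < b := by omega
        positivity
      congr 1
      field_simp
      ring
    · simp only [mem_Ioc, max_lt_iff, le_min_iff] at hb ⊢
      exact ⟨hb.1.1, hb.2.1⟩
    · simp only [mem_Ioc, max_lt_iff, le_min_iff, Nat.div_lt_iff_lt_mul ha.1,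
        Nat.div_lt_iff_lt_mul ha'.1, Nat.le_div_iff_mul_le ha.1,
        Nat.le_div_iff_mul_le ha'.1] at hb hb'
      rw [hyperbolaKernel, hyperbolaKernel]
      by_cases h : P < a * b ∧ a * b ≤ 2 * P
      · rw [if_neg (c := P < a' * b ∧ a' * b ≤ 2 * P) (by grind)]
        simp
      · rw [if_neg h, zero_mul]
  rw [e1]
  have hB1 : (1 : ℝ) ≤ B := by exact_mod_cast hB
  refine (norm_sum_Ioc_e_div_le (P := P) (X := B) (by exact_mod_cast hP) hB1 hlog ?_ ?_ hk hne'
    ?_).trans ?_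
  · have : B ≤ max B (max (P / a) (P / a')) := le_max_left _ _
    have : (B : ℝ) ≤ (max B (max (P / a) (P / a')) : ℕ) := by exact_mod_cast this
    linarith
  · have : min (2 * B) (min (2 * P / a) (2 * P / a')) ≤ 2 * B := min_le_left _ _
    exact_mod_cast this
  · refine le_trans ?_ hT
    rw [abs_mul]
    refine mul_le_of_le_one_right (abs_nonneg _) ?_
    have h1 : (1 : ℝ) / a ≤ 1 := by rw [div_le_one ha0]; exact ha1
    have h2 : (1 : ℝ) / a' ≤ 1 := by rw [div_le_one ha0']; exact ha1'
    have h3 : (0 : ℝ) < 1 / a := by positivity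
    have h4 : (0 : ℝ) < 1 / a' := by positivity
    exact abs_le.2 ⟨by linarith, by linarith⟩
  · refine add_le_add le_rfl ?_
    rw [abs_mul, habs]
    have e2 : 8 * (B : ℝ) ^ 2 / (|T| * (|(a : ℝ) - a'| / (a * a')))
        = 8 * (B : ℝ) ^ 2 * (a * a') / |T| * (1 / |(a : ℝ) - a'|) := by
      field_simp
    rw [e2]
    have : (a : ℝ) * a' ≤ N ^ 2 := by
      rw [sq]
      exact mul_le_mul haN haN' ha0'.le (by linarith)
    gcongr

theorem norm_sum_hyperbolaKernel_sq_le {P B N : ℕ} {T k A : ℝ} {α : ℕ → ℝ} (β : ℕ → ℝ)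
    (hP : 1 ≤ P) (hB : 1 ≤ B) (hN : N * B ≤ 2 * P)
    (hlog : Real.log P ≤ 4 * Real.log B) (hk : 1 ≤ k) (hT0 : T ≠ 0) (hT : |T| ≤ (P : ℝ) ^ k)
    (hA : ∀ a ∈ Icc 1 N, |α a| ≤ A) (hN1 : 1 ≤ N) :
    ‖∑ b ∈ Ioc B (2 * B), (β b : ℂ) * ∑ a ∈ Icc 1 N, (α a : ℂ) * hyperbolaKernel P T a b‖ ^ 2
      ≤ (∑ b ∈ Ioc B (2 * B), β b ^ 2) * (A ^ 2 * (2 * P + 404 * P ^ 2 * saving P k / B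
        + 128 * P ^ 3 * (1 + Real.log N) / (B * |T|))) := by
  have hT0' : 0 < |T| := abs_pos.2 hT0
  have hB0 : (0 : ℝ) < B := by exact_mod_cast hB
  have hN1' : (1 : ℝ) ≤ N := by exact_mod_cast hN1
  have hlogN : 0 ≤ Real.log N := Real.log_nonneg hN1'
  have hs := saving_pos P k
  have hA0 : 0 ≤ A := (abs_nonneg _).trans (hA 1 (by simp [hN1]))
  refine (norm_sum_sum_sq_le _ _ _ _ _).trans ?_
  refine mul_le_mul_of_nonneg_left ?_ (sum_nonneg fun _ _ => sq_nonneg _)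
  obtain ⟨K, hK⟩ : ∃ K : ℕ → ℕ → ℝ, ∀ a a', K a a' = ‖∑ b ∈ Ioc B (2 * B),
      hyperbolaKernel P T a b * (starRingEnd ℂ) (hyperbolaKernel P T a' b)‖ :=
    ⟨_, fun _ _ => rfl⟩
  simp only [← hK]
  have hK0 (a a') : 0 ≤ K a a' := by rw [hK]; exact norm_nonneg _
  have hrow (a : ℕ) (ha : a ∈ Icc 1 N) : ∑ a' ∈ Icc 1 N, |α a| * |α a'| * K a a'
      ≤ A ^ 2 * (B + N * (101 * B * saving P k)
        + 8 * B ^ 2 * N ^ 2 / |T| * (2 * (1 + Real.log N))) := by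
    have h1 : ∑ a' ∈ Icc 1 N, |α a| * |α a'| * K a a' ≤ ∑ a' ∈ Icc 1 N, A ^ 2 * K a a' := by
      refine sum_le_sum fun a' ha' => mul_le_mul_of_nonneg_right ?_ (hK0 _ _)
      rw [sq]
      exact mul_le_mul (hA a ha) (hA a' ha') (abs_nonneg _) hA0
    refine h1.trans ?_
    rw [← mul_sum]
    refine mul_le_mul_of_nonneg_left ?_ (sq_nonneg A)
    rw [← add_sum_erase _ _ ha, add_assoc]
    refine add_le_add ?_ ?_
    · rw [hK]
      refine (norm_sum_le _ _).trans ((sum_le_sum (g := fun _ => (1 : ℝ)) fun b _ => ?_).trans ?_)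
      · rw [norm_mul, RCLike.norm_conj]
        exact mul_le_one₀ (norm_hyperbolaKernel_le _ _ _ _) (norm_nonneg _)
          (norm_hyperbolaKernel_le _ _ _ _)
      · simp [two_mul]
    · have h2 : ∑ a' ∈ (Icc 1 N).erase a, K a a' ≤ ∑ a' ∈ (Icc 1 N).erase a,
          (101 * B * saving P k + 8 * B ^ 2 * N ^ 2 / |T| * (1 / |(a : ℝ) - a'|)) := by
        refine sum_le_sum fun a' ha' => ?_
        rw [mem_erase] at ha'
        rw [hK]
        exact norm_sum_hyperbolaKernel_le hP hB hlog hk hT0 hT ha ha'.2 ha'.1.symm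
      refine h2.trans ?_
      rw [sum_add_distrib, sum_const, nsmul_eq_mul, ← mul_sum]
      refine add_le_add ?_ ?_
      · refine mul_le_mul_of_nonneg_right ?_ (by positivity)
        have : #((Icc 1 N).erase a) ≤ N := (card_erase_le).trans (by simp)
        exact_mod_cast this
      · exact mul_le_mul_of_nonneg_left (sum_inv_abs_sub_le N ha) (by positivity)
  refine (sum_le_sum hrow).trans ?_
  rw [sum_const, nsmul_eq_mul, Nat.card_Icc, Nat.add_sub_cancel, mul_left_comm]
  refine mul_le_mul_of_nonneg_left ?_ (sq_nonneg A)
  have hNB : (N : ℝ) * B ≤ 2 * P := by exact_mod_cast hN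
  have hP0 : (0 : ℝ) ≤ P := Nat.cast_nonneg P
  have hNB0 : 0 ≤ (N : ℝ) * B := by positivity
  have e1 : (N : ℝ) * (B + N * (101 * B * saving P k)
        + 8 * B ^ 2 * N ^ 2 / |T| * (2 * (1 + Real.log N)))
      = N * B + 101 * (N * B) ^ 2 * (saving P k / B)
        + 16 * (N * B) ^ 3 * ((1 + Real.log N) / (B * |T|)) := by
    field_simp
    ring
  have e2 : 2 * (P : ℝ) + 404 * P ^ 2 * saving P k / B
        + 128 * P ^ 3 * (1 + Real.log N) / (B * |T|)
      = 2 * P + 101 * (2 * P) ^ 2 * (saving P k / B)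
        + 16 * (2 * P) ^ 3 * ((1 + Real.log N) / (B * |T|)) := by
    ring
  rw [e1, e2]
  gcongr

end Singmaster

namespace Singmaster

open Finset
open scoped ArithmeticFunction.Moebius ArithmeticFunction.zeta
  ArithmeticFunction.vonMangoldt

/-- Restriction of an arithmetic function to arguments at most `U`. -/
def truncate (U : ℕ) (f : ArithmeticFunction ℝ) : ArithmeticFunction ℝ :=
  ⟨fun n => if n ≤ U then f n else 0, by simp⟩

theorem truncate_apply (U : ℕ) (f : ArithmeticFunction ℝ) (n : ℕ) :
    truncate U f n = if n ≤ U then f n else 0 := rfl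

theorem abs_truncate_le (U : ℕ) (f : ArithmeticFunction ℝ) (n : ℕ) :
    |truncate U f n| ≤ |f n| := by
  rw [truncate_apply]
  split_ifs <;> simp

theorem sub_truncate_apply_of_le {U n : ℕ} (f : ArithmeticFunction ℝ) (hn : n ≤ U) :
    (f - truncate U f) n = 0 := by
  rw [sub_eq_add_neg, ArithmeticFunction.add_apply, ArithmeticFunction.neg_apply, truncate_apply,
    if_pos hn, add_neg_cancel]

theorem abs_sub_truncate_le (U : ℕ) (f : ArithmeticFunction ℝ) (n : ℕ) :
    |(f - truncate U f) n| ≤ |f n| := by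
  rw [sub_eq_add_neg, ArithmeticFunction.add_apply, ArithmeticFunction.neg_apply, truncate_apply]
  split_ifs <;> simp

theorem abs_coe_moebius_le (n : ℕ) : |(μ : ArithmeticFunction ℝ) n| ≤ 1 := by
  have := ArithmeticFunction.abs_moebius_le_one (n := n)
  rw [ArithmeticFunction.intCoe_apply]
  exact_mod_cast this

/-- Vaughan's identity. -/
theorem vonMangoldt_eq_vaughan (U : ℕ) :
    Λ = truncate U Λ + truncate U μ * ArithmeticFunction.log
      - truncate U μ * truncate U Λ * ζ
      + (Λ - truncate U Λ) * (((μ : ArithmeticFunction ℝ) - truncate U μ) * ζ) := by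
  have h1 : (μ : ArithmeticFunction ℝ) * ζ = 1 := ArithmeticFunction.coe_moebius_mul_coe_zeta
  have h2 : Λ * (ζ : ArithmeticFunction ℝ) = ArithmeticFunction.log :=
    ArithmeticFunction.vonMangoldt_mul_zeta
  rw [← h2]
  linear_combination (Λ - truncate U Λ) * (-h1)

theorem abs_truncate_mul_truncate_le (U n : ℕ) :
    |(truncate U μ * truncate U Λ) n| ≤ Real.log n := by
  rw [ArithmeticFunction.mul_apply]
  refine (abs_sum_le_sum_abs _ _).trans ?_
  have h : ∀ x ∈ n.divisorsAntidiagonal, |truncate U μ x.1 * truncate U Λ x.2| ≤ Λ x.2 := by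
    intro x _
    rw [abs_mul]
    refine (mul_le_of_le_one_left (abs_nonneg _)
      ((abs_truncate_le _ _ _).trans (abs_coe_moebius_le _))).trans ?_
    refine (abs_truncate_le _ _ _).trans (le_of_eq (abs_of_nonneg ?_))
    exact ArithmeticFunction.vonMangoldt_nonneg
  refine (sum_le_sum h).trans (le_of_eq ?_)
  rw [Nat.sum_divisorsAntidiagonal' (fun _ b => Λ b)]
  exact ArithmeticFunction.vonMangoldt_sum

theorem truncate_mul_truncate_eq_zero {U n : ℕ} (f g : ArithmeticFunction ℝ) (hn : U ^ 2 < n) :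
    (truncate U f * truncate U g) n = 0 := by
  rw [ArithmeticFunction.mul_apply]
  refine sum_eq_zero fun x hx => ?_
  rw [Nat.mem_divisorsAntidiagonal] at hx
  rw [truncate_apply, truncate_apply]
  by_cases h1 : x.1 ≤ U
  · rw [if_neg (c := x.2 ≤ U), mul_zero]
    intro h2
    have := Nat.mul_le_mul h1 h2
    rw [hx.1, ← sq] at this
    omega
  · rw [if_neg h1, zero_mul]

theorem abs_mul_zeta_le (U n : ℕ) :
    |(((μ : ArithmeticFunction ℝ) - truncate U μ) * ζ) n| ≤ #n.divisors := by
  rw [ArithmeticFunction.coe_mul_zeta_apply]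
  refine (abs_sum_le_sum_abs _ _).trans ((sum_le_card_nsmul _ _ 1 fun d _ => ?_).trans (by simp))
  exact (abs_sub_truncate_le _ _ _).trans (abs_coe_moebius_le _)

theorem mul_zeta_eq_zero {U n : ℕ} (f : ArithmeticFunction ℝ) (hn : n ≤ U) :
    ((f - truncate U f) * ζ) n = 0 := by
  rcases Nat.eq_zero_or_pos n with rfl | h0
  · simp
  rw [ArithmeticFunction.coe_mul_zeta_apply]
  refine sum_eq_zero fun d hd => sub_truncate_apply_of_le f ?_
  exact (Nat.divisor_le hd).trans hn

theorem sum_Ioc_two_pow_mul (f : ℕ → ℂ) (U J : ℕ) :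
    ∑ b ∈ Ioc U (2 ^ J * U), f b
      = ∑ j ∈ range J, ∑ b ∈ Ioc (2 ^ j * U) (2 * (2 ^ j * U)), f b := by
  induction J with
  | zero => simp
  | succ J ih =>
    rw [sum_range_succ, ← ih, ← sum_union]
    · rw [Ioc_union_Ioc_eq_Ioc, pow_succ, mul_comm (2 ^ J) 2, mul_assoc]
      · exact Nat.le_mul_of_pos_left _ (by positivity)
      · omega
    · exact Ioc_disjoint_Ioc_of_le le_rfl

theorem sum_mul_e_div_eq_hyperbolaKernel {f g : ArithmeticFunction ℝ} {P U J : ℕ} (T : ℝ)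
    (hg : ∀ n, n ≤ U → g n = 0) (hJ : 2 * P ≤ 2 ^ J * U) :
    ∑ n ∈ Ioc P (2 * P), ((f * g) n : ℂ) * e (T / n)
      = ∑ j ∈ range J, ∑ b ∈ Ioc (2 ^ j * U) (2 * (2 ^ j * U)), (g b : ℂ) *
        ∑ a ∈ Icc 1 (2 * P / (2 ^ j * U)), (f a : ℂ) * hyperbolaKernel P T a b := by
  rcases Nat.eq_zero_or_pos P with rfl | hP
  · simp
  have hU : 0 < U := by
    rcases Nat.eq_zero_or_pos U with rfl | h
    · omega
    · exact h
  rw [sum_Ioc_mul_apply f g (fun n => e (T / n))]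
  have h1 : ∑ a ∈ Icc 1 (2 * P), ∑ b ∈ Ioc (P / a) (2 * P / a),
      (f a : ℂ) * ((g b : ℂ) * e (T / (a * b : ℕ)))
      = ∑ a ∈ Icc 1 (2 * P), ∑ b ∈ Ioc U (2 ^ J * U),
        (g b : ℂ) * ((f a : ℂ) * hyperbolaKernel P T a b) := by
    refine sum_congr rfl fun a ha => ?_
    rw [mem_Icc] at ha
    have h2 : ∑ b ∈ Ioc (P / a) (2 * P / a), (f a : ℂ) * ((g b : ℂ) * e (T / (a * b : ℕ)))
        = ∑ b ∈ Ioc (P / a) (2 * P / a), (g b : ℂ) * ((f a : ℂ) * hyperbolaKernel P T a b) := by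
      refine sum_congr rfl fun b hb => ?_
      rw [mem_Ioc, Nat.div_lt_iff_lt_mul ha.1, Nat.le_div_iff_mul_le ha.1, mul_comm b] at hb
      rw [hyperbolaKernel, if_pos hb]
      push_cast
      ring
    rw [h2]
    refine (sum_subset (s₂ := Ioc (P / a) (2 * P / a) ∪ Ioc U (2 ^ J * U)) subset_union_left
      fun b _ hb => ?_).trans (sum_subset subset_union_right fun b hb hb' => ?_).symm
    · rw [mem_Ioc, Nat.div_lt_iff_lt_mul ha.1, Nat.le_div_iff_mul_le ha.1, mul_comm b] at hb
      rw [hyperbolaKernel, if_neg hb]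
      simp
    · have hbU : b ≤ U := by
        by_contra! h
        rw [mem_union] at hb
        refine hb' (hb.elim (fun hb => ?_) id)
        rw [mem_Ioc] at hb ⊢
        exact ⟨h, hb.2.trans ((Nat.div_le_self _ _).trans hJ)⟩
      rw [hg b hbU]
      simp
  rw [h1, sum_comm, sum_Ioc_two_pow_mul]
  refine sum_congr rfl fun j _ => sum_congr rfl fun b hb => ?_
  rw [← mul_sum]
  congr 1
  symm
  refine sum_subset (Icc_subset_Icc_right (Nat.div_le_self _ _)) fun a ha ha' => ?_
  rw [mem_Icc] at ha ha'
  rw [mem_Ioc] at hb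
  rw [hyperbolaKernel, if_neg, mul_zero]
  rintro ⟨-, h2⟩
  refine ha' ⟨ha.1, ?_⟩
  rw [Nat.le_div_iff_mul_le (by positivity)]
  exact (Nat.mul_le_mul_left a hb.1.le).trans h2

end Singmaster

namespace Singmaster

open Finset
open scoped ArithmeticFunction.Moebius ArithmeticFunction.zeta ArithmeticFunction.vonMangoldt

theorem one_div_le_saving {P k U : ℝ} (hP : 1 ≤ P) (hU : 0 < U) (hk : 1 ≤ k)
    (h : Real.log P ≤ 4 * Real.log U) : 1 / U ≤ saving P k := by
  rw [← Real.exp_log hU, one_div, ← Real.exp_neg, saving]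
  refine Real.exp_le_exp.2 (neg_le_neg ?_)
  have : Real.log P / (3 * 10 ^ 11 * k ^ 2) ≤ Real.log P / 4 :=
    div_le_div_of_nonneg_left (Real.log_nonneg hP) (by norm_num) (by nlinarith)
  linarith

theorem norm_typeTwo_block_le {P U B : ℕ} {T k : ℝ} (hP : 1 ≤ P) (hU : 1 ≤ U) (hUB : U ≤ B)
    (hlog : Real.log P ≤ 4 * Real.log U) (hk : 1 ≤ k) (hT0 : T ≠ 0) (hT : |T| ≤ (P : ℝ) ^ k) :
    ‖∑ b ∈ Ioc B (2 * B), ((((μ : ArithmeticFunction ℝ) - truncate U μ) * ζ) b : ℂ) *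
        ∑ a ∈ Icc 1 (2 * P / B), ((Λ - truncate U Λ) a : ℂ) * hyperbolaKernel P T a b‖
      ≤ (1 + Real.log (2 * P)) ^ 3 * P * (29 * √(saving P k) + 16 * √(P / |T|)) := by
  have hs := saving_pos P k
  have hP1 : (1 : ℝ) ≤ P := by exact_mod_cast hP
  have hU0 : (0 : ℝ) < U := by exact_mod_cast hU
  have hB0 : (0 : ℝ) < B := by exact_mod_cast hU.trans hUB
  have hT0' : 0 < |T| := abs_pos.2 hT0
  obtain ⟨L, hL⟩ : ∃ L, L = 1 + Real.log (2 * P) := ⟨_, rfl⟩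
  have hL1 : 1 ≤ L := by
    rw [hL]
    linarith [Real.log_nonneg (by linarith : (1 : ℝ) ≤ 2 * P)]
  rw [← hL]
  rcases lt_or_ge U (2 * P / B) with hN | hN
  swap
  · rw [sum_eq_zero, norm_zero]
    · positivity
    · intro b _
      rw [sum_eq_zero, mul_zero]
      intro a ha
      rw [mem_Icc] at ha
      rw [sub_truncate_apply_of_le _ (ha.2.trans hN)]
      simp
  have hNB : 2 * P / B * B ≤ 2 * P := Nat.div_mul_le_self _ _
  have hUB' : U * B ≤ 2 * P := (Nat.mul_le_mul_right B hN.le).trans hNB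
  have hN1 : 1 ≤ 2 * P / B := hU.trans hN.le
  have hBP : B ≤ P := by
    have h2 : 2 ≤ 2 * P / B := by omega
    have := (Nat.mul_le_mul_right B h2).trans hNB
    omega
  have hBP' : (B : ℝ) ≤ P := by exact_mod_cast hBP
  have hlogB : Real.log P ≤ 4 * Real.log B := by
    have := Real.log_le_log hU0 (by exact_mod_cast hUB : (U : ℝ) ≤ B)
    linarith
  have hA (a : ℕ) (ha : a ∈ Icc 1 (2 * P / B)) : |(Λ - truncate U Λ) a| ≤ L := by
    rw [mem_Icc] at ha
    have ha2 : a ≤ 2 * P := ha.2.trans (Nat.div_le_self _ _)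
    refine (abs_sub_truncate_le _ _ _).trans ?_
    rw [abs_of_nonneg ArithmeticFunction.vonMangoldt_nonneg]
    refine ArithmeticFunction.vonMangoldt_le_log.trans ?_
    have := Real.log_le_log (by exact_mod_cast ha.1) (by exact_mod_cast ha2 : (a : ℝ) ≤ 2 * P)
    linarith
  have h1 := norm_sum_hyperbolaKernel_sq_le
    (fun b => (((μ : ArithmeticFunction ℝ) - truncate U μ) * ζ) b) hP (hU.trans hUB) hNB hlogB hk
    hT0 hT hA hN1
  have h2 : ∑ b ∈ Ioc B (2 * B), ((((μ : ArithmeticFunction ℝ) - truncate U μ) * ζ) b) ^ 2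
      ≤ 2 * B * L ^ 3 := by
    calc _ ≤ ∑ b ∈ Ioc B (2 * B), (#b.divisors : ℝ) ^ 2 := by
          refine sum_le_sum fun b _ => ?_
          rw [← sq_abs]
          exact pow_le_pow_left₀ (abs_nonneg _) (abs_mul_zeta_le U b) 2
      _ ≤ ∑ b ∈ Icc 1 (2 * B), (#b.divisors : ℝ) ^ 2 := by
          refine sum_le_sum_of_subset_of_nonneg ?_ fun _ _ _ => by positivity
          intro b hb
          rw [mem_Ioc] at hb
          rw [mem_Icc]
          omega
      _ ≤ (2 * B : ℕ) * (1 + Real.log (2 * B : ℕ)) ^ 3 := sum_card_divisors_sq_le _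
      _ ≤ 2 * B * L ^ 3 := by
          push_cast
          have h3 : (1 : ℝ) ≤ 2 * B := by
            have : (1 : ℝ) ≤ B := by exact_mod_cast hU.trans hUB
            linarith
          have := Real.log_nonneg h3
          have := Real.log_le_log (by linarith) (by linarith : (2 * B : ℝ) ≤ 2 * P)
          rw [hL]
          gcongr
  have hlogN : 0 ≤ Real.log (2 * P / B : ℕ) := Real.log_natCast_nonneg _
  have hlogN' : 1 + Real.log (2 * P / B : ℕ) ≤ L := by
    have h4 : 2 * P / B ≤ 2 * P := Nat.div_le_self _ _
    have h5 : ((2 * P / B : ℕ) : ℝ) ≤ 2 * P := by exact_mod_cast h4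
    rw [hL]
    have := Real.log_le_log (by exact_mod_cast hN1) h5
    linarith
  have hBU : (B : ℝ) ≤ 2 * P * saving P k := by
    have h6 : (U : ℝ) * B ≤ 2 * P := by exact_mod_cast hUB'
    calc (B : ℝ) = U * B * (1 / U) := by field_simp
      _ ≤ 2 * P * saving P k := mul_le_mul h6
          (one_div_le_saving hP1 hU0 hk hlog) (by positivity) (by positivity)
  have h7 : (1 + Real.log (2 * P / B : ℕ)) ≤ L := hlogN'
  have hsq : (L ^ 3 * P * (29 * √(saving P k) + 16 * √(P / |T|))) ^ 2
      ≥ L ^ 6 * P ^ 2 * (841 * saving P k + 256 * (P / |T|)) := by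
    have e1 := Real.sq_sqrt hs.le
    have e2 := Real.sq_sqrt (by positivity : 0 ≤ (P : ℝ) / |T|)
    have e3 : 0 ≤ L ^ 6 * P ^ 2 * (√(saving P k) * √(P / |T|)) := by positivity
    calc _ = L ^ 6 * P ^ 2 * (841 * √(saving P k) ^ 2 + 256 * √(P / |T|) ^ 2)
          + 928 * (L ^ 6 * P ^ 2 * (√(saving P k) * √(P / |T|))) := by ring
      _ ≥ _ := by
          rw [e1, e2]
          linarith
  refine (pow_le_pow_iff_left₀ (norm_nonneg _) (by positivity) two_ne_zero).1
    (h1.trans (le_trans ?_ hsq))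
  have hLL : L ^ 5 ≤ L ^ 6 := pow_le_pow_right₀ hL1 (by norm_num)
  calc _ ≤ 2 * B * L ^ 3 * (L ^ 2 * (2 * P + 404 * P ^ 2 * saving P k / B
        + 128 * P ^ 3 * L / (B * |T|))) := by gcongr
    _ = L ^ 5 * (4 * P * B + 808 * P ^ 2 * saving P k) + L ^ 6 * (256 * P ^ 2 * (P / |T|)) := by
        field_simp
        ring
    _ ≤ L ^ 6 * (4 * P * (2 * P * saving P k) + 808 * P ^ 2 * saving P k)
        + L ^ 6 * (256 * P ^ 2 * (P / |T|)) := by gcongr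
    _ = L ^ 6 * P ^ 2 * (816 * saving P k + 256 * (P / |T|)) := by ring
    _ ≤ _ := by gcongr; norm_num

theorem exists_cube_le_and_log_le {P : ℕ} (hP : 512 ≤ P) :
    ∃ U : ℕ, 1 ≤ U ∧ U ^ 2 ≤ P ∧ Real.log P ≤ 4 * Real.log U ∧
      Real.log P ≤ 4 * Real.log (P / (U ^ 2 : ℕ)) := by
  obtain ⟨U, hU⟩ : ∃ U, U = Nat.findGreatest (fun u => u ^ 3 ≤ P) P := ⟨_, rfl⟩
  have h1 : U ^ 3 ≤ P := by
    rw [hU]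
    exact Nat.findGreatest_spec (P := fun u => u ^ 3 ≤ P) (Nat.zero_le P) (by simp)
  have h2 : 8 ≤ U := by
    rw [hU]
    exact Nat.le_findGreatest (by omega) (by norm_num; exact hP)
  have h3 : P < (U + 1) ^ 3 := by
    by_contra! h
    have h4 : U + 1 ≤ U := by
      nth_rw 2 [hU]
      refine Nat.le_findGreatest ((Nat.le_self_pow (by norm_num) _).trans h) h
    omega
  have h4 : P ≤ U ^ 4 := by
    calc P ≤ (U + 1) ^ 3 := h3.le
      _ ≤ (2 * U) ^ 3 := Nat.pow_le_pow_left (by omega) 3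
      _ = 8 * U ^ 3 := by ring
      _ ≤ U * U ^ 3 := Nat.mul_le_mul_right _ h2
      _ = U ^ 4 := by ring
  have hU0 : (0 : ℝ) < U := by exact_mod_cast (by omega : 0 < U)
  have hlog : Real.log P ≤ 4 * Real.log U := by
    have : (P : ℝ) ≤ (U : ℝ) ^ 4 := by exact_mod_cast h4
    have := Real.log_le_log (by exact_mod_cast (by omega : 0 < P)) this
    rw [Real.log_pow] at this
    exact_mod_cast this
  refine ⟨U, by omega, ?_, hlog, hlog.trans ?_⟩
  · calc U ^ 2 ≤ U ^ 3 := Nat.pow_le_pow_right (by omega) (by norm_num)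
      _ ≤ P := h1
  · have h5 : (U : ℝ) ≤ P / (U ^ 2 : ℕ) := by
      rw [le_div_iff₀ (by positivity)]
      push_cast
      have : (U : ℝ) ^ 3 ≤ P := by exact_mod_cast h1
      linarith [pow_succ' (U : ℝ) 2]
    have := Real.log_le_log hU0 h5
    linarith

/-- Exponential sums over primes, weighted by the von Mangoldt function. -/
theorem norm_sum_vonMangoldt_mul_e_div_le {P : ℕ} {T k : ℝ} (hP : 512 ≤ P) (hk : 1 ≤ k)
    (hT0 : T ≠ 0) (hT : |T| ≤ (P : ℝ) ^ k) :
    ‖∑ n ∈ Ioc P (2 * P), (Λ n : ℂ) * e (T / n)‖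
      ≤ 300 * (1 + Real.log (2 * P)) ^ 4 * P * (√(saving P k) + √(P / |T|)) := by
  have hs := saving_pos P k
  have hT0' : 0 < |T| := abs_pos.2 hT0
  have hP1 : (1 : ℝ) ≤ P := by exact_mod_cast (by omega : 1 ≤ P)
  have hlogP : 0 ≤ Real.log P := Real.log_nonneg hP1
  obtain ⟨L, hL⟩ : ∃ L, L = 1 + Real.log (2 * P) := ⟨_, rfl⟩
  have hl0 : 0 ≤ Real.log (2 * P) := Real.log_nonneg (by linarith)
  have hL1 : 1 ≤ L := by linarith
  have hLP : Real.log P ≤ L := by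
    have := Real.log_le_log (by linarith) (by linarith : (P : ℝ) ≤ 2 * P)
    linarith
  rw [← hL]
  rcases lt_or_ge |T| P with hTP | hTP
  · have h1 : 1 ≤ √(P / |T|) := by
      rw [Real.one_le_sqrt, one_le_div hT0']
      exact hTP.le
    have h2 : ‖∑ n ∈ Ioc P (2 * P), (Λ n : ℂ) * e (T / n)‖ ≤ P * L := by
      refine (norm_sum_le_of_le _ (f := fun n : ℕ => (Λ n : ℂ) * e (T / n)) (n := fun _ => L)
        fun n hn => ?_).trans (le_of_eq ?_)
      · rw [mem_Ioc] at hn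
        rw [norm_mul, norm_e, mul_one, Complex.norm_real,
          Real.norm_of_nonneg ArithmeticFunction.vonMangoldt_nonneg]
        refine ArithmeticFunction.vonMangoldt_le_log.trans ?_
        have := Real.log_le_log (by exact_mod_cast (by omega : 0 < n))
          (by exact_mod_cast hn.2 : (n : ℝ) ≤ 2 * P)
        linarith
      · rw [sum_const, Nat.card_Ioc, nsmul_eq_mul, two_mul, Nat.add_sub_cancel]
    have h3 : L ≤ L ^ 4 := le_self_pow₀ hL1 (by norm_num)
    calc _ ≤ P * L := h2
      _ ≤ P * L ^ 4 * 1 := by rw [mul_one]; gcongr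
      _ ≤ (300 * (P * L ^ 4)) * (√(saving P k) + √(P / |T|)) := by
        have h4 : 0 ≤ P * L ^ 4 := by positivity
        have h5 := Real.sqrt_nonneg (saving P k)
        exact mul_le_mul (by linarith) (by linarith) zero_le_one (by linarith)
      _ = _ := by ring
  obtain ⟨U, hU1, hUP, hlog1, hlog2⟩ := exists_cube_le_and_log_le hP
  have hUP1 : U ≤ P := (Nat.le_self_pow (by norm_num) U).trans hUP
  have hU0 : (0 : ℝ) < U := by exact_mod_cast hU1
  have hss : saving P k ≤ √(saving P k) := by
    have h1 : saving P k ≤ 1 := by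
      refine Real.exp_le_one_iff.2 (neg_nonpos.2 (by positivity))
    exact Real.le_sqrt_of_sq_le (pow_le_of_le_one hs.le h1 two_ne_zero)
  have hTT : P / |T| ≤ √(P / |T|) := by
    have h1 : P / |T| ≤ 1 := by rwa [div_le_one hT0']
    exact Real.le_sqrt_of_sq_le (pow_le_of_le_one (by positivity) h1 two_ne_zero)
  obtain ⟨R, hR⟩ : ∃ R, R = L ^ 4 * P := ⟨_, rfl⟩
  have hR0 : 0 ≤ R := by rw [hR]; positivity
  have hL2 : L ^ 2 ≤ L ^ 4 := pow_le_pow_right₀ hL1 (by norm_num)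
  have hinner : L ^ 2 * (101 * P * saving P k + 8 * P ^ 2 / |T|)
      ≤ R * (101 * √(saving P k) + 8 * √(P / |T|)) := by
    calc _ = L ^ 2 * P * (101 * saving P k + 8 * (P / |T|)) := by ring
      _ ≤ L ^ 4 * P * (101 * √(saving P k) + 8 * √(P / |T|)) := by gcongr
      _ = _ := by rw [hR]
  have hcast : ((2 * P : ℕ) : ℝ) = 2 * P := by push_cast; rfl
  have hlogle (V : ℕ) (hV1 : 1 ≤ V) (hV : V ≤ P) : 1 + Real.log V ≤ L := by
    have := Real.log_le_log (by exact_mod_cast hV1)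
      (by exact_mod_cast (by omega : V ≤ 2 * P) : (V : ℝ) ≤ 2 * P)
    linarith
  have hlogV (V : ℕ) : 0 ≤ Real.log V := Real.log_natCast_nonneg V
  have hpos : 0 ≤ 101 * P * saving P k + 8 * P ^ 2 / |T| := by positivity
  have hmono : Monotone fun n : ℕ => Real.log n := by
    intro a b hab
    rcases Nat.eq_zero_or_pos a with rfl | ha
    · simpa using Real.log_natCast_nonneg b
    · exact Real.log_le_log (by exact_mod_cast ha) (by exact_mod_cast hab)
  have hS1 : ‖∑ n ∈ Ioc P (2 * P), ((truncate U μ * ArithmeticFunction.log) n : ℂ) * e (T / n)‖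
      ≤ R * (101 * √(saving P k) + 8 * √(P / |T|)) := by
    refine (norm_sum_mul_e_div_le (w := fun n : ℕ => Real.log n) hU1 hUP1 ?_ hk hT0 hT
      (fun n => (abs_truncate_le _ _ _).trans (abs_coe_moebius_le n))
      (fun n hn => by rw [truncate_apply, if_neg (by omega)]) hmono
      (fun n => Real.log_natCast_nonneg n)
      (fun n _ => ArithmeticFunction.log_apply)).trans (le_trans ?_ hinner)
    · refine hlog2.trans ?_
      have : (U : ℝ) ≤ (U ^ 2 : ℕ) := by exact_mod_cast Nat.le_self_pow (by norm_num) U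
      have := Real.log_le_log (by positivity)
        (div_le_div_of_nonneg_left (by linarith : (0 : ℝ) ≤ P) hU0 this)
      linarith
    · refine mul_le_mul_of_nonneg_right ?_ hpos
      rw [one_mul, hcast, sq]
      have := hlogV U
      exact mul_le_mul (by linarith) (hlogle U hU1 hUP1) (by linarith) (by linarith)
  have hS2 : ‖∑ n ∈ Ioc P (2 * P), ((truncate U μ * truncate U Λ * ζ) n : ℂ) * e (T / n)‖
      ≤ R * (101 * √(saving P k) + 8 * √(P / |T|)) := by
    refine (norm_sum_mul_e_div_le (w := fun _ => 1) (V := U ^ 2) (A := L)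
      (Nat.one_le_pow _ _ hU1) hUP hlog2 hk hT0 hT (fun n => ?_)
      (fun n hn => truncate_mul_truncate_eq_zero _ _ hn) monotone_const
      (fun _ => zero_le_one)
      (fun n hn => by simp [ArithmeticFunction.natCoe_apply]; omega)).trans
      (le_trans ?_ hinner)
    · rcases le_or_gt n (U ^ 2) with hn | hn
      · refine (abs_truncate_mul_truncate_le U n).trans ((hmono (hn.trans hUP)).trans hLP)
      · rw [truncate_mul_truncate_eq_zero _ _ hn]
        simp only [abs_zero]
        linarith
    · refine mul_le_mul_of_nonneg_right ?_ hpos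
      rw [mul_one, sq L]
      have hL0 : 0 ≤ L := by linarith
      exact mul_le_mul_of_nonneg_left (hlogle _ (Nat.one_le_pow _ _ hU1) hUP) hL0
  have hS3 : ‖∑ n ∈ Ioc P (2 * P), (((Λ - truncate U Λ) *
      (((μ : ArithmeticFunction ℝ) - truncate U μ) * ζ)) n : ℂ) * e (T / n)‖
      ≤ 2 * (R * (29 * √(saving P k) + 16 * √(P / |T|))) := by
    obtain ⟨J, hJ⟩ : ∃ J, J = Nat.log 2 (2 * P) + 1 := ⟨_, rfl⟩
    have hJ1 : 2 * P ≤ 2 ^ J * U := by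
      have : 2 * P < 2 ^ J := by rw [hJ]; exact Nat.lt_pow_succ_log_self (by norm_num) _
      exact this.le.trans (Nat.le_mul_of_pos_right _ hU1)
    have hJ2 : (J : ℝ) ≤ 2 * L := by
      have h1 : 2 ^ (Nat.log 2 (2 * P)) ≤ 2 * P := Nat.pow_log_le_self 2 (by omega)
      have h2 : (2 : ℝ) ^ (Nat.log 2 (2 * P)) ≤ 2 * P := by exact_mod_cast h1
      have h3 := Real.log_le_log (by positivity) h2
      rw [Real.log_pow] at h3
      have h4 : (0 : ℝ) ≤ Nat.log 2 (2 * P) := Nat.cast_nonneg _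
      rw [hJ]
      push_cast
      nlinarith [Real.log_two_gt_d9]
    rw [sum_mul_e_div_eq_hyperbolaKernel T (fun n hn => mul_zeta_eq_zero _ hn) hJ1]
    refine (norm_sum_le_of_le _ fun j _ => norm_typeTwo_block_le (by omega) hU1
      (Nat.le_mul_of_pos_left _ (by positivity)) hlog1 hk hT0 hT).trans ?_
    rw [sum_const, card_range, nsmul_eq_mul, ← hL]
    calc _ ≤ 2 * L * (L ^ 3 * P * (29 * √(saving P k) + 16 * √(P / |T|))) := by gcongr
      _ = _ := by rw [hR]; ring
  have hsum : ∑ n ∈ Ioc P (2 * P), (Λ n : ℂ) * e (T / n)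
      = ∑ n ∈ Ioc P (2 * P), ((truncate U μ * ArithmeticFunction.log) n : ℂ) * e (T / n)
        - ∑ n ∈ Ioc P (2 * P), ((truncate U μ * truncate U Λ * ζ) n : ℂ) * e (T / n)
        + ∑ n ∈ Ioc P (2 * P), (((Λ - truncate U Λ) *
            (((μ : ArithmeticFunction ℝ) - truncate U μ) * ζ)) n : ℂ) * e (T / n) := by
    rw [← sum_sub_distrib, ← sum_add_distrib]
    refine sum_congr rfl fun n hn => ?_
    rw [mem_Ioc] at hn
    have h1 := congrArg (fun f : ArithmeticFunction ℝ => f n) (vonMangoldt_eq_vaughan U)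
    simp only [ArithmeticFunction.add_apply, sub_eq_add_neg (truncate U Λ + _),
      ArithmeticFunction.neg_apply] at h1
    rw [truncate_apply, if_neg (by omega), zero_add] at h1
    rw [h1]
    push_cast
    ring
  rw [hsum]
  refine (norm_add_le _ _).trans ((add_le_add (norm_sub_le _ _) le_rfl).trans ?_)
  have h5 : 0 ≤ R * √(saving P k) := by positivity
  have h6 : 0 ≤ R * √(P / |T|) := by positivity
  calc _ ≤ R * (101 * √(saving P k) + 8 * √(P / |T|)) + R * (101 * √(saving P k)
        + 8 * √(P / |T|)) + 2 * (R * (29 * √(saving P k) + 16 * √(P / |T|))) :=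
        add_le_add (add_le_add hS1 hS2) hS3
    _ = 260 * (R * √(saving P k)) + 48 * (R * √(P / |T|)) := by ring
    _ ≤ 300 * (R * √(saving P k)) + 300 * (R * √(P / |T|)) := by linarith
    _ = _ := by rw [hR]; ring

end Singmaster

namespace Singmaster

open Finset
open scoped ArithmeticFunction.vonMangoldt

/-- The primes in `(P, 4P]`. -/
def primeBlock (P : ℕ) : Finset ℕ := {p ∈ Ioc P (4 * P) | p.Prime}

theorem mem_primeBlock {P p : ℕ} : p ∈ primeBlock P ↔ (P < p ∧ p ≤ 4 * P) ∧ p.Prime := by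
  rw [primeBlock, mem_filter, mem_Ioc]

theorem sum_log_primeBlock_eq (P : ℕ) :
    ∑ p ∈ primeBlock P, Real.log p = Chebyshev.theta (4 * P : ℕ) - Chebyshev.theta P := by
  rw [Chebyshev.theta, Chebyshev.theta, Nat.floor_natCast, Nat.floor_natCast, eq_sub_iff_add_eq,
    primeBlock, ← sum_union, ← filter_union]
  · rw [union_comm, Ioc_union_Ioc_eq_Ioc (Nat.zero_le _) (by omega)]
  · refine disjoint_filter_filter ?_
    rw [disjoint_comm]
    exact Ioc_disjoint_Ioc_of_le le_rfl

theorem eventually_le_sum_log_primeBlock :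
    ∀ᶠ P : ℕ in Filter.atTop, (P : ℝ) ≤ ∑ p ∈ primeBlock P, Real.log p := by
  have h1 : ∀ᶠ x : ℝ in Filter.atTop, Real.log x ≤ 0.01 * x ^ (1 / 2 : ℝ) := by
    have := (isLittleO_log_rpow_atTop (r := 1 / 2) (by norm_num)).bound
      (c := 0.01) (by norm_num)
    filter_upwards [this, Filter.eventually_ge_atTop 1] with x hx hx1
    rwa [Real.norm_of_nonneg (Real.log_nonneg hx1), Real.norm_of_nonneg (by positivity)] at hx
  have h2 : Filter.Tendsto (fun P : ℕ => (4 * P + 1 : ℝ)) Filter.atTop Filter.atTop :=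
    Filter.tendsto_atTop_add_const_right _ _
      (Filter.Tendsto.const_mul_atTop (by norm_num) tendsto_natCast_atTop_atTop)
  filter_upwards [h2.eventually h1, Filter.eventually_ge_atTop 100] with P hP hP1
  have hP1' : (100 : ℝ) ≤ P := by exact_mod_cast hP1
  rw [sum_log_primeBlock_eq]
  have h3 := Chebyshev.theta_ge (4 * P)
  have h4 := Chebyshev.theta_le_log4_mul_x (x := P) (Nat.cast_nonneg _)
  rw [show (4 : ℝ) = 2 ^ 2 by norm_num, Real.log_pow] at h4
  push_cast at h3 h4 ⊢
  rw [← Real.sqrt_eq_rpow] at hP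
  have h5 : √(4 * P : ℝ) ≤ √(4 * P + 1) := Real.sqrt_le_sqrt (by linarith)
  have h6 : Real.log (4 * P) ≤ Real.log (4 * P + 1) :=
    Real.log_le_log (by linarith) (by linarith)
  have h7 : 0 ≤ Real.log (4 * P) := Real.log_nonneg (by linarith)
  have h8 : √(4 * P : ℝ) * Real.log (4 * P) ≤ √(4 * P + 1) * (0.01 * √(4 * P + 1)) := by
    gcongr
    linarith
  have h9 : √(4 * P + 1 : ℝ) * √(4 * P + 1) = 4 * P + 1 := Real.mul_self_sqrt (by linarith)
  have h10 : √(4 * P + 1 : ℝ) ≤ 4 * P + 1 := Real.sqrt_le_iff.2 ⟨by linarith, by nlinarith⟩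
  have h11 : (P : ℝ) * 0.693 ≤ P * Real.log 2 := by
    gcongr
    linarith [Real.log_two_gt_d9]
  nlinarith

theorem norm_sum_primeBlock_le {P : ℕ} {T k : ℝ} (hP : 512 ≤ P) (hk : 1 ≤ k)
    (hT0 : T ≠ 0) (hT : |T| ≤ (P : ℝ) ^ k) :
    ‖∑ p ∈ primeBlock P, (Real.log p : ℂ) * e (T / p)‖
      ≤ 2000 * (1 + Real.log (4 * P)) ^ 4 * P * (√(saving P k) + √(P / |T|)) := by
  have hP1 : (512 : ℝ) ≤ P := by exact_mod_cast hP
  have hT0' : 0 < |T| := abs_pos.2 hT0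
  have hT2 : |T| ≤ ((2 * P : ℕ) : ℝ) ^ k :=
    hT.trans (Real.rpow_le_rpow (by positivity) (by push_cast; linarith) (by linarith))
  have h1 := norm_sum_vonMangoldt_mul_e_div_le hP hk hT0 hT
  have h2 := norm_sum_vonMangoldt_mul_e_div_le (P := 2 * P) (by omega) hk hT0 hT2
  obtain ⟨L, hL⟩ : ∃ L, L = 1 + Real.log (4 * P) := ⟨_, rfl⟩
  have hl0 : 0 ≤ Real.log (4 * P) := Real.log_nonneg (by linarith)
  have hl2 : 0 ≤ Real.log (2 * P) := Real.log_nonneg (by linarith)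
  have hl3 : Real.log (2 * P) ≤ Real.log (4 * P) := Real.log_le_log (by linarith) (by linarith)
  have hL1 : 1 ≤ L := by linarith
  rw [← hL]
  have hs := saving_pos P k
  have hs2 : saving (2 * P : ℕ) k ≤ saving P k := by
    refine Real.exp_le_exp.2 (neg_le_neg ?_)
    have : Real.log P ≤ Real.log (2 * P : ℕ) :=
      Real.log_le_log (by linarith) (by push_cast; linarith)
    gcongr
  have hsq2 : √((2 * P : ℕ) / |T|) ≤ 1.5 * √(P / |T|) := by
    rw [Real.sqrt_le_left (by positivity), mul_pow, Real.sq_sqrt (by positivity)]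
    push_cast
    have : 0 ≤ P / |T| := by positivity
    rw [mul_div_assoc]
    nlinarith
  have hdec : ∑ p ∈ primeBlock P, (Real.log p : ℂ) * e (T / p)
      = ∑ n ∈ Ioc P (2 * P), (Λ n : ℂ) * e (T / n)
        + ∑ n ∈ Ioc (2 * P) (2 * (2 * P)), (Λ n : ℂ) * e (T / n)
        - ∑ n ∈ Ioc P (4 * P) with ¬ n.Prime, (Λ n : ℂ) * e (T / n) := by
    rw [← sum_union (Ioc_disjoint_Ioc_of_le le_rfl), Ioc_union_Ioc_eq_Ioc (by omega) (by omega),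
      show 2 * (2 * P) = 4 * P by ring, eq_sub_iff_add_eq, primeBlock,
      ← sum_filter_add_sum_filter_not (Ioc P (4 * P)) Nat.Prime]
    congr 1
    refine sum_congr rfl fun p hp => ?_
    rw [mem_filter] at hp
    rw [ArithmeticFunction.vonMangoldt_apply_prime hp.2]
  have hnp : ‖∑ n ∈ Ioc P (4 * P) with ¬ n.Prime, (Λ n : ℂ) * e (T / n)‖
      ≤ 4 * P * L * √(saving P k) := by
    have h3 : ‖∑ n ∈ Ioc P (4 * P) with ¬ n.Prime, (Λ n : ℂ) * e (T / n)‖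
        ≤ ∑ n ∈ Ioc 0 (4 * P) with ¬ n.Prime, Λ n := by
      refine (norm_sum_le_of_le _ (f := fun n : ℕ => (Λ n : ℂ) * e (T / n)) (n := fun n => Λ n)
        fun n _ => ?_).trans ?_
      · rw [norm_mul, norm_e, mul_one, Complex.norm_real,
          Real.norm_of_nonneg ArithmeticFunction.vonMangoldt_nonneg]
      · refine sum_le_sum_of_subset_of_nonneg (filter_subset_filter _ ?_) fun _ _ _ =>
          ArithmeticFunction.vonMangoldt_nonneg
        exact Ioc_subset_Ioc_left (Nat.zero_le _)
    have h4 := Chebyshev.psi_sub_theta_eq_sum_not_prime (4 * P : ℕ)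
    rw [Nat.floor_natCast] at h4
    have h5 := Chebyshev.psi_sub_theta_le (x := (4 * P : ℕ)) (by push_cast; linarith)
    rw [h4] at h5
    refine h3.trans (h5.trans ?_)
    push_cast
    have h6 : √(4 * P : ℝ) = 2 * √P := by
      rw [Real.sqrt_mul (by norm_num), show (4 : ℝ) = 2 ^ 2 by norm_num,
        Real.sqrt_sq (by norm_num)]
    have h7 : √(P : ℝ) ≤ P * √(saving P k) := by
      have h8 := one_div_le_saving (U := P) (P := P) (by linarith) (by linarith) hk (by
        linarith [Real.log_nonneg (by linarith : (1 : ℝ) ≤ P)])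
      calc √(P : ℝ) = P * √(1 / P) := by
            rw [Real.sqrt_div zero_le_one, Real.sqrt_one]
            rw [mul_one_div, Real.div_sqrt]
        _ ≤ _ := by gcongr
    rw [h6]
    calc 2 * (2 * √(P : ℝ)) * Real.log (4 * P) ≤ 2 * (2 * (P * √(saving P k))) * L := by
          gcongr
          linarith
      _ = _ := by ring
  rw [hdec]
  refine (norm_sub_le _ _).trans ((add_le_add ((norm_add_le _ _).trans
    (add_le_add h1 h2)) hnp).trans ?_)
  have hLL : L ≤ L ^ 4 := le_self_pow₀ hL1 (by norm_num)
  have hc : (2 * ((2 * P : ℕ) : ℝ)) = 4 * P := by push_cast; ring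
  rw [hc, ← hL]
  have hx : 0 ≤ L ^ 4 * P * √(saving P k) := by positivity
  have hy : 0 ≤ L ^ 4 * P * √(P / |T|) := by positivity
  calc _ ≤ 300 * L ^ 4 * P * (√(saving P k) + √(P / |T|))
        + 300 * L ^ 4 * (2 * P) * (√(saving P k) + 1.5 * √(P / |T|))
        + 4 * P * L ^ 4 * √(saving P k) := by
        have hLp : 1 + Real.log (2 * P) ≤ L := by linarith
        push_cast at hs2 hsq2 ⊢
        gcongr
    _ = 904 * (L ^ 4 * P * √(saving P k)) + 1200 * (L ^ 4 * P * √(P / |T|)) := by ring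
    _ ≤ 2000 * (L ^ 4 * P * √(saving P k)) + 2000 * (L ^ 4 * P * √(P / |T|)) := by linarith
    _ = _ := by ring

end Singmaster

namespace Singmaster

open Finset

theorem tendsto_log_natCast_atTop :
    Filter.Tendsto (fun n : ℕ => Real.log n) Filter.atTop Filter.atTop :=
  Real.tendsto_log_atTop.comp tendsto_natCast_atTop_atTop

theorem eventually_exp_neg_mul_rpow_le {c b : ℝ} (hc : 0 < c) (hb : 0 < b) (N : ℕ) :
    ∀ᶠ x : ℝ in Filter.atTop, Real.exp (-(c * x ^ b)) ≤ 1 / x ^ N := by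
  have h1 := (isLittleO_exp_neg_mul_rpow_atTop hc (-(N / b))).bound (c := 1) one_pos
  filter_upwards [(tendsto_rpow_atTop hb).eventually h1, Filter.eventually_gt_atTop 0] with x hx h0
  rw [Real.norm_of_nonneg (Real.exp_pos _).le, Real.norm_of_nonneg (by positivity), one_mul,
    ← Real.rpow_mul h0.le, show b * -(N / b) = -(N : ℝ) by field_simp, Real.rpow_neg h0.le,
    Real.rpow_natCast, neg_mul] at hx
  rwa [one_div]

/-- Exponential sums over primes in the Vinogradov range save an arbitrary power of the
logarithm. -/
theorem eventually_norm_sum_primeBlock_le {ε : ℝ} (hε : 0 < ε) (A : ℕ) :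
    ∀ᶠ n : ℕ in Filter.atTop, ∀ P : ℕ, Real.log n ^ ((2 : ℝ) / 3 + ε) ≤ Real.log P → P ≤ n →
      ∀ T : ℝ, P * Real.log n ^ (2 * A + 20) ≤ |T| → |T| ≤ (n : ℝ) ^ 2 →
      ‖∑ p ∈ primeBlock P, (Real.log p : ℂ) * e (T / p)‖ ≤ P / Real.log n ^ A := by
  have h1 := tendsto_log_natCast_atTop.eventually
    (eventually_exp_neg_mul_rpow_le (c := 1 / (24 * 10 ^ 11)) (b := 3 * ε) (by norm_num)
      (by linarith) (A + 10))
  have h2 := tendsto_log_natCast_atTop.eventually (Filter.eventually_ge_atTop (20 : ℝ))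
  have h3 := ((tendsto_rpow_atTop (y := (2 : ℝ) / 3 + ε) (by linarith)).comp
    tendsto_log_natCast_atTop).eventually (Filter.eventually_ge_atTop (Real.log 512))
  filter_upwards [h1, h2, h3] with n h1 h2 h3 P hP hPn T hT1 hT2
  obtain ⟨l, hl⟩ : ∃ l, l = Real.log n := ⟨_, rfl⟩
  rw [Function.comp_apply] at h3
  rw [← hl] at h1 h2 h3 hP hT1 ⊢
  have hP0 : 0 < P := by
    rcases Nat.eq_zero_or_pos P with rfl | h
    · have : 0 < Real.log 512 := Real.log_pos (by norm_num)
      rw [Nat.cast_zero, Real.log_zero] at hP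
      linarith
    · exact h
  have hP0' : (0 : ℝ) < P := by exact_mod_cast hP0
  have hP512 : (512 : ℝ) ≤ P := (Real.log_le_log_iff (by norm_num) hP0').1 (h3.trans hP)
  have hPn' : (P : ℝ) ≤ n := by exact_mod_cast hPn
  have hn0 : (0 : ℝ) < n := hP0'.trans_le hPn'
  have hlP : Real.log P ≤ l := by rw [hl]; exact Real.log_le_log hP0' hPn'
  have hlP0 : 0 < Real.log P := Real.log_pos (by linarith)
  obtain ⟨k, hk⟩ : ∃ k, k = 2 * l / Real.log P := ⟨_, rfl⟩
  have hk1 : 1 ≤ k := by rw [hk, le_div_iff₀ hlP0]; linarith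
  have hPk : (P : ℝ) ^ k = (n : ℝ) ^ 2 := by
    rw [Real.rpow_def_of_pos hP0', hk, mul_div_cancel₀ _ hlP0.ne', hl, two_mul, Real.exp_add,
      Real.exp_log hn0, sq]
  have hTpos : 0 < |T| := lt_of_lt_of_le (by positivity) hT1
  have hmain := norm_sum_primeBlock_le (P := P) (T := T) (k := k) (by exact_mod_cast hP512) hk1
    (abs_pos.1 hTpos) (hPk ▸ hT2)
  have hsav : √(saving P k) ≤ 1 / l ^ (A + 10) := by
    refine le_trans ?_ h1
    rw [saving, Real.sqrt_eq_rpow, ← Real.exp_mul]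
    refine Real.exp_le_exp.2 ?_
    have hcube : l ^ 2 * l ^ (3 * ε) ≤ Real.log P ^ 3 := by
      have := pow_le_pow_left₀ (by positivity) hP 3
      rw [← Real.rpow_natCast, ← Real.rpow_mul (by linarith)] at this
      refine le_trans (le_of_eq ?_) this
      rw [← Real.rpow_natCast, ← Real.rpow_add (by linarith)]
      congr 1
      push_cast
      ring
    have hk2 : Real.log P / (3 * 10 ^ 11 * k ^ 2) = Real.log P ^ 3 / (12 * 10 ^ 11 * l ^ 2) := by
      rw [hk]
      have : l ≠ 0 := by linarith
      field_simp
      ring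
    rw [hk2]
    have : l ^ (3 * ε) / (12 * 10 ^ 11) ≤ Real.log P ^ 3 / (12 * 10 ^ 11 * l ^ 2) := by
      rw [div_le_div_iff₀ (by norm_num) (by positivity)]
      linarith
    linarith
  have hq : √(P / |T|) ≤ 1 / l ^ (A + 10) := by
    rw [Real.sqrt_le_left (by positivity), div_pow, one_pow, ← pow_mul, div_le_div_iff₀ hTpos
      (by positivity), one_mul]
    rwa [show (A + 10) * 2 = 2 * A + 20 by ring]
  have hlog : 1 + Real.log (4 * P) ≤ 2 * l := by
    rw [Real.log_mul (by norm_num) hP0'.ne']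
    have := Real.log_le_sub_one_of_pos (show (0 : ℝ) < 4 by norm_num)
    linarith
  have hlog0 : 0 ≤ Real.log (4 * P) := Real.log_nonneg (by linarith)
  refine hmain.trans ?_
  calc _ ≤ 2000 * (2 * l) ^ 4 * P * (1 / l ^ (A + 10) + 1 / l ^ (A + 10)) := by gcongr
    _ = P / l ^ A * (64000 / l ^ 6) := by
      rw [pow_add]
      have : l ≠ 0 := by linarith
      field_simp
      ring
    _ ≤ P / l ^ A * 1 := by
      gcongr
      rw [div_le_one (by positivity)]
      calc (64000 : ℝ) ≤ 20 ^ 6 := by norm_num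
        _ ≤ l ^ 6 := by gcongr
    _ = _ := mul_one _

theorem cos_pi_mul_pow_two_mul (z : ℝ) (K : ℕ) :
    ((Real.cos (Real.pi * z) ^ (2 * K) : ℝ) : ℂ)
      = ∑ i ∈ range (2 * K + 1),
        (((2 * K).choose i / 4 ^ K : ℝ) : ℂ) * e ((((i : ℤ) - K : ℤ) : ℝ) * z) := by
  have h1 : ((Real.cos (Real.pi * z) : ℝ) : ℂ) = (e (z / 2) + e (-(z / 2))) / 2 := by
    rw [Complex.ofReal_cos, Complex.cos, e_apply, e_apply]
    congr 3 <;> · push_cast; ring_nf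
  rw [Complex.ofReal_pow, h1, div_pow, add_pow, sum_div]
  refine sum_congr rfl fun i hi => ?_
  have hi' : i ≤ 2 * K := by rw [mem_range] at hi; omega
  rw [← AddChar.map_nsmul_eq_pow, ← AddChar.map_nsmul_eq_pow, ← AddChar.map_add_eq_mul, pow_mul]
  have : i • (z / 2) + (2 * K - i) • (-(z / 2)) = (((i : ℤ) - K : ℤ) : ℝ) * z := by
    rw [nsmul_eq_mul, nsmul_eq_mul, Nat.cast_sub hi']
    push_cast
    ring
  rw [this]
  push_cast
  ring

theorem sum_choose_two_mul_div (K : ℕ) :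
    ∑ i ∈ range (2 * K + 1), ((2 * K).choose i / 4 ^ K : ℝ) = 1 := by
  rw [← sum_div, div_eq_one_iff_eq (by positivity)]
  have := Nat.sum_range_choose (2 * K)
  rw [pow_mul] at this
  exact_mod_cast this

theorem one_div_le_choose_div {K : ℕ} (hK : 0 < K) :
    1 / (2 * K : ℝ) ≤ (2 * K).choose K / 4 ^ K := by
  have h := Nat.four_pow_le_two_mul_self_mul_centralBinom K hK
  rw [Nat.centralBinom_eq_two_mul_choose] at h
  rw [div_le_div_iff₀ (by positivity) (by positivity), one_mul, mul_comm]
  exact_mod_cast h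

theorem sin_sq_pi_mul (y : ℝ) :
    ((Real.sin (Real.pi * y) ^ 2 : ℝ) : ℂ) = 1 / 2 - (e y + e (-y)) / 4 := by
  have h1 : ((Real.cos (2 * Real.pi * y) : ℝ) : ℂ) = (e y + e (-y)) / 2 := by
    rw [Complex.ofReal_cos, Complex.cos, e_apply, e_apply]
    congr 3
    push_cast
    ring_nf
  have h2 : Real.sin (Real.pi * y) ^ 2 = 1 / 2 - Real.cos (2 * Real.pi * y) / 2 := by
    rw [Real.sin_sq_eq_half_sub]
    ring_nf
  rw [h2]
  push_cast at h1 ⊢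
  rw [h1]
  ring

theorem cos_pow_le_of_le_fract {x w : ℝ} (hw : 0 < w) (hx : w ≤ Int.fract x) (K : ℕ) :
    Real.cos (Real.pi * (x - w / 2)) ^ (2 * K) ≤ Real.exp (-(w ^ 2 * K)) := by
  have hx1 := Int.fract_lt_one x
  have h1 : Real.cos (Real.pi * (x - w / 2)) ^ 2
      = Real.cos (Real.pi * (Int.fract x - w / 2)) ^ 2 := by
    rw [Int.fract, Real.cos_sq, Real.cos_sq]
    congr 2
    rw [← Real.cos_sub_int_mul_two_pi _ ⌊x⌋]
    congr 1
    ring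
  have h2 : w ≤ Real.sin (Real.pi * (Int.fract x - w / 2)) := by
    have hpi := Real.pi_pos
    have hb : ∀ z : ℝ, w / 2 ≤ z → z ≤ 1 / 2 → w ≤ Real.sin (Real.pi * z) := by
      intro z h1 h2
      have h := Real.mul_le_sin (x := Real.pi * z) (by nlinarith) (by nlinarith)
      have : 2 / Real.pi * (Real.pi * z) = 2 * z := by field_simp
      linarith
    rcases le_total (Int.fract x - w / 2) (1 / 2) with h | h
    · exact hb _ (by linarith) h
    · rw [← Real.sin_pi_sub, show Real.pi - Real.pi * (Int.fract x - w / 2)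
        = Real.pi * (1 - (Int.fract x - w / 2)) by ring]
      exact hb _ (by linarith) (by linarith)
  rw [pow_mul, h1, Real.cos_sq']
  have h3 : Real.sin (Real.pi * (Int.fract x - w / 2)) ^ 2 ≤ 1 := by
    have := Real.sin_sq_add_cos_sq (Real.pi * (Int.fract x - w / 2))
    nlinarith [sq_nonneg (Real.cos (Real.pi * (Int.fract x - w / 2)))]
  calc (1 - Real.sin (Real.pi * (Int.fract x - w / 2)) ^ 2) ^ K
      ≤ Real.exp (-w ^ 2) ^ K := by
        refine pow_le_pow_left₀ (by linarith) ?_ K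
        have := Real.add_one_le_exp (-w ^ 2)
        have : w ^ 2 ≤ Real.sin (Real.pi * (Int.fract x - w / 2)) ^ 2 := by gcongr
        linarith
    _ = _ := by rw [← Real.exp_nat_mul]; ring_nf

/-- If all low-frequency exponential sums in two phases are small, some element has its first
phase just above an integer and its second phase away from the integers. -/
theorem exists_fract_lt_and_lt_sin_sq {ι : Type*} {S : Finset ι} {wt x y : ι → ℝ} {η w : ℝ}
    {K : ℕ} (hK : 0 < K) (hwt : ∀ s ∈ S, 0 ≤ wt s) (hM : 0 < ∑ s ∈ S, wt s) (hw : 0 < w)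
    (hS : ∀ h j : ℤ, |h| ≤ K → |j| ≤ 1 → (h ≠ 0 ∨ j ≠ 0) →
      ‖∑ s ∈ S, (wt s : ℂ) * e (h * x s + j * y s)‖ ≤ η * ∑ s ∈ S, wt s)
    (hη : η + Real.exp (-(w ^ 2 * K)) < 1 / (5 * K)) :
    ∃ s ∈ S, Int.fract (x s) < w ∧ 1 / 10 < Real.sin (Real.pi * y s) ^ 2 := by
  by_contra! hcon
  obtain ⟨M, hMd⟩ : ∃ M, M = ∑ s ∈ S, wt s := ⟨_, rfl⟩
  rw [← hMd] at hM hS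
  have hη0 : 0 ≤ η * M := (norm_nonneg _).trans
    (hS 1 0 (by rw [abs_one]; exact_mod_cast hK) (by simp) (by simp))
  obtain ⟨c, hc⟩ : ∃ c : ℕ → ℝ, c = fun i => ((2 * K).choose i / 4 ^ K : ℝ) := ⟨_, rfl⟩
  have hc0 : ∀ i, 0 ≤ c i := fun i => by rw [hc]; positivity
  obtain ⟨B, hB⟩ : ∃ B : ℤ → ℂ, B = fun h : ℤ => (2 / 5 : ℂ) * (∑ s ∈ S, (wt s : ℂ) * e (h * x s))
      - (∑ s ∈ S, (wt s : ℂ) * e (h * x s + y s)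
        + ∑ s ∈ S, (wt s : ℂ) * e (h * x s - y s)) / 4 := ⟨_, rfl⟩
  obtain ⟨Q, hQ⟩ : ∃ Q : ι → ℝ, Q = fun s => wt s * (Real.cos (Real.pi * (x s - w / 2)) ^ (2 * K)
    * (Real.sin (Real.pi * y s) ^ 2 - 1 / 10)) := ⟨_, rfl⟩
  have hexp : ((∑ s ∈ S, Q s : ℝ) : ℂ)
      = ∑ i ∈ range (2 * K + 1), (c i : ℂ) * e ((((i : ℤ) - K : ℤ) : ℝ) * (-(w / 2)))
        * B ((i : ℤ) - K) := by
    rw [hB, Complex.ofReal_sum]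
    simp only [mul_sub, mul_add, add_div, mul_sum, sum_div]
    simp only [← sum_add_distrib, ← sum_sub_distrib]
    rw [sum_comm]
    refine sum_congr rfl fun s _ => ?_
    rw [hQ]
    dsimp only
    rw [Complex.ofReal_mul, Complex.ofReal_mul, cos_pi_mul_pow_two_mul, Complex.ofReal_sub,
      sin_sq_pi_mul, sum_mul, mul_sum]
    refine sum_congr rfl fun i _ => ?_
    rw [hc]
    dsimp only
    rw [sub_eq_add_neg (x s), mul_add, AddChar.map_add_eq_mul, sub_eq_add_neg _ (y s),
      AddChar.map_add_eq_mul, AddChar.map_add_eq_mul]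
    push_cast
    ring
  have hBb : ∀ i ∈ range (2 * K + 1),
      ‖B ((i : ℤ) - K) - if i = K then ((2 / 5 * M : ℝ) : ℂ) else 0‖ ≤ η * M := by
    intro i hi
    rw [mem_range] at hi
    have hi2 : |(i : ℤ) - K| ≤ K := by rw [abs_le]; constructor <;> omega
    have hp := hS ((i : ℤ) - K) 1 hi2 (by simp) (by simp)
    have hm := hS ((i : ℤ) - K) (-1) hi2 (by simp) (by simp)
    simp only [Int.cast_one, one_mul, Int.cast_neg, neg_mul, ← sub_eq_add_neg] at hp hm
    have h4 : ∀ a b : ℂ, ‖a‖ ≤ η * M → ‖b‖ ≤ η * M → ‖(a + b) / 4‖ ≤ η * M / 2 := by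
      intro a b ha hb
      rw [norm_div, Complex.norm_ofNat]
      linarith [norm_add_le a b]
    have h5 := h4 _ _ hp hm
    split_ifs with hiK
    · have : B ((i : ℤ) - K) - ((2 / 5 * M : ℝ) : ℂ)
          = -((∑ s ∈ S, (wt s : ℂ) * e (((i : ℤ) - K : ℤ) * x s + y s)
        + ∑ s ∈ S, (wt s : ℂ) * e (((i : ℤ) - K : ℤ) * x s - y s)) / 4) := by
        rw [hB, hiK, hMd]
        simp
      rw [this, norm_neg]
      linarith
    · have h0 := hS ((i : ℤ) - K) 0 hi2 (by simp) (Or.inl (by omega))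
      simp only [Int.cast_zero, zero_mul, add_zero] at h0
      rw [sub_zero, hB]
      refine (norm_sub_le _ _).trans ?_
      rw [norm_mul]
      have : ‖(2 / 5 : ℂ)‖ = 2 / 5 := by simp
      rw [this]
      linarith
  have hlow : 1 / (5 * K) * M - η * M ≤ ∑ s ∈ S, Q s := by
    have h1 : ((∑ s ∈ S, Q s : ℝ) : ℂ) - ((c K * (2 / 5 * M) : ℝ) : ℂ)
        = ∑ i ∈ range (2 * K + 1), (c i : ℂ) * e ((((i : ℤ) - K : ℤ) : ℝ) * (-(w / 2)))
        * (B ((i : ℤ) - K) - if i = K then ((2 / 5 * M : ℝ) : ℂ) else 0) := by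
      simp only [mul_sub, mul_ite, mul_zero]
      rw [sum_sub_distrib, ← hexp, sum_ite_eq' (range (2 * K + 1)) K,
        if_pos (mem_range.2 (by omega))]
      simp
    have h2 : ‖((∑ s ∈ S, Q s : ℝ) : ℂ) - ((c K * (2 / 5 * M) : ℝ) : ℂ)‖ ≤ η * M := by
      rw [h1]
      refine (norm_sum_le_of_le _ (n := fun i => c i * (η * M)) fun i hi => ?_).trans ?_
      · rw [norm_mul, norm_mul, norm_e, mul_one, Complex.norm_real, Real.norm_of_nonneg (hc0 i)]
        exact mul_le_mul_of_nonneg_left (hBb i hi) (hc0 i)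
      · rw [← sum_mul, hc, sum_choose_two_mul_div, one_mul]
    rw [← Complex.ofReal_sub, Complex.norm_real, Real.norm_eq_abs] at h2
    have h3 := (abs_le.1 h2).1
    have h4 : 1 / (2 * K : ℝ) * (2 / 5 * M) ≤ c K * (2 / 5 * M) := by
      rw [hc]
      exact mul_le_mul_of_nonneg_right (one_div_le_choose_div hK) (by positivity)
    have h5 : 1 / (2 * K : ℝ) * (2 / 5 * M) = 1 / (5 * K) * M := by field_simp
    linarith
  have hup : ∑ s ∈ S, Q s ≤ Real.exp (-(w ^ 2 * K)) * M := by
    rw [hMd, mul_sum]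
    refine sum_le_sum fun s hs => ?_
    rw [hQ]
    dsimp only
    rw [mul_comm]
    refine mul_le_mul_of_nonneg_right ?_ (hwt s hs)
    have hcos : 0 ≤ Real.cos (Real.pi * (x s - w / 2)) ^ (2 * K) := by
      rw [pow_mul]; positivity
    rcases lt_or_ge (Int.fract (x s)) w with h | h
    · have := hcon s hs h
      have hE := Real.exp_pos (-(w ^ 2 * K))
      nlinarith
    · have h1 := cos_pow_le_of_le_fract hw h K
      have h2 := Real.sin_sq_le_one (Real.pi * y s)
      nlinarith
  have : (η + Real.exp (-(w ^ 2 * K))) * M < 1 / (5 * K) * M := by gcongr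
  linarith

theorem eventually_pow_log_le (c : ℝ) (N : ℕ) :
    ∀ᶠ n : ℕ in Filter.atTop, c * Real.log n ^ N ≤ n := by
  have h1 : ∀ᶠ x : ℝ in Filter.atTop, ‖Real.log x ^ N‖ ≤ (1 / (|c| + 1)) * ‖x‖ :=
    (Real.isLittleO_pow_log_id_atTop (n := N)).bound (by positivity)
  filter_upwards [tendsto_natCast_atTop_atTop.eventually h1] with n hn
  have hl : 0 ≤ Real.log n ^ N := pow_nonneg (Real.log_natCast_nonneg n) N
  rw [Real.norm_of_nonneg hl, Real.norm_of_nonneg (Nat.cast_nonneg n), one_div,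
    inv_mul_eq_div, le_div_iff₀ (by positivity)] at hn
  nlinarith [le_abs_self c]

theorem abs_lin_comb_ge {N₁ N₂ b : ℝ} {h j : ℤ} (h0 : 0 ≤ N₂) (hb : b ≤ N₂) (hb' : b ≤ N₁ - N₂)
    (hj : |j| ≤ 1) (hhj : h ≠ 0 ∨ j ≠ 0) (hb0 : 0 ≤ b) : b ≤ |h * N₁ + j * N₂| := by
  have key : ∀ h : ℤ, b ≤ |h * N₁ + N₂| := by
    intro h
    rcases le_or_gt 0 h with hh | hh
    · have : (0 : ℝ) ≤ h := by exact_mod_cast hh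
      refine le_trans ?_ (le_abs_self _)
      nlinarith
    · have : (h : ℝ) ≤ -1 := by exact_mod_cast (by omega : h ≤ -1)
      refine le_trans ?_ (neg_le_abs _)
      nlinarith
  obtain ⟨hj1, hj2⟩ := abs_le.1 hj
  have : j = -1 ∨ j = 0 ∨ j = 1 := by omega
  rcases this with rfl | rfl | rfl
  · have := key (-h)
    rw [← abs_neg] at this
    convert! this using 2
    push_cast
    ring
  · have hh : h ≠ 0 := by simpa using hhj
    have h1 : (1 : ℝ) ≤ |(h : ℝ)| := by exact_mod_cast Int.one_le_abs hh
    rw [Int.cast_zero, zero_mul, add_zero, abs_mul, abs_of_nonneg (by linarith : 0 ≤ N₁)]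
    nlinarith
  · simpa using key h

theorem exists_log_le_imp {f : ℕ → Prop} {ε : ℝ} (hε : 0 < ε) (hf : ∀ᶠ P : ℕ in Filter.atTop, f P) :
    ∀ᶠ n : ℕ in Filter.atTop, ∀ P : ℕ, Real.log n ^ ((2 : ℝ) / 3 + ε) ≤ Real.log P → f P := by
  obtain ⟨P₀, hP₀⟩ := Filter.eventually_atTop.1 hf
  have h3 := ((tendsto_rpow_atTop (y := (2 : ℝ) / 3 + ε) (by linarith)).comp
    tendsto_log_natCast_atTop).eventually (Filter.eventually_gt_atTop (Real.log P₀))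
  filter_upwards [h3] with n hn P hP
  refine hP₀ P ?_
  by_contra! hlt
  rcases Nat.eq_zero_or_pos P with rfl | hpos
  · rw [Nat.cast_zero, Real.log_zero] at hP
    rw [Function.comp_apply] at hn
    linarith [Real.log_natCast_nonneg P₀]
  · have : Real.log P ≤ Real.log P₀ :=
      Real.log_le_log (by exact_mod_cast hpos) (by exact_mod_cast hlt.le)
    rw [Function.comp_apply] at hn
    linarith

/-- Detection of a prime of prescribed size just below a divisor condition for `N₁`, with `N₂`
away from its multiples. -/
theorem eventually_exists_prime_mod {ε : ℝ} (hε : 0 < ε) (A : ℕ) :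
    ∀ᶠ n : ℕ in Filter.atTop, ∀ P N₁ N₂ : ℕ, Real.log n ^ ((2 : ℝ) / 3 + ε) ≤ Real.log P →
      N₁ ≤ n → P * Real.log n ^ (4 * A + 24) ≤ N₂ →
      P * Real.log n ^ (4 * A + 24) ≤ (N₁ : ℝ) - N₂ →
      ∃ p ∈ primeBlock P, ((N₁ % p : ℕ) : ℝ) * Real.log n ^ A < p ∧
        1 / 10 < Real.sin (Real.pi * (N₂ / p)) ^ 2 := by
  filter_upwards [eventually_norm_sum_primeBlock_le hε (2 * A + 2),
    exists_log_le_imp hε eventually_le_sum_log_primeBlock,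
    exists_log_le_imp hε (Filter.eventually_gt_atTop 0),
    eventually_pow_log_le 4 (2 * A + 1), eventually_pow_log_le 1 (2 * A + 2),
    tendsto_log_natCast_atTop.eventually (Filter.eventually_gt_atTop (20 : ℝ))]
    with n hsum hmass hpos hpow1 hpow2 hl P N₁ N₂ hP hN1 hN2 hN12
  obtain ⟨l, hld⟩ : ∃ l, l = Real.log n := ⟨_, rfl⟩
  have hsum := hsum P hP
  have hmass := hmass P hP
  have hP0 : (0 : ℝ) < P := by exact_mod_cast hpos P hP
  rw [← hld] at hsum hpow1 hpow2 hl hN2 hN12 ⊢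
  have hl0 : 0 < l := by linarith
  have hN1n : (N₁ : ℝ) ≤ n := by exact_mod_cast hN1
  have hN2' : (0 : ℝ) ≤ N₂ := Nat.cast_nonneg _
  have hPn : (P : ℝ) ≤ n := by
    have : (P : ℝ) * 1 ≤ P * l ^ (4 * A + 24) := by
      gcongr
      exact one_le_pow₀ (by linarith)
    have : 0 ≤ P * l ^ (4 * A + 24) := by positivity
    linarith
  have hn0 : (0 : ℝ) < n := by linarith
  obtain ⟨K, hK⟩ : ∃ K : ℕ, K = ⌈l ^ (2 * A + 1)⌉₊ := ⟨_, rfl⟩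
  have hK1 : l ^ (2 * A + 1) ≤ K := hK ▸ Nat.le_ceil _
  have hone : 1 ≤ l ^ (2 * A + 1) := one_le_pow₀ (by linarith)
  have hK2 : (K : ℝ) ≤ 2 * l ^ (2 * A + 1) := by
    have := Nat.ceil_lt_add_one (a := l ^ (2 * A + 1)) (by positivity)
    rw [hK]
    linarith
  have hK0 : 0 < K := by
    have : (0 : ℝ) < K := by linarith
    exact_mod_cast this
  obtain ⟨p, hp, h1, h2⟩ := exists_fract_lt_and_lt_sin_sq (S := primeBlock P)
    (wt := fun p => Real.log p) (x := fun p => N₁ / p) (y := fun p => N₂ / p)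
    (η := 1 / l ^ (2 * A + 2)) (w := 1 / l ^ A) hK0 (fun p _ => Real.log_natCast_nonneg p)
    (hP0.trans_le hmass) (by positivity) (by
      intro h j hh hj hhj
      have hT : ∀ p : ℕ, (h * ((N₁ : ℝ) / p) + j * ((N₂ : ℝ) / p))
        = (h * N₁ + j * N₂) / p := fun p => by ring
      simp only [hT]
      refine (hsum (by exact_mod_cast hPn) (h * N₁ + j * N₂) ?_ ?_).trans ?_
      · rw [show 2 * (2 * A + 2) + 20 = 4 * A + 24 by ring]
        exact abs_lin_comb_ge hN2' hN2 hN12 hj hhj (by positivity)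
      · have hh' : |(h : ℝ)| ≤ K := by exact_mod_cast hh
        have hj' : |(j : ℝ)| ≤ 1 := by exact_mod_cast hj
        have hle : (N₂ : ℝ) ≤ n := by
          have : 0 ≤ P * l ^ (4 * A + 24) := by positivity
          linarith
        have hN1' : (0 : ℝ) ≤ N₁ := Nat.cast_nonneg _
        calc |(h : ℝ) * N₁ + j * N₂| ≤ |(h : ℝ)| * N₁ + |(j : ℝ)| * N₂ := by
              refine (abs_add_le _ _).trans (le_of_eq ?_)
              rw [abs_mul, abs_mul, abs_of_nonneg hN2', abs_of_nonneg hN1']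
          _ ≤ K * n + 1 * n := by gcongr
          _ = (K + 1) * n := by ring
          _ ≤ n * n := by
              gcongr
              linarith
          _ = _ := (sq _).symm
      · rw [div_eq_mul_one_div, mul_comm]
        gcongr) (by
      have hw : (1 / l ^ A) ^ 2 * K ≥ l := by
        calc l = (1 / l ^ A) ^ 2 * l ^ (2 * A + 1) := by
              rw [pow_succ l, mul_comm 2 A, pow_mul]
              field_simp
          _ ≤ _ := by gcongr
      have hexp : Real.exp (-((1 / l ^ A) ^ 2 * K)) ≤ 1 / l ^ (2 * A + 2) := by
        calc _ ≤ Real.exp (-l) := Real.exp_le_exp.2 (by linarith)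
          _ = 1 / n := by rw [Real.exp_neg, hld, Real.exp_log hn0, one_div]
          _ ≤ _ := by
            gcongr
            linarith
      have h5 : 1 / (5 * (2 * l ^ (2 * A + 1))) ≤ 1 / (5 * (K : ℝ)) := by gcongr
      have h6 : 1 / l ^ (2 * A + 2) + 1 / l ^ (2 * A + 2) < 1 / (5 * (2 * l ^ (2 * A + 1))) := by
        rw [← add_div, div_lt_div_iff₀ (by positivity) (by positivity), pow_succ l (2 * A + 1)]
        have : 0 < l ^ (2 * A + 1) := by positivity
        nlinarith
      linarith)
  refine ⟨p, hp, ?_, h2⟩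
  rw [Int.fract_div_natCast_eq_div_natCast_mod] at h1
  have hp0 : (0 : ℝ) < p := by exact_mod_cast (mem_primeBlock.1 hp).2.pos
  rwa [div_lt_div_iff₀ hp0 (by positivity), one_mul] at h1

/-- Detection of a prime of prescribed size with `N` just above one of its multiples. -/
theorem eventually_exists_prime_mod_lt {ε : ℝ} (hε : 0 < ε) (A : ℕ) :
    ∀ᶠ n : ℕ in Filter.atTop, ∀ P N : ℕ, Real.log n ^ ((2 : ℝ) / 3 + ε) ≤ Real.log P →
      N ≤ n → P * Real.log n ^ (4 * A + 25) ≤ N →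
      ∃ p ∈ primeBlock P, ((N % p : ℕ) : ℝ) * Real.log n ^ A < p := by
  filter_upwards [eventually_exists_prime_mod hε A,
    exists_log_le_imp hε (Filter.eventually_gt_atTop 0),
    tendsto_log_natCast_atTop.eventually (Filter.eventually_gt_atTop (20 : ℝ))]
    with n hn hpos hl P N hP hN hPN
  have hP0 : (1 : ℝ) ≤ P := by exact_mod_cast hpos P hP
  have h1 : 1 ≤ Real.log n ^ (4 * A + 24) := one_le_pow₀ (by linarith)
  have h2 : 20 * (P * Real.log n ^ (4 * A + 24)) ≤ N := by
    rw [show 4 * A + 25 = (4 * A + 24) + 1 by ring, pow_succ] at hPN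
    refine le_trans ?_ hPN
    rw [mul_comm, mul_assoc]
    gcongr
  have h3 : 1 ≤ P * Real.log n ^ (4 * A + 24) := one_le_mul_of_one_le_of_one_le hP0 h1
  have h4 : ((N / 2 : ℕ) : ℝ) ≤ N / 2 := Nat.cast_div_le
  have h5 : (N : ℝ) ≤ 2 * (N / 2 : ℕ) + 1 := by exact_mod_cast (by omega : N ≤ 2 * (N / 2) + 1)
  obtain ⟨p, hp, h, -⟩ := hn P N (N / 2) hP hN (by linarith) (by linarith)
  exact ⟨p, hp, h⟩

theorem log_div_sub_antitone {m a b : ℝ} (hm : 0 ≤ m) (ha : m < a) (hab : a ≤ b) :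
    Real.log (b / (b - m)) ≤ Real.log (a / (a - m)) := by
  have h1 : 0 < a - m := by linarith
  have h2 : 0 < b - m := by linarith
  refine Real.log_le_log (by apply div_pos <;> linarith) ?_
  rw [div_le_div_iff₀ h2 h1]
  nlinarith

theorem log_choose_add_one_left {n m : ℕ} (h : m ≤ n) :
    Real.log ((n + 1).choose m)
      = Real.log (n.choose m) + Real.log (((n : ℝ) + 1) / (n + 1 - m)) := by
  have h1 := Nat.choose_mul_succ_eq n m
  have h2 : (0 : ℝ) < n.choose m := by exact_mod_cast Nat.choose_pos h
  have hm : (m : ℝ) ≤ n := by exact_mod_cast h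
  have h3 : (n.choose m : ℝ) * (n + 1) = (n + 1).choose m * (n + 1 - m) := by
    have : ((n + 1 - m : ℕ) : ℝ) = n + 1 - m := by
      rw [Nat.cast_sub (by omega)]
      push_cast
      ring
    rw [← this]
    exact_mod_cast h1
  have h4 : (0 : ℝ) < n + 1 - m := by linarith
  rw [← Real.log_mul h2.ne' (by positivity), ← mul_div_assoc, h3, mul_div_cancel_right₀ _ h4.ne']

theorem log_choose_add_one_right {n m : ℕ} (h : m < n) :
    Real.log (n.choose (m + 1))
      = Real.log (n.choose m) + Real.log (((n : ℝ) - m) / (m + 1)) := by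
  have h1 := Nat.choose_succ_right_eq n m
  have h2 : (0 : ℝ) < n.choose m := by exact_mod_cast Nat.choose_pos h.le
  have hm : (m : ℝ) < n := by exact_mod_cast h
  have h3 : (n.choose (m + 1) : ℝ) * (m + 1) = n.choose m * (n - m) := by
    rw [← Nat.cast_sub h.le]
    exact_mod_cast h1
  have h4 : (0 : ℝ) < n - m := by linarith
  rw [← Real.log_mul h2.ne' (by positivity), ← mul_div_assoc, ← h3,
    mul_div_cancel_right₀ _ (by positivity)]

theorem log_choose_sub_log_choose_left {n' m : ℕ} (hm : m ≤ n') (D : ℕ) :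
    D * Real.log (((n' + D : ℕ) : ℝ) / ((n' + D : ℕ) - m))
        ≤ Real.log ((n' + D).choose m) - Real.log (n'.choose m) ∧
      Real.log ((n' + D).choose m) - Real.log (n'.choose m)
        ≤ D * Real.log (((n' : ℝ) + 1) / (n' + 1 - m)) := by
  have hm' : (m : ℝ) ≤ n' := by exact_mod_cast hm
  have hm0 : (0 : ℝ) ≤ m := Nat.cast_nonneg m
  induction D with
  | zero => simp
  | succ D ih =>
    have hD : (0 : ℝ) ≤ D := Nat.cast_nonneg D
    rw [← Nat.add_assoc, log_choose_add_one_left (by omega)]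
    push_cast at ih ⊢
    have h1 := log_div_sub_antitone hm0 (show (m : ℝ) < n' + 1 by linarith)
      (show (n' : ℝ) + 1 ≤ n' + D + 1 by linarith)
    have h2 : D * Real.log (((n' : ℝ) + D + 1) / (n' + D + 1 - m))
        ≤ D * Real.log (((n' : ℝ) + D) / (n' + D - m)) := by
      rcases eq_or_lt_of_le hD with h0 | h0
      · rw [← h0]; simp
      · exact mul_le_mul_of_nonneg_left
          (log_div_sub_antitone hm0 (by linarith) (by linarith)) hD
    constructor <;> linarith [ih.1, ih.2]

theorem log_sub_div_antitone {n a b c d : ℝ} (ha : 0 < c) (hd : b < n) (hcd : c ≤ d)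
    (hab : a ≤ b) : Real.log ((n - b) / d) ≤ Real.log ((n - a) / c) := by
  refine Real.log_le_log (div_pos (by linarith) (by linarith)) ?_
  rw [div_le_div_iff₀ (by linarith) ha]
  nlinarith

theorem log_choose_sub_log_choose_right {n' m E : ℕ} (hE : m + E ≤ n') :
    E * Real.log (((n' : ℝ) + 1 - (m + E : ℕ)) / (m + E : ℕ))
        ≤ Real.log (n'.choose (m + E)) - Real.log (n'.choose m) ∧
      Real.log (n'.choose (m + E)) - Real.log (n'.choose m)
        ≤ E * Real.log (((n' : ℝ) - m) / (m + 1)) := by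
  induction E with
  | zero => simp
  | succ E ih =>
    have hm0 : (0 : ℝ) ≤ m := Nat.cast_nonneg m
    have hEn : ((m + (E + 1) : ℕ) : ℝ) ≤ n' := by exact_mod_cast hE
    have hD : (0 : ℝ) ≤ E := Nat.cast_nonneg E
    have ih := ih (by omega)
    rw [← Nat.add_assoc, log_choose_add_one_right (by omega)]
    push_cast at ih hEn ⊢
    have h1 := log_sub_div_antitone (n := n') (a := m) (b := m + E) (c := m + 1) (d := m + E + 1)
      (by linarith) (by linarith) (by linarith) (by linarith)
    have h2 : E * Real.log (((n' : ℝ) - (m + E)) / (m + E + 1))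
        ≤ E * Real.log (((n' : ℝ) + 1 - (m + E)) / (m + E)) := by
      rcases Nat.eq_zero_or_pos E with h0 | h0
      · rw [h0]; simp
      · have h0' : (0 : ℝ) < E := by exact_mod_cast h0
        have := log_sub_div_antitone (n := (n' : ℝ) + 1) (a := m + E) (b := m + E + 1)
          (c := m + E) (d := m + E + 1) (by linarith) (by linarith) (by linarith) (by linarith)
        rw [show (n' : ℝ) + 1 - (m + E + 1) = n' - (m + E) by ring] at this
        exact mul_le_mul_of_nonneg_left this hD
    rw [show (n' : ℝ) + 1 - (m + E + 1) = n' - (m + E) by ring]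
    constructor <;> linarith [ih.1, ih.2]

/-- Two solutions of `C(n, m) = C(n', m')` with `m < m'` in the lower half of their rows. -/
structure SolPair (n m n' m' : ℕ) : Prop where
  pos : 1 ≤ m
  lt : m < m'
  le_left : 2 * m ≤ n
  le_right : 2 * m' ≤ n'
  eq : n.choose m = n'.choose m'

namespace SolPair

variable {n m n' m' : ℕ}

theorem row_lt (h : SolPair n m n' m') : n' < n := by
  by_contra! hn
  have h1 : n.choose m ≤ n'.choose m := Nat.choose_le_choose m hn
  have h2 := h.eq
  have h3 : n'.choose m < n'.choose m' := by
    have h4 := (log_choose_sub_log_choose_right (n' := n') (m := m) (E := m' - m)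
      (by have := h.lt; have := h.le_right; omega)).1
    have hm' : m + (m' - m) = m' := by have := h.lt; omega
    rw [hm'] at h4
    have h5 : (2 : ℝ) * m' ≤ n' := by exact_mod_cast h.le_right
    have h6 : (0 : ℝ) < m' := by exact_mod_cast Nat.zero_lt_of_lt h.lt
    have h7 : 0 < Real.log (((n' : ℝ) + 1 - m') / m') := by
      apply Real.log_pos
      rw [one_lt_div h6]
      linarith
    have h8 : (0 : ℝ) < ((m' - m : ℕ) : ℝ) := by exact_mod_cast Nat.sub_pos_of_lt h.lt
    have h9 : 0 < ((m' - m : ℕ) : ℝ) * Real.log (((n' : ℝ) + 1 - m') / m') := by positivity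
    have h10 : (0 : ℝ) < n'.choose m := by
      exact_mod_cast Nat.choose_pos (by have := h.lt; have := h.le_right; omega)
    have h11 : Real.log (n'.choose m) < Real.log (n'.choose m') := by linarith
    exact_mod_cast (Real.log_lt_log_iff h10
      (by exact_mod_cast Nat.choose_pos (by have := h.le_right; omega))).1 h11
  omega

theorem log_row_le (h : SolPair n m n' m') :
    ((n : ℝ) - n') * Real.log (n / (n - m))
      ≤ ((m' : ℝ) - m) * Real.log ((n' - m) / (m + 1)) := by
  have h0 := h.row_lt
  have h1 := (log_choose_sub_log_choose_left (n' := n') (m := m)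
    (by have := h.lt; have := h.le_right; omega) (n - n')).1
  have h2 := (log_choose_sub_log_choose_right (n' := n') (m := m) (E := m' - m)
      (by have := h.lt; have := h.le_right; omega)).2
  rw [Nat.add_sub_cancel' h.lt.le, Nat.cast_sub h.lt.le, ← h.eq] at h2
  rw [Nat.add_sub_cancel' h0.le, Nat.cast_sub h0.le] at h1
  linarith

theorem log_col_le (h : SolPair n m n' m') :
    ((m' : ℝ) - m) * Real.log ((n' + 1 - m') / m')
      ≤ ((n : ℝ) - n') * Real.log ((n' + 1) / (n' + 1 - m)) := by
  have h0 := h.row_lt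
  have h1 := (log_choose_sub_log_choose_left (n' := n') (m := m)
    (by have := h.lt; have := h.le_right; omega) (n - n')).2
  have h2 := (log_choose_sub_log_choose_right (n' := n') (m := m) (E := m' - m)
      (by have := h.lt; have := h.le_right; omega)).1
  rw [Nat.add_sub_cancel' h.lt.le, Nat.cast_sub h.lt.le, ← h.eq] at h2
  rw [Nat.add_sub_cancel' h0.le, Nat.cast_sub h0.le] at h1
  linarith

end SolPair

namespace SolPair

variable {n m n' m' : ℕ}

theorem col_le (h : SolPair n m n' m') : (m' : ℝ) ≤ 2 * m * Real.log n := by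
  have h1 : 2 ^ m' ≤ n ^ m := by
    calc 2 ^ m' ≤ n'.choose m' := by
          rcases Nat.eq_zero_or_pos m' with h0 | h0
          · rw [h0]; simp
          refine le_trans ?_ (Nat.choose_le_choose m' h.le_right)
          have h1 := Nat.four_pow_le_two_mul_self_mul_centralBinom m' h0
          have h2 : 2 * m' ≤ 2 ^ m' := by
            obtain ⟨k, rfl⟩ : ∃ k, m' = k + 1 := ⟨m' - 1, by omega⟩
            have := Nat.lt_two_pow_self (n := k)
            rw [pow_succ]
            omega
          rw [Nat.centralBinom_eq_two_mul_choose, show 4 = 2 * 2 from rfl, mul_pow] at h1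
          exact Nat.le_of_mul_le_mul_left (h1.trans (Nat.mul_le_mul_right _ h2)) (by positivity)
      _ = n.choose m := h.eq.symm
      _ ≤ n ^ m := Nat.choose_le_pow n m
  have h2 : (m' : ℝ) * Real.log 2 ≤ m * Real.log n := by
    rw [← Real.log_pow, ← Real.log_pow]
    exact Real.log_le_log (by positivity) (by exact_mod_cast h1)
  have h3 : (m' : ℝ) * (1 / 2) ≤ m' * Real.log 2 := by
    gcongr
    linarith [Real.log_two_gt_d9]
  linarith

theorem mul_le_of_four_mul_le (h : SolPair n m n' m') (h4 : 4 * m' ≤ n') :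
    ((m' : ℝ) - m) * (n' - m) ≤ ((n : ℝ) - n') * m := by
  have h1 := h.log_col_le
  have hD : (n' : ℝ) < n := by exact_mod_cast h.row_lt
  have hE : (m : ℝ) < m' := by exact_mod_cast h.lt
  have hm0 : (0 : ℝ) ≤ m := Nat.cast_nonneg m
  have h4' : (4 : ℝ) * m' ≤ n' := by exact_mod_cast h4
  have h2 : 1 ≤ Real.log (((n' : ℝ) + 1 - m') / m') := by
    rw [Real.le_log_iff_exp_le (by apply div_pos <;> linarith), le_div_iff₀ (by linarith)]
    nlinarith [Real.exp_one_lt_d9]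
  have h3 : Real.log (((n' : ℝ) + 1) / (n' + 1 - m)) ≤ m / (n' + 1 - m) := by
    refine (Real.log_le_sub_one_of_pos (by apply div_pos <;> linarith)).trans (le_of_eq ?_)
    rw [div_sub_one (by linarith)]
    congr 1
    ring
  have h5 : ((m' : ℝ) - m) * 1 ≤ ((n : ℝ) - n') * (m / (n' + 1 - m)) :=
    (mul_le_mul_of_nonneg_left h2 (by linarith)).trans
      (h1.trans (mul_le_mul_of_nonneg_left h3 (by linarith)))
  rw [mul_one, ← mul_div_assoc, le_div_iff₀ (by linarith)] at h5
  nlinarith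

theorem sub_mul_le (h : SolPair n m n' m') :
    ((n : ℝ) - n') * m ≤ n * (((m' : ℝ) - m) * Real.log n) := by
  have h1 := h.log_row_le
  have hD : (n' : ℝ) < n := by exact_mod_cast h.row_lt
  have hE : (m : ℝ) < m' := by exact_mod_cast h.lt
  have hm0 : (1 : ℝ) ≤ m := by exact_mod_cast h.pos
  have h4' : (2 : ℝ) * m' ≤ n' := by exact_mod_cast h.le_right
  have h2 : (m : ℝ) / n ≤ Real.log ((n : ℝ) / (n - m)) := by
    have := Real.one_sub_inv_le_log_of_pos (x := (n : ℝ) / (n - m)) (by apply div_pos <;> linarith)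
    refine le_trans (le_of_eq ?_) this
    have : (n : ℝ) ≠ 0 := by linarith
    rw [inv_div, one_sub_div this]
    congr 1
    ring
  have h3 : Real.log (((n' : ℝ) - m) / (m + 1)) ≤ Real.log n := by
    refine Real.log_le_log (by apply div_pos <;> linarith) ?_
    rw [div_le_iff₀ (by linarith)]
    nlinarith
  have h5 : ((n : ℝ) - n') * (m / n) ≤ ((m' : ℝ) - m) * Real.log n :=
    (mul_le_mul_of_nonneg_left h2 (by linarith)).trans
      (h1.trans (mul_le_mul_of_nonneg_left h3 (by linarith)))
  rw [← mul_div_assoc, div_le_iff₀ (by linarith)] at h5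
  linarith

end SolPair

theorem dvd_prod_Ioc_iff {p a b : ℕ} (hp : p.Prime) :
    p ∣ ∏ i ∈ Ioc a b, i ↔ ∃ i, a < i ∧ i ≤ b ∧ p ∣ i := by
  rw [hp.prime.dvd_finsetProd_iff]
  constructor
  · rintro ⟨i, hi, h⟩
    rw [mem_Ioc] at hi
    exact ⟨i, hi.1, hi.2, h⟩
  · rintro ⟨i, h1, h2, h⟩
    exact ⟨i, mem_Ioc.2 ⟨h1, h2⟩, h⟩

theorem factorial_mul_prod_Ioc {a b : ℕ} (h : a ≤ b) :
    a.factorial * ∏ i ∈ Ioc a b, i = b.factorial := by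
  induction b, h using Nat.le_induction with
  | base => simp
  | succ b hab ih =>
    rw [prod_Ioc_succ_top hab, ← mul_assoc, ih, Nat.factorial_succ, mul_comm]

theorem dvd_choose_of_mod_lt {p n m : ℕ} (hp : p.Prime) (hmp : m < p) (hmn : m ≤ n)
    (h : n % p < m) : p ∣ n.choose m := by
  have h1 : p ∣ ∏ i ∈ Ioc (n - m) n, i := by
    rw [dvd_prod_Ioc_iff hp]
    have := Nat.mod_le n p
    exact ⟨n - n % p, by omega, by omega, Nat.dvd_sub_mod n⟩
  have h2 := factorial_mul_prod_Ioc (show n - m ≤ n by omega)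
  rw [← Nat.choose_mul_factorial_mul_factorial hmn, mul_comm] at h2
  have h3 := Nat.eq_of_mul_eq_mul_right (Nat.factorial_pos _) h2
  rw [h3] at h1
  rcases hp.dvd_mul.1 h1 with h | h
  · exact h
  · exact absurd ((hp.dvd_factorial).1 h) (by omega)

theorem mod_lt_of_dvd_choose {p n m : ℕ} (hp : p.Prime) (hmn : m ≤ n)
    (h : p ∣ n.choose m) : n % p < m := by
  have h2 := factorial_mul_prod_Ioc (show n - m ≤ n by omega)
  rw [← Nat.choose_mul_factorial_mul_factorial hmn, mul_comm] at h2
  have h3 := Nat.eq_of_mul_eq_mul_right (Nat.factorial_pos _) h2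
  obtain ⟨i, hi1, hi2, j, rfl⟩ := (dvd_prod_Ioc_iff hp).1 (h3 ▸ h.mul_right _)
  by_contra! hcon
  have h4 : j ≤ n / p := (Nat.le_div_iff_mul_le hp.pos).2 (by rw [mul_comm]; exact hi2)
  have h5 := Nat.mul_le_mul_left p h4
  have h6 := Nat.div_add_mod n p
  omega

theorem mod_add_mod_eq {p n m : ℕ} (hp : p.Prime) (hmn : m ≤ n) (hn : n < p ^ 2) :
    m % p + (n - m) % p = n % p + p * (n.choose m).factorization p := by
  have hlog : Nat.log p n < 2 := by
    rcases Nat.eq_zero_or_pos n with rfl | h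
    · simp
    · exact Nat.log_lt_of_lt_pow h.ne' hn
  rw [Nat.factorization_choose hp hmn hlog, show Ico 1 2 = {1} from rfl, filter_singleton, pow_one]
  split_ifs with h
  · have := Nat.add_mod_add_of_le_add_mod h
    rw [Nat.add_sub_cancel' hmn] at this
    rw [card_singleton, mul_one, this]
  · have := Nat.add_mod_of_add_mod_lt (not_le.1 h)
    rw [Nat.add_sub_cancel' hmn] at this
    rw [card_empty, mul_zero, add_zero, this]

namespace SolPair

variable {n m n' m' : ℕ}

theorem prod_eq (h : SolPair n m n' m') :
    (∏ i ∈ Ioc n' n, i) * ∏ i ∈ Ioc m m', i = ∏ i ∈ Ioc (n' - m') (n - m), i := by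
  have h1 := h.row_lt
  have h2 := h.lt
  have h3 := h.le_right
  have a := factorial_mul_prod_Ioc h1.le
  have b := factorial_mul_prod_Ioc h2.le
  have c := factorial_mul_prod_Ioc (show n' - m' ≤ n - m by omega)
  have d := Nat.choose_mul_factorial_mul_factorial (show m ≤ n by omega)
  have d' := Nat.choose_mul_factorial_mul_factorial (show m' ≤ n' by omega)
  rw [h.eq] at d
  have hpos : 0 < n'.choose m' * m.factorial * (n' - m').factorial * m'.factorial :=
    Nat.mul_pos (Nat.mul_pos (Nat.mul_pos (Nat.choose_pos (by omega)) (Nat.factorial_pos _))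
      (Nat.factorial_pos _)) (Nat.factorial_pos _)
  refine Nat.eq_of_mul_eq_mul_left hpos ?_
  calc _ = (n'.choose m' * m'.factorial * (n' - m').factorial) * (∏ i ∈ Ioc n' n, i)
        * (m.factorial * ∏ i ∈ Ioc m m', i) := by ring
    _ = n.factorial * m'.factorial := by rw [d', a, b]
    _ = n'.choose m' * m.factorial * ((n' - m').factorial * ∏ i ∈ Ioc (n' - m') (n - m), i)
        * m'.factorial := by rw [c, d]
    _ = _ := by ring

theorem exists_dvd_of_row (h : SolPair n m n' m') {p : ℕ} (hp : p.Prime)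
    (hr : n % p < n - n') (hr' : n % p < n) :
    ∃ i, n' - m' < i ∧ i ≤ n - m ∧ p ∣ i := by
  rw [← dvd_prod_Ioc_iff hp, ← h.prod_eq]
  refine Dvd.dvd.mul_right ((dvd_prod_Ioc_iff hp).2 ⟨n - n % p, ?_, by omega, Nat.dvd_sub_mod n⟩) _
  omega

theorem exists_dvd_of_diff (h : SolPair n m n' m') {p : ℕ} (hp : p.Prime)
    (hr : (n - m) % p < (n - m) - (n' - m')) :
    (∃ i, n' < i ∧ i ≤ n ∧ p ∣ i) ∨ ∃ i, m < i ∧ i ≤ m' ∧ p ∣ i := by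
  rw [← dvd_prod_Ioc_iff hp, ← dvd_prod_Ioc_iff hp, ← hp.dvd_mul, h.prod_eq,
    dvd_prod_Ioc_iff hp]
  exact ⟨(n - m) - (n - m) % p, by omega, by omega, Nat.dvd_sub_mod _⟩

end SolPair

theorem sin_sq_le_of_dvd {p N : ℕ} {z : ℤ} (hp : 0 < p) (hz : (p : ℤ) ∣ z)
    (h : 10 * |(N : ℤ) - z| ≤ p) : Real.sin (Real.pi * ((N : ℝ) / p)) ^ 2 ≤ 1 / 10 := by
  obtain ⟨k, rfl⟩ := hz
  have hp' : (0 : ℝ) < p := by exact_mod_cast hp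
  have h1 : 10 * |(N : ℝ) - p * k| ≤ p := by exact_mod_cast h
  have h2 : Real.sin (Real.pi * ((N : ℝ) / p)) ^ 2
      = Real.sin (Real.pi * (((N : ℝ) - p * k) / p)) ^ 2 := by
    rw [Real.sin_sq_eq_half_sub, Real.sin_sq_eq_half_sub,
      ← Real.cos_sub_int_mul_two_pi (2 * (Real.pi * ((N : ℝ) / p))) k]
    congr 3
    field_simp
  rw [h2]
  refine Real.sin_sq_le_sq.trans ?_
  have h3 : |((N : ℝ) - p * k) / p| ≤ 1 / 10 := by
    rw [abs_div, abs_of_pos hp', div_le_iff₀ hp']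
    linarith
  rw [mul_pow, ← sq_abs (((N : ℝ) - p * k) / p)]
  have h4 : Real.pi ^ 2 ≤ 10 := by nlinarith [Real.pi_lt_d2, Real.pi_pos]
  have h5 : |((N : ℝ) - p * k) / p| ^ 2 ≤ (1 / 10) ^ 2 := by gcongr
  nlinarith [sq_nonneg |((N : ℝ) - p * k) / p|]

theorem eventually_pow_log_le_of_exp_le {ε : ℝ} (hε : 0 < ε) (c : ℝ) (N : ℕ) :
    ∀ᶠ n : ℕ in Filter.atTop, ∀ x : ℝ, Real.exp (Real.log n ^ ((2 : ℝ) / 3 + ε)) ≤ x →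
      c * Real.log n ^ N ≤ x := by
  filter_upwards [tendsto_log_natCast_atTop.eventually (eventually_exp_neg_mul_rpow_le
      (c := 1) (b := 2 / 3 + ε) one_pos (by linarith) (N + 1)),
    tendsto_log_natCast_atTop.eventually (Filter.eventually_ge_atTop c),
    tendsto_log_natCast_atTop.eventually (Filter.eventually_gt_atTop 0)] with n h1 h2 h3 x hx
  rw [one_mul, Real.exp_neg, one_div] at h1
  have h4 := (inv_le_inv₀ (Real.exp_pos _) (by positivity)).1 h1
  calc c * Real.log n ^ N ≤ Real.log n * Real.log n ^ N := by gcongr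
    _ = Real.log n ^ (N + 1) := by ring
    _ ≤ x := h4.trans hx

theorem eventually_rpow_log_le (C : ℕ) :
    ∀ᶠ n : ℕ in Filter.atTop, ∀ P : ℕ, n ≤ P ^ C →
      Real.log n ^ ((2 : ℝ) / 3 + 1 / 6) ≤ Real.log P := by
  have h1 : ∀ᶠ x : ℝ in Filter.atTop, (C : ℝ) ≤ x ^ (1 / 6 : ℝ) :=
    (tendsto_rpow_atTop (by norm_num)).eventually (Filter.eventually_ge_atTop _)
  filter_upwards [tendsto_log_natCast_atTop.eventually h1,
    tendsto_log_natCast_atTop.eventually (Filter.eventually_gt_atTop 0),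
    Filter.eventually_gt_atTop 0] with n h1 h2 h3 P hP
  have h4 : Real.log n ≤ C * Real.log P := by
    rw [← Real.log_pow]
    exact Real.log_le_log (by exact_mod_cast h3) (by exact_mod_cast hP)
  have h6 : 0 ≤ Real.log P := Real.log_natCast_nonneg P
  have h5 : Real.log n ^ ((2 : ℝ) / 3 + 1 / 6) * Real.log n ^ (1 / 6 : ℝ) = Real.log n := by
    rw [← Real.rpow_add h2]
    norm_num
  have h7 : Real.log n ^ ((2 : ℝ) / 3 + 1 / 6) * Real.log n ^ (1 / 6 : ℝ)
      ≤ Real.log P * Real.log n ^ (1 / 6 : ℝ) := by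
    rw [h5, mul_comm]
    exact h4.trans (mul_le_mul_of_nonneg_right h1 h6)
  exact le_of_mul_le_mul_right h7 (by positivity)

theorem natCast_lt_of_mul_lt {a b : ℕ} {x y : ℝ} (hx : 0 < x) (h : a * x < y) (hy : y ≤ b * x) :
    a < b := by
  have : (a : ℝ) < b := lt_of_mul_lt_mul_right (h.trans_le hy) hx.le
  exact_mod_cast this

/-- The rows of two solutions are within `m'` times a power of the logarithm. -/
theorem eventually_row_sub_lt {ε : ℝ} (hε : 0 < ε) :
    ∀ᶠ n : ℕ in Filter.atTop, ∀ m n' m' : ℕ, SolPair n m n' m' →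
      Real.exp (Real.log n ^ ((2 : ℝ) / 3 + ε)) ≤ m →
      (n : ℝ) - n' < m' * Real.log n ^ 194 := by
  filter_upwards [eventually_exists_prime_mod hε 2, eventually_exists_prime_mod_lt hε 34,
    tendsto_log_natCast_atTop.eventually (Filter.eventually_ge_atTop (1000 : ℝ))]
    with n hdet hdet1 hl m n' m' h hm
  by_contra! hD
  obtain ⟨l, hld⟩ : ∃ l, l = Real.log n := ⟨_, rfl⟩
  have hcol := h.col_le
  have hlt := h.lt
  have hrow := h.row_lt
  have hll := h.le_left
  have hlr := h.le_right
  have hm1 : (1 : ℝ) ≤ m := by exact_mod_cast h.pos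
  have hlogm : Real.log n ^ ((2 : ℝ) / 3 + ε) ≤ Real.log m :=
    (Real.le_log_iff_exp_le (by linarith)).2 hm
  rw [← hld] at hdet hdet1 hl hD hcol hlogm
  have hl0 : 0 < l := by linarith
  have hm'0 : (m : ℝ) < m' := by exact_mod_cast hlt
  have hmono : ∀ c a : ℝ, 0 ≤ c → ∀ i j : ℕ, i < j → a ≤ 1000 → c * (a * l ^ i) ≤ c * l ^ j := by
    intro c a hc i j hij ha
    refine mul_le_mul_of_nonneg_left ?_ hc
    calc a * l ^ i ≤ l * l ^ i := by gcongr; linarith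
      _ = l ^ (i + 1) := by ring
      _ ≤ l ^ j := pow_le_pow_right₀ (by linarith) hij
  rcases le_or_gt (10 * m' * l ^ 32) (n' : ℝ) with hn' | hn'
  · obtain ⟨p, hp, h1, h2⟩ := hdet (10 * m') n n'
      (hlogm.trans (Real.log_le_log (by linarith) (by push_cast; linarith))) le_rfl
      (by push_cast; exact hn') (by
        have := hmono m' 10 (by linarith) 32 194 (by norm_num) (by norm_num)
        push_cast
        linarith)
    obtain ⟨⟨hp1, hp2⟩, hpp⟩ := mem_primeBlock.1 hp
    have hp2' : (p : ℝ) ≤ 40 * m' := by exact_mod_cast (by omega : p ≤ 40 * m')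
    have h3 : n % p < m := natCast_lt_of_mul_lt (by positivity) h1 (by
      have := hmono m 80 (by linarith) 1 2 (by norm_num) (by norm_num)
      linarith)
    have h4 := dvd_choose_of_mod_lt hpp (by omega) (by omega) h3
    rw [h.eq] at h4
    have h5 := mod_lt_of_dvd_choose hpp (by omega) h4
    have h6 := sin_sq_le_of_dvd (p := p) (N := n') (z := (p * (n' / p) : ℕ)) hpp.pos
      (by push_cast; exact dvd_mul_right _ _) (by
        have := Nat.div_add_mod n' p
        rw [abs_of_nonneg] <;> omega)
    linarith
  · have hn'1 : (1 : ℝ) ≤ n' := by exact_mod_cast (by omega : 1 ≤ n')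
    obtain ⟨p, hp, h1⟩ := hdet1 (2 * n') n
      (hlogm.trans (Real.log_le_log (by linarith) (by
        have : (m : ℝ) ≤ n' := by exact_mod_cast (by omega : m ≤ n')
        push_cast; linarith))) le_rfl (by
        have h8 : (n' : ℝ) * l ^ 161 ≤ 10 * m' * l ^ 32 * l ^ 161 := by gcongr
        have h9 := hmono m' 20 (by linarith) 193 194 (by norm_num) (by norm_num)
        rw [mul_assoc (10 * (m' : ℝ)), ← pow_add] at h8
        norm_num at h8 ⊢
        nlinarith)
    obtain ⟨⟨hp1, hp2⟩, hpp⟩ := mem_primeBlock.1 hp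
    have hp2' : (p : ℝ) ≤ 8 * n' := by exact_mod_cast (by omega : p ≤ 8 * n')
    have h3 : n % p < m := natCast_lt_of_mul_lt (by positivity) h1 (by
      have h7 := hmono m 160 (by linarith) 33 34 (by norm_num) (by norm_num)
      have h8 : (m' : ℝ) * l ^ 32 ≤ 2 * m * l * l ^ 32 := by gcongr
      rw [mul_assoc (2 * (m : ℝ)), ← pow_succ'] at h8
      norm_num only at h8
      linarith)
    have h4 := dvd_choose_of_mod_lt hpp (by omega) (by omega) h3
    rw [h.eq] at h4
    have h5 := (hpp.dvd_factorial).1 (h4.trans (Dvd.intro _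
      ((mul_assoc _ _ _).symm.trans (Nat.choose_mul_factorial_mul_factorial (by omega)))))
    omega

namespace SolPair

variable {n m n' m' : ℕ} {u l : ℝ}

theorem row_le_pow_four (h : SolPair n m n' m') (hu : u ^ 10 = m) (hl : 1000 ≤ l)
    (hlu : l ^ 2000 ≤ u) (hE : (m' : ℝ) - m ≤ u ^ 9) (hD : (n : ℝ) - n' < m' * l ^ 194) :
    m' ≤ 2 * m ∧ n ≤ m ^ 4 := by
  have hl1 : 1 ≤ l := by linarith
  have hu1 : 1000 ≤ u := hl.trans ((le_self_pow₀ hl1 (by norm_num)).trans hlu)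
  have hm'm : (m' : ℝ) ≤ 2 * m := by
    have : u ^ 9 ≤ u ^ 10 := pow_le_pow_right₀ (by linarith) (by norm_num)
    linarith
  have hum : u ≤ m := hu ▸ le_self_pow₀ (by linarith) (by norm_num)
  have hlt : (m : ℝ) < m' := by exact_mod_cast h.lt
  have hE1 : (m : ℝ) + 1 ≤ m' := by exact_mod_cast h.lt
  have hpow : 4 * l ^ 194 ≤ m := by
    calc 4 * l ^ 194 ≤ l * l ^ 194 := by gcongr; linarith
      _ = l ^ 195 := by ring
      _ ≤ l ^ 2000 := pow_le_pow_right₀ hl1 (by norm_num)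
      _ ≤ m := hlu.trans hum
  have hn' : (n' : ℝ) < m' ^ 3 := by
    by_contra! hn
    have h4 : (4 : ℝ) * m' ≤ n' := by
      refine le_trans ?_ hn
      nlinarith [sq_nonneg ((m' : ℝ) - 2)]
    have h1 := h.mul_le_of_four_mul_le (by exact_mod_cast h4)
    have h2 : 1 * ((n' : ℝ) - m) ≤ (m' - m) * (n' - m) := by
      apply mul_le_mul_of_nonneg_right <;> linarith
    have h3 : ((n : ℝ) - n') * m ≤ m' * l ^ 194 * m := by gcongr
    have h5 : (m' : ℝ) * l ^ 194 * m ≤ m' * (m / 4) * m := by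
      gcongr
      linarith
    have h6 : (m' : ℝ) * m * m ≤ m' * m' * m' := by gcongr
    have h7 : (4 : ℝ) * m' ≤ m' ^ 3 := by nlinarith [sq_nonneg ((m' : ℝ) - 2)]
    have h9 : (m' : ℝ) ^ 3 = m' * m' * m' := by ring
    linarith
  refine ⟨by exact_mod_cast hm'm, ?_⟩
  have h5 : (m' : ℝ) * l ^ 194 ≤ 2 * m * m := by
    have : l ^ 194 ≤ (m : ℝ) := by linarith [pow_pos (by linarith : 0 < l) 194]
    gcongr
  have h6 : (m' : ℝ) ^ 3 ≤ (2 * m) ^ 3 := by gcongr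
  have h7 : (n : ℝ) ≤ (m : ℝ) ^ 4 := by
    have h8 : (1000 : ℝ) * m ^ 3 ≤ m * m ^ 3 := by gcongr; linarith
    have h9 : (m : ℝ) * m * 1 ≤ m * m * m := by gcongr; linarith
    nlinarith
  exact_mod_cast h7

theorem not_dvd_of_row (h : SolPair n m n' m') {p : ℕ} (hp : p.Prime)
    (hpl : n - n' + m' < p) (h1 : n % p < m) (h2 : n % p < n - n') : False := by
  have := h.row_lt
  have := h.le_left
  have := h.le_right
  obtain ⟨i, hi1, hi2, j, rfl⟩ := h.exists_dvd_of_row hp h2 (by omega)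
  have h3 := Nat.div_add_mod n p
  have h4 : j < n / p := by
    by_contra! hcon
    have := Nat.mul_le_mul_left p hcon
    omega
  have h5 := Nat.mul_le_mul_left p (Nat.succ_le_of_lt h4)
  rw [Nat.succ_eq_add_one, mul_add] at h5
  omega

theorem not_dvd_of_diff (h : SolPair n m n' m') {p : ℕ} (hp : p.Prime)
    (hpl : 8 * (n - m - m) < p)
    (hr : 4 * ((n - m) % p) < (n - m) - (n' - m')) : False := by
  have := h.row_lt
  have := h.lt
  have := h.le_left
  have := h.le_right
  have h3 := Nat.div_add_mod (n - m) p
  rcases h.exists_dvd_of_diff hp (by omega) with ⟨i, hi1, hi2, j, rfl⟩ | ⟨i, hi1, hi2, j, rfl⟩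
  · have h4 : (p : ℤ) ∣ (n : ℤ) - (p * j : ℕ) - (n - 2 * (p * ((n - m) / p) : ℕ)) := by
      push_cast
      exact ⟨2 * (((n - m) / p : ℕ) : ℤ) - j, by push_cast; ring⟩
    have h5 := Int.eq_zero_of_abs_lt_dvd h4 (by rw [abs_lt]; constructor <;> omega)
    omega
  · have h4 : (p : ℤ) ∣ ((p * ((n - m) / p) : ℕ) : ℤ) - (p * j : ℕ) := by
      push_cast
      exact ⟨(((n - m) / p : ℕ) : ℤ) - j, by push_cast; ring⟩
    have h5 := Int.eq_zero_of_abs_lt_dvd h4 (by rw [abs_lt]; constructor <;> omega)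
    omega

theorem sin_sq_le_of_mod (h : SolPair n m n' m') {p : ℕ} (hp : p.Prime)
    (hpl : 10 * ((n - m) - (n' - m')) ≤ p)
    (hr : (n - m) % p < (n - m) - (n' - m')) :
    Real.sin (Real.pi * ((m : ℝ) / p)) ^ 2 ≤ 1 / 10 := by
  have := h.row_lt
  have := h.lt
  have := h.le_left
  have := h.le_right
  have h3 := Nat.div_add_mod (n - m) p
  rcases h.exists_dvd_of_diff hp (by omega) with ⟨i, hi1, hi2, j, rfl⟩ | ⟨i, hi1, hi2, j, rfl⟩
  · refine sin_sq_le_of_dvd (z := ((p * j : ℕ) : ℤ) - (p * ((n - m) / p) : ℕ)) hp.pos ?_ ?_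
    · push_cast
      exact ⟨(j : ℤ) - ((n - m) / p : ℕ), by push_cast; ring⟩
    · have : |(m : ℤ) - (((p * j : ℕ) : ℤ) - (p * ((n - m) / p) : ℕ))|
          ≤ ((n - m) - (n' - m') : ℕ) := by rw [abs_le]; constructor <;> omega
      omega
  · refine sin_sq_le_of_dvd (z := ((p * j : ℕ) : ℤ)) hp.pos
      (by push_cast; exact dvd_mul_right _ _) ?_
    have : |(m : ℤ) - ((p * j : ℕ) : ℤ)| ≤ ((n - m) - (n' - m') : ℕ) := by
      rw [abs_le]; constructor <;> omega
    omega

end SolPair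

theorem eventually_row_sub_mul_lt :
    ∀ᶠ n : ℕ in Filter.atTop, ∀ m n' m' : ℕ, SolPair n m n' m' → ∀ u : ℝ, u ^ 10 = m →
      Real.log n ^ 2000 ≤ u → (m' : ℝ) - m ≤ u ^ 9 →
      (n : ℝ) - n' < m' * Real.log n ^ 194 → ((n : ℝ) - n') * Real.log n ^ 176 < m := by
  filter_upwards [eventually_exists_prime_mod_lt (ε := 1 / 6) (by norm_num) 195,
    eventually_rpow_log_le 30,
    tendsto_log_natCast_atTop.eventually (Filter.eventually_ge_atTop (1000 : ℝ))]
    with n hdet hlog hl m n' m' h u hu hlu hE hD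
  by_contra! hDm
  obtain ⟨l, hld⟩ : ∃ l, l = Real.log n := ⟨_, rfl⟩
  have hsub := h.sub_mul_le
  rw [← hld] at hdet hl hlu hD hDm hsub
  obtain ⟨hm'm, hnm⟩ := h.row_le_pow_four hu hl hlu hE hD
  have hl0 : 0 < l := by linarith
  have hu1 : 1000 ≤ u := hl.trans ((le_self_pow₀ (by linarith) (by norm_num)).trans hlu)
  have hu0 : 0 < u := by linarith
  have hrow := h.row_lt
  have hrow' : (n' : ℝ) < n := by exact_mod_cast hrow
  have hlt := h.lt
  have hlt' : (m : ℝ) < m' := by exact_mod_cast hlt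
  have hm'm' : (m' : ℝ) ≤ 2 * m := by exact_mod_cast hm'm
  have hm0 : (0 : ℝ) < m := by exact_mod_cast h.pos
  have hcast : ((n - n' + m' : ℕ) : ℝ) = n - n' + m' := by
    rw [Nat.cast_add, Nat.cast_sub hrow.le]
  have hpow : ∀ i j : ℕ, i ≤ j → l ^ i ≤ l ^ j := fun i j hij =>
    pow_le_pow_right₀ (by linarith) hij
  have hsum : (n : ℝ) - n' + m' ≤ 4 * m * l ^ 194 := by
    have h1 : (m' : ℝ) * l ^ 194 ≤ 2 * m * l ^ 194 := by gcongr
    have h2 : (m : ℝ) * 1 ≤ m * l ^ 194 := by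
      gcongr
      exact one_le_pow₀ (by linarith)
    linarith
  have hn : u ^ 11 ≤ n * l ^ 177 := by
    have h1 : ((n : ℝ) - n') * m * l ^ 176 ≤ n * (u ^ 9 * l) * l ^ 176 := by
      refine mul_le_mul_of_nonneg_right (hsub.trans ?_) (by positivity)
      gcongr
    have h2 : (m : ℝ) * m ≤ (n - n') * l ^ 176 * m := by gcongr
    have h3 : u ^ 9 * u ^ 11 ≤ u ^ 9 * (n * l ^ 177) := by
      calc u ^ 9 * u ^ 11 = u ^ 10 * u ^ 10 := by ring
        _ = (m : ℝ) * m := by rw [hu]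
        _ ≤ (n - n') * m * l ^ 176 := by linarith
        _ ≤ _ := h1
        _ = _ := by ring
    exact le_of_mul_le_mul_left h3 (by positivity)
  have hbig : 32 * m * l ^ 999 ≤ (n : ℝ) := by
    refine le_of_mul_le_mul_right (le_trans ?_ hn) (show 0 < l ^ 177 by positivity)
    calc 32 * m * l ^ 999 * l ^ 177 = m * (32 * l ^ 1176) := by ring
      _ ≤ m * (l * l ^ 1176) := by gcongr; linarith
      _ = m * l ^ 1177 := by ring
      _ ≤ m * u := by gcongr; exact (hpow _ _ (by norm_num)).trans hlu
      _ = u ^ 11 := by rw [← hu]; ring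
  obtain ⟨p, hp, h1⟩ := hdet (8 * (n - n' + m')) n (hld ▸ hlog _ (by
      refine hnm.trans ((Nat.pow_le_pow_left (show m ≤ 8 * (n - n' + m') by omega) 4).trans ?_)
      exact Nat.pow_le_pow_right (by omega) (by norm_num))) le_rfl (by
    rw [Nat.cast_mul, hcast]
    calc _ ≤ ((8 : ℕ) : ℝ) * (4 * m * l ^ 194) * l ^ (4 * 195 + 25) := by gcongr
      _ = 32 * m * l ^ 999 := by push_cast; ring
      _ ≤ n := hbig)
  obtain ⟨⟨hp1, hp2⟩, hpp⟩ := mem_primeBlock.1 hp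
  have hp2' : (p : ℝ) ≤ 32 * (n - n' + m') := by
    rw [← hcast]
    exact_mod_cast (by omega : p ≤ 32 * (n - n' + m'))
  have e1 : l ^ 195 = l * l ^ 194 := by ring
  refine h.not_dvd_of_row hpp (by omega) (natCast_lt_of_mul_lt (by positivity) h1 ?_)
    (natCast_lt_of_mul_lt (by positivity) h1 ?_)
  · rw [e1]
    have : (1000 : ℝ) * (m * l ^ 194) ≤ l * (m * l ^ 194) := by gcongr
    have : 0 ≤ m * l ^ 194 := by positivity
    linarith
  · rw [Nat.cast_sub hrow.le]
    have h2 : ((n : ℝ) - n') * 1 ≤ (n - n') * l ^ 194 := by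
      gcongr
      exact one_le_pow₀ (by linarith)
    have h3 : ((n : ℝ) - n') * l ^ 176 ≤ (n - n') * l ^ 194 := by
      gcongr
      · linarith
      · norm_num
    have h4 : (1000 : ℝ) * ((n - n') * l ^ 194) ≤ l * ((n - n') * l ^ 194) := by
      gcongr
    rw [e1]
    linarith

/-- When `m' - m` is small compared with `m`, the two solutions are very close. -/
theorem eventually_diff_pow_lt :
    ∀ᶠ n : ℕ in Filter.atTop, ∀ m n' m' : ℕ, SolPair n m n' m' → ∀ u : ℝ, u ^ 10 = m →
      Real.log n ^ 2000 ≤ u → (m' : ℝ) - m ≤ u ^ 9 →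
      (n : ℝ) - n' < m' * Real.log n ^ 194 → ((n - m) - (n' - m')) ^ 6 < m := by
  filter_upwards [eventually_exists_prime_mod_lt (ε := 1 / 6) (by norm_num) 30,
    eventually_exists_prime_mod (ε := 1 / 6) (by norm_num) 1,
    eventually_rpow_log_le 30, eventually_row_sub_mul_lt,
    tendsto_log_natCast_atTop.eventually (Filter.eventually_ge_atTop (1000 : ℝ))]
    with n hdet1 hdet hlog hrowm hl m n' m' h u hu hlu hE hD
  by_contra! hH
  have hDm := hrowm m n' m' h u hu hlu hE hD
  obtain ⟨l, hld⟩ : ∃ l, l = Real.log n := ⟨_, rfl⟩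
  rw [← hld] at hdet hdet1 hl hlu hD hDm
  obtain ⟨hm'm, hnm⟩ := h.row_le_pow_four hu hl hlu hE hD
  have hl0 : 0 < l := by linarith
  have hu1 : 1000 ≤ u := hl.trans ((le_self_pow₀ (by linarith) (by norm_num)).trans hlu)
  have hrow := h.row_lt
  have hlt := h.lt
  have hll := h.le_left
  have hlr := h.le_right
  obtain ⟨H, hHd⟩ : ∃ H, H = (n - m) - (n' - m') := ⟨_, rfl⟩
  rw [← hHd] at hH
  have hHr : (H : ℝ) = (n - n') + (m' - m) := by
    have : n + m' = H + n' + m := by omega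
    have : (n : ℝ) + m' = H + n' + m := by exact_mod_cast this
    linarith
  have hm0 : (0 : ℝ) < m := by exact_mod_cast h.pos
  have hpow : ∀ i j : ℕ, i ≤ j → l ^ i ≤ l ^ j := fun i j hij =>
    pow_le_pow_right₀ (by linarith) hij
  have hHm : H * l ^ 176 ≤ 2 * m := by
    have h1 : ((m' : ℝ) - m) * l ^ 176 ≤ u ^ 9 * u := by
      gcongr
      exact (hpow _ _ (by norm_num)).trans hlu
    rw [hHr, add_mul]
    rw [← pow_succ, hu] at h1
    linarith
  have hnH : n ≤ H ^ 24 := by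
    calc n ≤ m ^ 4 := hnm
      _ ≤ (H ^ 6) ^ 4 := Nat.pow_le_pow_left hH 4
      _ = _ := by ring
  have hH1 : 1 ≤ H := by omega
  have hlogP : ∀ P : ℕ, H ≤ P → l ^ ((2 : ℝ) / 3 + 1 / 6) ≤ Real.log P := fun P hP =>
    hld ▸ hlog P (hnH.trans ((Nat.pow_le_pow_left hP 24).trans
      (Nat.pow_le_pow_right (by omega) (by norm_num))))
  have hlm : (m : ℝ) ≤ (n - m : ℕ) := by exact_mod_cast (by omega : m ≤ n - m)
  rcases le_or_gt ((n - m - m : ℕ) : ℝ) (H * l ^ 29) with hv | hv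
  · obtain ⟨p, hp, h1⟩ := hdet1 (8 * (n - m - m)) (n - m) (hlogP _ (by omega)) (by omega) (by
      rw [Nat.cast_mul]
      calc _ ≤ ((8 : ℕ) : ℝ) * (H * l ^ 29) * l ^ (4 * 30 + 25) := by gcongr
        _ = 8 * (H * l ^ 174) := by push_cast; ring
        _ ≤ H * l ^ 176 / 2 := by
          have : 1000 * (H * l ^ 174) ≤ l * (H * l ^ 174) := by gcongr
          have h2 : 1 * (l * (H * l ^ 174)) ≤ l * (l * (H * l ^ 174)) := by gcongr; linarith
          have h3 : H * l ^ 176 = l * (l * (H * l ^ 174)) := by ring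
          have : 0 ≤ H * l ^ 174 := by positivity
          linarith
        _ ≤ _ := by linarith)
    obtain ⟨⟨hp1, hp2⟩, hpp⟩ := mem_primeBlock.1 hp
    have hp2' : (p : ℝ) ≤ 32 * (n - m - m : ℕ) := by
      exact_mod_cast (by omega : p ≤ 32 * (n - m - m))
    refine h.not_dvd_of_diff hpp (by omega) (hHd ▸ natCast_lt_of_mul_lt (y := 4 * p)
      (show 0 < l ^ 30 by positivity) ?_ ?_)
    · push_cast
      linarith
    · have : 1000 * (H * l ^ 29) ≤ l * (H * l ^ 29) := by gcongr
      have h3 : H * l ^ 30 = l * (H * l ^ 29) := by ring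
      have : 0 ≤ H * l ^ 29 := by positivity
      linarith
  · have hvr : ((n - m : ℕ) : ℝ) - m = (n - m - m : ℕ) := by
      rw [Nat.cast_sub (show m ≤ n - m by omega)]
    have h28 : 1000 * (H * l ^ 28) ≤ H * l ^ 29 := by
      have : 1000 * (H * l ^ 28) ≤ l * (H * l ^ 28) := by gcongr
      have h3 : H * l ^ 29 = l * (H * l ^ 28) := by ring
      linarith
    have h29 : H * l ^ 29 ≤ H * l ^ 176 := by
      gcongr
      · linarith
      · norm_num
    obtain ⟨p, hp, h1, h2⟩ := hdet (100 * H) (n - m) m (hlogP _ (by omega)) (by omega)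
      (by push_cast; nlinarith) (by
        rw [hvr]
        push_cast
        have : 0 ≤ H * l ^ 28 := by positivity
        linarith)
    obtain ⟨⟨hp1, hp2⟩, hpp⟩ := mem_primeBlock.1 hp
    have h3 := h.sin_sq_le_of_mod hpp (by omega) (hHd ▸ natCast_lt_of_mul_lt
      (show 0 < l ^ 1 by positivity) h1 (by
        have : (p : ℝ) ≤ 400 * H := by exact_mod_cast (by omega : p ≤ 400 * H)
        nlinarith [(Nat.cast_nonneg H : (0 : ℝ) ≤ H)]))
    linarith

/-- The normalised binomial coefficients of `cos (π x) ^ (2 * K)`. -/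
noncomputable def binomWeight (K i : ℕ) : ℝ := (2 * K).choose i / 4 ^ K

theorem binomWeight_nonneg (K i : ℕ) : 0 ≤ binomWeight K i := by
  unfold binomWeight
  positivity

theorem binomWeight_self_pos (K : ℕ) : 0 < binomWeight K K := by
  have : 0 < (2 * K).choose K := Nat.choose_pos (by omega)
  unfold binomWeight
  positivity

theorem binomWeight_le_self (K i : ℕ) : binomWeight K i ≤ binomWeight K K := by
  unfold binomWeight
  have := Nat.choose_le_centralBinom i K
  rw [Nat.centralBinom_eq_two_mul_choose] at this
  gcongr

theorem binomWeight_succ_self (K : ℕ) :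
    binomWeight (K + 1) (K + 1) * (2 * K + 2) = binomWeight K K * (2 * K + 1) := by
  have h := Nat.succ_mul_centralBinom_succ K
  rw [Nat.centralBinom_eq_two_mul_choose, Nat.centralBinom_eq_two_mul_choose] at h
  have h' : ((K : ℝ) + 1) * (2 * (K + 1)).choose (K + 1) =
      2 * (2 * K + 1) * (2 * K).choose K := by exact_mod_cast h
  unfold binomWeight
  rw [pow_succ]
  field_simp
  linarith

theorem binomWeight_self_sq_le (K : ℕ) : (2 * K + 1) * binomWeight K K ^ 2 ≤ 1 := by
  induction K with
  | zero => simp [binomWeight]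
  | succ K ih =>
    have h := binomWeight_succ_self K
    have h1 : binomWeight (K + 1) (K + 1) = binomWeight K K * (2 * K + 1) / (2 * K + 2) := by
      rw [← h]
      field_simp
    rw [h1]
    push_cast
    rw [div_pow, mul_div_assoc', div_le_one (by positivity)]
    calc (2 * ((K : ℝ) + 1) + 1) * (binomWeight K K * (2 * K + 1)) ^ 2
        = (2 * (K : ℝ) + 3) * (2 * K + 1) * ((2 * K + 1) * binomWeight K K ^ 2) := by ring
      _ ≤ (2 * (K : ℝ) + 3) * (2 * K + 1) * 1 := by gcongr
      _ ≤ _ := by linarith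

theorem one_le_mul_binomWeight_self_sq {K : ℕ} (hK : 1 ≤ K) :
    1 ≤ 4 * K * binomWeight K K ^ 2 := by
  induction K, hK using Nat.le_induction with
  | base => norm_num [binomWeight]
  | succ K hK ih =>
    have h := binomWeight_succ_self K
    have h1 : binomWeight (K + 1) (K + 1) = binomWeight K K * (2 * K + 1) / (2 * K + 2) := by
      rw [← h]
      field_simp
    have hK' : (1 : ℝ) ≤ K := by exact_mod_cast hK
    rw [h1]
    push_cast
    rw [div_pow, mul_div_assoc', one_le_div (by positivity)]
    have h2 : 0 ≤ (4 * K * binomWeight K K ^ 2 - 1) * ((2 * K + 1) ^ 2 * (K + 1)) :=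
      mul_nonneg (by linarith) (by positivity)
    have h3 : 0 ≤ binomWeight K K ^ 2 := sq_nonneg _
    refine le_of_mul_le_mul_left ?_ (show (0 : ℝ) < K by linarith)
    nlinarith

theorem binomWeight_self_le (J : ℕ) (hJ : 1 ≤ J) :
    binomWeight J J ≤ 2 * binomWeight (2 * J) (2 * J) := by
  have h1 := binomWeight_self_sq_le J
  have h2 := one_le_mul_binomWeight_self_sq (show 1 ≤ 2 * J by omega)
  push_cast at h2
  have h3 := binomWeight_self_pos (2 * J)
  have hJ' : (1 : ℝ) ≤ J := by exact_mod_cast hJ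
  refine abs_le_of_sq_le_sq' ?_ (by positivity) |>.2
  refine le_of_mul_le_mul_left ?_ (show (0 : ℝ) < 2 * J + 1 by linarith)
  nlinarith [sq_nonneg (binomWeight (2 * J) (2 * J))]

theorem sum_binomWeight (K : ℕ) : ∑ i ∈ range (2 * K + 1), binomWeight K i = 1 :=
  sum_choose_two_mul_div K

theorem cos_pow_eq_sum (K : ℕ) (z : ℝ) : Real.cos (Real.pi * z) ^ (2 * K) =
    ∑ i ∈ range (2 * K + 1), binomWeight K i * Real.cos (2 * Real.pi * (((i : ℤ) - K : ℤ) * z)) := by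
  have h := congrArg Complex.re (cos_pi_mul_pow_two_mul z K)
  rw [Complex.ofReal_re, Complex.re_sum] at h
  rw [h]
  refine sum_congr rfl fun i _ => ?_
  rw [Complex.re_ofReal_mul, e_apply, Complex.exp_ofReal_mul_I_re]
  rfl

/-- A smooth approximation to the function equal to `1 / 2` on `(0, 1)`. -/
noncomputable def smoothStep (K : ℕ) (x : ℝ) : ℝ :=
  x + ∑ i ∈ (range (2 * K + 1)).erase K, binomWeight K i / binomWeight K K *
    (Real.sin (2 * Real.pi * (((i : ℤ) - K : ℤ) * x)) / (2 * Real.pi * ((i : ℤ) - K : ℤ)))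

theorem hasDerivAt_smoothStep (K : ℕ) (x : ℝ) :
    HasDerivAt (smoothStep K) (Real.cos (Real.pi * x) ^ (2 * K) / binomWeight K K) x := by
  have h : ∀ i ∈ (range (2 * K + 1)).erase K, HasDerivAt
      (fun x : ℝ => binomWeight K i / binomWeight K K *
        (Real.sin (2 * Real.pi * (((i : ℤ) - K : ℤ) * x)) / (2 * Real.pi * ((i : ℤ) - K : ℤ))))
      (binomWeight K i / binomWeight K K * Real.cos (2 * Real.pi * (((i : ℤ) - K : ℤ) * x))) x := by
    intro i hi
    have hne : (((i : ℤ) - K : ℤ) : ℝ) ≠ 0 := by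
      have := (mem_erase.1 hi).1
      exact_mod_cast (by omega : (i : ℤ) - K ≠ 0)
    have h1 := (((hasDerivAt_id x).const_mul (((i : ℤ) - K : ℤ) : ℝ)).const_mul
      (2 * Real.pi)).sin.div_const (2 * Real.pi * ((i : ℤ) - K : ℤ))
    convert! h1.const_mul (binomWeight K i / binomWeight K K) using 2
    have := Real.pi_pos
    simp only [id]
    field_simp
  convert! (hasDerivAt_id x).add (HasDerivAt.fun_sum h) using 1
  rw [cos_pow_eq_sum, ← add_sum_erase _ _ (mem_range.2 (by omega : K < 2 * K + 1)), add_div,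
    sum_div]
  congr 1
  · simp [(binomWeight_self_pos K).ne']
  · exact sum_congr rfl fun i _ => by ring

theorem monotone_smoothStep (K : ℕ) : Monotone (smoothStep K) :=
  monotone_of_hasDerivAt_nonneg (hasDerivAt_smoothStep K) fun x => by
    have := binomWeight_self_pos K
    have : 0 ≤ Real.cos (Real.pi * x) ^ (2 * K) := (even_two_mul K).pow_nonneg _
    simp only [Pi.zero_apply]
    positivity

theorem smoothStep_zero (K : ℕ) : smoothStep K 0 = 0 := by
  simp [smoothStep]

theorem smoothStep_one_sub (K : ℕ) (x : ℝ) : smoothStep K (1 - x) = 1 - smoothStep K x := by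
  have : ∀ k : ℤ, Real.sin (2 * Real.pi * (k * (1 - x))) = -Real.sin (2 * Real.pi * (k * x)) := by
    intro k
    rw [← Real.sin_neg, ← Real.sin_add_int_mul_two_pi (-(2 * Real.pi * (k * x))) k]
    congr 1
    ring
  simp only [smoothStep, this, neg_div, mul_neg, sum_neg_distrib]
  ring

theorem smoothStep_half (K : ℕ) : smoothStep K (1 / 2) = 1 / 2 := by
  have := smoothStep_one_sub K (1 / 2)
  norm_num at this ⊢
  linarith

theorem abs_smoothStep_sub_half_le {J : ℕ} (hJ : 1 ≤ J) {x : ℝ} (hx0 : 0 ≤ x) (hx1 : x ≤ 1) :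
    |smoothStep (2 * J) x - 1 / 2| ≤ Real.cos (Real.pi * x) ^ (2 * J) := by
  wlog hx : x ≤ 1 / 2 generalizing x
  · have := this (x := 1 - x) (by linarith) (by linarith) (by linarith)
    rw [smoothStep_one_sub, mul_one_sub, Real.cos_pi_sub, (even_two_mul J).neg_pow,
      abs_sub_comm] at this
    convert! this using 2
    ring
  have hw := binomWeight_self_le J hJ
  have hJ0 := binomWeight_self_pos J
  have hK0 := binomWeight_self_pos (2 * J)
  obtain ⟨A, hA⟩ : ∃ A, A = Real.cos (Real.pi * x) ^ (2 * J) := ⟨_, rfl⟩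
  have hA0 : 0 ≤ A := hA ▸ (even_two_mul J).pow_nonneg _
  rw [← hA, abs_le]
  have h1 := monotone_smoothStep (2 * J) hx
  rw [smoothStep_half] at h1
  refine ⟨?_, by linarith⟩
  obtain ⟨B, hB⟩ : ∃ B, B = A * (binomWeight J J / binomWeight (2 * J) (2 * J)) := ⟨_, rfl⟩
  have hB0 : 0 ≤ B := hB ▸ by positivity
  have hBA : B ≤ A * 2 := hB ▸ mul_le_mul_of_nonneg_left ((div_le_iff₀ hK0).2 hw) hA0
  have hder : ∀ t, HasDerivAt (fun t => B * smoothStep J t - smoothStep (2 * J) t)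
      (B * (Real.cos (Real.pi * t) ^ (2 * J) / binomWeight J J) -
        Real.cos (Real.pi * t) ^ (2 * (2 * J)) / binomWeight (2 * J) (2 * J)) t := fun t =>
    ((hasDerivAt_smoothStep J t).const_mul B).sub (hasDerivAt_smoothStep (2 * J) t)
  have hmono : MonotoneOn (fun t => B * smoothStep J t - smoothStep (2 * J) t)
      (Set.Icc x (1 / 2)) := by
    refine monotoneOn_of_hasDerivWithinAt_nonneg (convex_Icc _ _)
      (fun t _ => (hder t).continuousAt.continuousWithinAt)
      (fun t _ => (hder t).hasDerivWithinAt) fun t ht => ?_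
    have ht' := interior_subset ht
    have hcos : Real.cos (Real.pi * t) ^ (2 * J) ≤ A := by
      rw [hA]
      have := Real.pi_pos
      refine pow_le_pow_left₀ (Real.cos_nonneg_of_mem_Icc ⟨?_, ?_⟩)
        (Real.cos_le_cos_of_nonneg_of_le_pi
        ?_ ?_ ?_) _ <;> nlinarith [ht'.1, ht'.2]
    have hc0 : 0 ≤ Real.cos (Real.pi * t) ^ (2 * J) := (even_two_mul J).pow_nonneg _
    have e1 : B * (Real.cos (Real.pi * t) ^ (2 * J) / binomWeight J J) =
        A * Real.cos (Real.pi * t) ^ (2 * J) / binomWeight (2 * J) (2 * J) := by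
      rw [hB]
      field_simp
    rw [e1, ← sub_div, two_mul (2 * J), pow_add, ← sub_mul]
    exact div_nonneg (mul_nonneg (by linarith) hc0) hK0.le
  have h2 := hmono ⟨le_rfl, hx⟩ ⟨hx, le_rfl⟩ hx
  have h3 := monotone_smoothStep J hx0
  simp only [smoothStep_half] at h2
  rw [smoothStep_zero] at h3
  have h4 := mul_nonneg hB0 h3
  linarith

theorem binomWeight_succ_mul (K : ℕ) : binomWeight K (K + 1) * (K + 1) = binomWeight K K * K := by
  have h := Nat.choose_succ_right_eq (2 * K) K
  rw [show 2 * K - K = K by omega] at h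
  have h' : ((2 * K).choose (K + 1) : ℝ) * (K + 1) = (2 * K).choose K * K := by exact_mod_cast h
  unfold binomWeight
  rw [div_mul_eq_mul_div, h', div_mul_eq_mul_div]

theorem binomWeight_pred {K : ℕ} (hK : 1 ≤ K) : binomWeight K (K - 1) = binomWeight K (K + 1) := by
  unfold binomWeight
  rw [← Nat.choose_symm (show K + 1 ≤ 2 * K by omega), show 2 * K - (K + 1) = K - 1 by omega]

/-- The Fourier coefficients of `1 / 2 - x` after smoothing. -/
noncomputable def sawCoeff (K i : ℕ) : ℝ :=
  binomWeight K i / binomWeight K K / (2 * Real.pi * ((i : ℤ) - K : ℤ))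

theorem sawCoeff_pred {K : ℕ} (hK : 1 ≤ K) : sawCoeff K (K - 1) = -sawCoeff K (K + 1) := by
  rw [sawCoeff, sawCoeff, binomWeight_pred hK, show ((K - 1 : ℕ) : ℤ) - K = -1 by omega,
    show ((K + 1 : ℕ) : ℤ) - K = 1 by omega]
  push_cast
  rw [mul_neg, div_neg]

theorem abs_sawCoeff_le (K i : ℕ) : |sawCoeff K i| ≤ 1 := by
  have hK := binomWeight_self_pos K
  rcases eq_or_ne ((i : ℤ) - K) 0 with h | h
  · simp [sawCoeff, h]
  have h1 : (1 : ℝ) ≤ |(((i : ℤ) - K : ℤ) : ℝ)| := by exact_mod_cast Int.one_le_abs h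
  rw [sawCoeff, abs_div, abs_mul, abs_of_pos Real.two_pi_pos,
    abs_of_nonneg (div_nonneg (binomWeight_nonneg K i) hK.le), div_le_one (by positivity)]
  have h2 : binomWeight K i / binomWeight K K ≤ 1 :=
    (div_le_one hK).2 (binomWeight_le_self K i)
  nlinarith [Real.pi_gt_three]

theorem fract_sub_half_eq (K : ℕ) (y : ℝ) : Int.fract y - 1 / 2 =
    smoothStep K (Int.fract y) - 1 / 2 - ∑ i ∈ (range (2 * K + 1)).erase K,
      sawCoeff K i * Real.sin (2 * Real.pi * (((i : ℤ) - K : ℤ) * y)) := by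
  have : ∀ i ∈ (range (2 * K + 1)).erase K,
      sawCoeff K i * Real.sin (2 * Real.pi * (((i : ℤ) - K : ℤ) * y)) =
      binomWeight K i / binomWeight K K * (Real.sin (2 * Real.pi * (((i : ℤ) - K : ℤ) *
        Int.fract y)) / (2 * Real.pi * ((i : ℤ) - K : ℤ))) := by
    intro i _
    rw [← Real.sin_sub_int_mul_two_pi (2 * Real.pi * (((i : ℤ) - K : ℤ) * y))
      (((i : ℤ) - K) * ⌊y⌋), sawCoeff, Int.fract]
    rw [div_mul_eq_mul_div, mul_div_assoc]
    congr 3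
    push_cast
    ring
  rw [sum_congr rfl this, smoothStep]
  ring

variable {ι : Type*} {S : Finset ι} {w x y : ι → ℝ} {M η : ℝ}

theorem abs_sum_smoothStep_mul_le {J : ℕ} (hJ : 1 ≤ J) (hw : ∀ s ∈ S, 0 ≤ w s)
    (hM : ∑ s ∈ S, w s = M) (hM0 : 0 ≤ η * M)
    (h : ∀ k : ℤ, |k| ≤ J → k ≠ 0 → |∑ s ∈ S, w s * Real.cos (2 * Real.pi * (k * y s))| ≤ η * M) :
    |∑ s ∈ S, w s * ((smoothStep (2 * J) (Int.fract (y s)) - 1 / 2) *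
      Real.sin (2 * Real.pi * x s))| ≤ binomWeight J J * M + η * M := by
  have h1 : ∀ s ∈ S, |w s * ((smoothStep (2 * J) (Int.fract (y s)) - 1 / 2) *
      Real.sin (2 * Real.pi * x s))| ≤ w s * Real.cos (Real.pi * y s) ^ (2 * J) := by
    intro s hs
    rw [abs_mul, abs_mul, abs_of_nonneg (hw s hs)]
    refine mul_le_mul_of_nonneg_left ?_ (hw s hs)
    have h2 := abs_smoothStep_sub_half_le hJ (Int.fract_nonneg (y s)) (Int.fract_lt_one _).le
    have h3 : Real.cos (Real.pi * Int.fract (y s)) ^ (2 * J) =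
        Real.cos (Real.pi * y s) ^ (2 * J) := by
      rw [cos_pow_eq_sum, cos_pow_eq_sum]
      refine sum_congr rfl fun i _ => ?_
      rw [← Real.cos_sub_int_mul_two_pi (2 * Real.pi * (((i : ℤ) - J : ℤ) * y s))
        (((i : ℤ) - J) * ⌊y s⌋), Int.fract]
      congr 2
      push_cast
      ring
    rw [h3] at h2
    calc _ ≤ Real.cos (Real.pi * y s) ^ (2 * J) * 1 := by
          exact mul_le_mul h2 (Real.abs_sin_le_one _) (abs_nonneg _)
            ((even_two_mul J).pow_nonneg _)
      _ = _ := mul_one _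
  refine (abs_sum_le_sum_abs _ _).trans ((sum_le_sum h1).trans ?_)
  have h4 : ∑ s ∈ S, w s * Real.cos (Real.pi * y s) ^ (2 * J) =
      ∑ i ∈ range (2 * J + 1), binomWeight J i *
        ∑ s ∈ S, w s * Real.cos (2 * Real.pi * (((i : ℤ) - J : ℤ) * y s)) := by
    simp_rw [cos_pow_eq_sum, mul_sum]
    rw [sum_comm]
    exact sum_congr rfl fun i _ => sum_congr rfl fun s _ => by ring
  rw [h4, ← add_sum_erase _ _ (mem_range.2 (by omega : J < 2 * J + 1))]
  refine add_le_add ?_ ?_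
  · simp [hM]
  · calc _ ≤ ∑ i ∈ (range (2 * J + 1)).erase J, binomWeight J i * (η * M) := by
          refine sum_le_sum fun i hi => mul_le_mul_of_nonneg_left ?_ (binomWeight_nonneg J i)
          have hi' := mem_erase.1 hi
          have := mem_range.1 hi'.2
          exact (le_abs_self _).trans (h _ (abs_le.2 (by omega)) (by omega))
      _ = (∑ i ∈ (range (2 * J + 1)).erase J, binomWeight J i) * (η * M) := by rw [sum_mul]
      _ ≤ 1 * (η * M) := by
          refine mul_le_mul_of_nonneg_right ?_ hM0
          rw [← sum_binomWeight J]
          exact sum_le_sum_of_subset_of_nonneg (erase_subset _ _)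
            fun i _ _ => binomWeight_nonneg J i
      _ = _ := one_mul _

theorem abs_sum_sawCoeff_mul_sub_le {K : ℕ} (hK : 1 ≤ K) (T : ℤ → ℝ) {B : ℝ}
    (h : ∀ k : ℤ, |k| ≤ K → k ≠ 1 → |T k| ≤ B) :
    |∑ i ∈ (range (2 * K + 1)).erase K, sawCoeff K i * ((T ((i : ℤ) - K) - T (-((i : ℤ) - K))) / 2) -
      sawCoeff K (K + 1) * T 1| ≤ 2 * K * B := by
  have hB : 0 ≤ B := (abs_nonneg _).trans (h 0 (by simp) (by norm_num))
  have hm1 : |T (-1)| ≤ B := h (-1) (by simp; omega) (by norm_num)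
  have e1 : sawCoeff K (K + 1) * T 1 = ∑ i ∈ (range (2 * K + 1)).erase K,
      ((if i = K + 1 then sawCoeff K (K + 1) * T 1 / 2 else 0) +
        (if i = K - 1 then sawCoeff K (K + 1) * T 1 / 2 else 0)) := by
    rw [sum_add_distrib, sum_ite_eq', sum_ite_eq', if_pos, if_pos]
    · ring
    · simp; omega
    · simp; omega
  rw [e1, ← sum_sub_distrib]
  have hhalf : |sawCoeff K (K + 1) * T (-1) / 2| ≤ B := by
    rw [abs_div, abs_mul, abs_two]
    have := mul_le_mul (abs_sawCoeff_le K (K + 1)) hm1 (abs_nonneg _) zero_le_one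
    linarith
  have hterm : ∀ i ∈ (range (2 * K + 1)).erase K,
      |sawCoeff K i * ((T ((i : ℤ) - K) - T (-((i : ℤ) - K))) / 2) -
        ((if i = K + 1 then sawCoeff K (K + 1) * T 1 / 2 else 0) +
          (if i = K - 1 then sawCoeff K (K + 1) * T 1 / 2 else 0))| ≤ B := by
    intro i hi
    have hi' := mem_erase.1 hi
    have hi2 := mem_range.1 hi'.2
    by_cases h1 : i = K + 1
    · rw [if_pos h1, if_neg (by omega), h1, show ((K + 1 : ℕ) : ℤ) - K = 1 by omega,
        show (sawCoeff K (K + 1) * ((T 1 - T (-1)) / 2) -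
          (sawCoeff K (K + 1) * T 1 / 2 + 0)) = -(sawCoeff K (K + 1) * T (-1) / 2) by ring, abs_neg]
      exact hhalf
    by_cases h2 : i = K - 1
    · rw [if_neg h1, if_pos h2, h2, show ((K - 1 : ℕ) : ℤ) - K = -1 by omega, neg_neg,
        sawCoeff_pred hK, show (-sawCoeff K (K + 1) * ((T (-1) - T 1) / 2) -
          (0 + sawCoeff K (K + 1) * T 1 / 2)) = -(sawCoeff K (K + 1) * T (-1) / 2) by ring, abs_neg]
      exact hhalf
    rw [if_neg h1, if_neg h2, add_zero, sub_zero, abs_mul]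
    have h3 := h ((i : ℤ) - K) (abs_le.2 (by omega)) (by omega)
    have h4 := h (-((i : ℤ) - K)) (abs_le.2 (by omega)) (by omega)
    have h5 : |(T ((i : ℤ) - K) - T (-((i : ℤ) - K))) / 2| ≤ B := by
      rw [abs_div, abs_two]
      have := abs_sub (T ((i : ℤ) - K)) (T (-((i : ℤ) - K)))
      linarith
    calc _ ≤ 1 * B := mul_le_mul (abs_sawCoeff_le K i) h5 (abs_nonneg _) zero_le_one
      _ = B := one_mul B
  refine (abs_sum_le_sum_abs _ _).trans ((sum_le_sum hterm).trans ?_)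
  rw [sum_const, card_erase_of_mem (mem_range.2 (by omega)), card_range, nsmul_eq_mul,
    show 2 * K + 1 - 1 = 2 * K by omega]
  push_cast
  exact le_rfl

/-- The correlation of the sawtooth function with a sine wave of another frequency. -/
theorem abs_sum_fract_mul_sin_add_le {J : ℕ} (hJ : 1 ≤ J) (hw : ∀ s ∈ S, 0 ≤ w s)
    (hM : ∑ s ∈ S, w s = M)
    (h1 : ∀ k : ℤ, |k| ≤ (2 * J : ℕ) → k ≠ 1 →
      |∑ s ∈ S, w s * Real.cos (2 * Real.pi * (k * y s - x s))| ≤ η * M)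
    (h2 : ∀ k : ℤ, |k| ≤ (2 * J : ℕ) → k ≠ 0 →
      |∑ s ∈ S, w s * Real.cos (2 * Real.pi * (k * y s))| ≤ η * M) :
    |∑ s ∈ S, w s * ((Int.fract (y s) - 1 / 2) * Real.sin (2 * Real.pi * x s)) +
      sawCoeff (2 * J) (2 * J + 1) * ∑ s ∈ S, w s * Real.cos (2 * Real.pi * (y s - x s))| ≤
      (binomWeight J J + (4 * J + 1) * η) * M := by
  have hM0 : 0 ≤ η * M := (abs_nonneg _).trans (h1 0 (by simp) (by norm_num))
  obtain ⟨T, hT⟩ : ∃ T : ℤ → ℝ, T = fun k : ℤ =>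
    ∑ s ∈ S, w s * Real.cos (2 * Real.pi * (k * y s - x s)) := ⟨_, rfl⟩
  have hT1 : ∑ s ∈ S, w s * Real.cos (2 * Real.pi * (y s - x s)) = T 1 := by
    rw [hT]
    simp
  have h3 := abs_sum_sawCoeff_mul_sub_le (show 1 ≤ 2 * J by omega) T (B := η * M)
    (fun k hk hk1 => hT ▸ h1 k hk hk1)
  have h4 := abs_sum_smoothStep_mul_le (x := x) hJ hw hM hM0
    (fun k hk hk0 => h2 k (hk.trans (by push_cast; omega)) hk0)
  have e1 : ∀ k : ℤ, (T k - T (-k)) / 2 =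
      ∑ s ∈ S, w s * (Real.sin (2 * Real.pi * (k * y s)) * Real.sin (2 * Real.pi * x s)) := by
    intro k
    rw [hT, ← sum_sub_distrib, sum_div]
    refine sum_congr rfl fun s _ => ?_
    rw [← mul_sub, show 2 * Real.pi * (((-k : ℤ) : ℝ) * y s - x s) =
      -(2 * Real.pi * (k * y s) + 2 * Real.pi * x s) by push_cast; ring, Real.cos_neg,
      mul_sub (2 * Real.pi), Real.cos_sub, Real.cos_add]
    ring
  have e2 : ∑ s ∈ S, w s * ((Int.fract (y s) - 1 / 2) * Real.sin (2 * Real.pi * x s)) =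
      ∑ s ∈ S, w s * ((smoothStep (2 * J) (Int.fract (y s)) - 1 / 2) *
        Real.sin (2 * Real.pi * x s)) -
      ∑ i ∈ (range (2 * (2 * J) + 1)).erase (2 * J), sawCoeff (2 * J) i *
        ((T ((i : ℤ) - (2 * J : ℕ)) - T (-((i : ℤ) - (2 * J : ℕ)))) / 2) := by
    simp_rw [e1, mul_sum]
    rw [sum_comm, ← sum_sub_distrib]
    refine sum_congr rfl fun s _ => ?_
    rw [fract_sub_half_eq (2 * J) (y s), sub_mul, mul_sub, sum_mul, mul_sum]
    congr 1
    exact sum_congr rfl fun i _ => by ring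
  rw [hT1, e2]
  push_cast at h3 h4 ⊢
  rw [abs_le] at *
  constructor <;> linarith [h3.1, h3.2, h4.1, h4.2]

end Singmaster

namespace Singmaster

open Finset

theorem eventually_abs_sum_cos_le :
    ∀ᶠ n : ℕ in Filter.atTop, ∀ P : ℕ,
      Real.log n ^ ((2 : ℝ) / 3 + 1 / 6) ≤ Real.log P → P ≤ n → ∀ T : ℝ,
      P * Real.log n ^ 26 ≤ |T| → |T| ≤ (n : ℝ) ^ 2 →
      |∑ p ∈ primeBlock P, Real.log p * Real.cos (2 * Real.pi * (T / p))| ≤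
        1 / 10 ^ 7 * ∑ p ∈ primeBlock P, Real.log p := by
  filter_upwards [eventually_norm_sum_primeBlock_le (ε := 1 / 6) (by norm_num) 3,
    exists_log_le_imp (ε := 1 / 6) (by norm_num) eventually_le_sum_log_primeBlock,
    tendsto_log_natCast_atTop.eventually (Filter.eventually_ge_atTop (1000 : ℝ))]
    with n h1 h2 h3 P hP hPn T hT hTn
  have h4 := (Complex.abs_re_le_norm _).trans (h1 P hP hPn T hT hTn)
  rw [Complex.re_sum] at h4
  have e1 : ∀ p ∈ primeBlock P, ((Real.log p : ℂ) * e (T / p)).re =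
      Real.log p * Real.cos (2 * Real.pi * (T / p)) := by
    intro p _
    rw [Complex.re_ofReal_mul, e_apply, Complex.exp_ofReal_mul_I_re]
  rw [sum_congr rfl e1] at h4
  refine h4.trans ?_
  have h5 : (10 : ℝ) ^ 7 ≤ Real.log n ^ 3 := by
    calc (10 : ℝ) ^ 7 ≤ 1000 ^ 3 := by norm_num
      _ ≤ _ := by gcongr
  calc (P : ℝ) / Real.log n ^ 3 ≤ (P : ℝ) / 10 ^ 7 := by gcongr
    _ = 1 / 10 ^ 7 * (P : ℝ) := by ring
    _ ≤ _ := mul_le_mul_of_nonneg_left (h2 P hP) (by positivity)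

theorem binomWeight_self_lt : binomWeight 2000 2000 ≤ 1 / 60 := by
  have h := binomWeight_self_sq_le 2000
  push_cast at h
  refine (pow_le_pow_iff_left₀ (binomWeight_nonneg _ _) (by norm_num) two_ne_zero).1 ?_
  linarith

theorem le_sawCoeff : 15 / 100 ≤ sawCoeff 4000 4001 ∧ sawCoeff 4000 4001 ≤ 1 := by
  refine ⟨?_, (le_abs_self _).trans (abs_sawCoeff_le _ _)⟩
  have h := binomWeight_succ_mul 4000
  have h0 := binomWeight_self_pos 4000
  push_cast at h
  have h1 : binomWeight 4000 4001 / binomWeight 4000 4000 = 4000 / 4001 := by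
    rw [div_eq_div_iff h0.ne' (by norm_num)]
    linarith
  rw [sawCoeff, h1, show ((4001 : ℕ) : ℤ) - (4000 : ℕ) = 1 by norm_num, Int.cast_one, mul_one,
    le_div_iff₀ Real.two_pi_pos]
  have := Real.pi_lt_d2
  linarith

theorem le_abs_mul_sub {m N : ℕ} {b : ℝ} {k : ℤ} (hk : k ≠ 1) (hN : m ≤ N) (hb : b ≤ m) :
    b ≤ |(k : ℝ) * N - m| := by
  have hm : (0 : ℝ) ≤ m := Nat.cast_nonneg m
  have hN' : (m : ℝ) ≤ N := by exact_mod_cast hN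
  rcases le_or_gt k 0 with h | h
  · have hk' : (k : ℝ) ≤ 0 := by exact_mod_cast h
    rw [abs_of_nonpos (by nlinarith)]
    nlinarith
  · have hk' : (2 : ℝ) ≤ k := by exact_mod_cast (by omega : (2 : ℤ) ≤ k)
    exact le_trans (by nlinarith) (le_abs_self _)

theorem eventually_abs_sum_fract_le :
    ∀ᶠ n : ℕ in Filter.atTop, ∀ P : ℕ,
      Real.log n ^ ((2 : ℝ) / 3 + 1 / 6) ≤ Real.log P → P ≤ n → ∀ m N : ℕ, m ≤ N → N ≤ n →
      P * Real.log n ^ 26 ≤ m →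
      |∑ p ∈ primeBlock P, Real.log p *
          ((Int.fract ((N : ℝ) / p) - 1 / 2) * Real.sin (2 * Real.pi * ((m : ℝ) / p))) +
        sawCoeff 4000 4001 * ∑ p ∈ primeBlock P, Real.log p *
          Real.cos (2 * Real.pi * ((N : ℝ) / p - (m : ℝ) / p))| ≤
        1 / 50 * ∑ p ∈ primeBlock P, Real.log p := by
  filter_upwards [eventually_abs_sum_cos_le, Filter.eventually_ge_atTop 4001,
    tendsto_log_natCast_atTop.eventually (Filter.eventually_ge_atTop (1000 : ℝ))]
    with n h1 hn hl P hP hPn m N hN hNn hm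
  have hn' : (4001 : ℝ) ≤ n := by exact_mod_cast hn
  have hNn' : (N : ℝ) ≤ n := by exact_mod_cast hNn
  have hmN' : (m : ℝ) ≤ N := by exact_mod_cast hN
  have hm0 : (0 : ℝ) ≤ m := Nat.cast_nonneg m
  have hup : ∀ k : ℤ, |k| ≤ (2 * 2000 : ℕ) → |(k : ℝ) * N| ≤ 4000 * n := by
    intro k hk
    have hk' : |(k : ℝ)| ≤ 4000 := by exact_mod_cast hk
    rw [abs_mul, Nat.abs_cast]
    exact mul_le_mul hk' hNn' (Nat.cast_nonneg N) (by norm_num)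
  have h := abs_sum_fract_mul_sin_add_le (S := primeBlock P) (w := fun p : ℕ => Real.log p)
    (x := fun p : ℕ => (m : ℝ) / p) (y := fun p : ℕ => (N : ℝ) / p) (η := 1 / 10 ^ 7)
    (J := 2000) (by norm_num) (fun p _ => Real.log_natCast_nonneg p) rfl (fun k hk hk1 => by
      have h2 := h1 P hP hPn (k * N - m) (le_abs_mul_sub hk1 hN hm) (by
        refine (abs_sub _ _).trans ?_
        rw [Nat.abs_cast]
        nlinarith [hup k hk])
      simpa only [sub_div, mul_div_assoc] using h2) (fun k hk hk0 => by
      have h2 := h1 P hP hPn (k * N) (by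
        rw [abs_mul, Nat.abs_cast]
        have : (1 : ℝ) ≤ |(k : ℝ)| := by exact_mod_cast Int.one_le_abs hk0
        nlinarith) (by nlinarith [hup k hk])
      simpa only [sub_div, mul_div_assoc] using h2)
  refine h.trans (mul_le_mul_of_nonneg_right ?_
    (sum_nonneg fun p _ => Real.log_natCast_nonneg p))
  have := binomWeight_self_lt
  norm_num
  linarith

namespace SolPair

variable {n m n' m' : ℕ}

theorem fract_add_fract_sub (h : SolPair n m n' m') {p : ℕ} (hp : p.Prime) (hn : n < p ^ 2) :
    Int.fract ((m : ℝ) / p) + Int.fract (((n - m : ℕ) : ℝ) / p) - Int.fract ((n : ℝ) / p) =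
    Int.fract ((m' : ℝ) / p) + Int.fract (((n' - m' : ℕ) : ℝ) / p) -
      Int.fract ((n' : ℝ) / p) := by
  have hp0 : (0 : ℝ) < p := by exact_mod_cast hp.pos
  have := h.le_left
  have := h.le_right
  have h1 := mod_add_mod_eq hp (show m ≤ n by omega) hn
  have h2 := mod_add_mod_eq hp (show m' ≤ n' by omega) (h.row_lt.trans hn)
  rw [h.eq] at h1
  have h3 : m % p + (n - m) % p + n' % p = m' % p + (n' - m') % p + n % p := by omega
  have h4 : ((m % p : ℕ) : ℝ) + ((n - m) % p : ℕ) + (n' % p : ℕ) =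
      (m' % p : ℕ) + ((n' - m') % p : ℕ) + (n % p : ℕ) := by exact_mod_cast h3
  simp only [Int.fract_div_natCast_eq_div_natCast_mod]
  rw [← add_div, ← sub_div, ← add_div, ← sub_div]
  congr 1
  linarith

theorem lt_pow_of_le_sub (h : SolPair n m n' m') {u l : ℝ} (hld : l = Real.log n)
    (hu : u ^ 10 = m) (hl : 1000 ≤ l)
    (hlu : l ^ 2000 ≤ u) (hE : u ^ 9 ≤ (m' : ℝ) - m) (hD : (n : ℝ) - n' < m' * l ^ 194) :
    (n : ℝ) < u ^ 14 := by
  have hl1 : 1 ≤ l := by linarith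
  have hlu' : ∀ k ≤ 2000, l ^ k ≤ u := fun k hk => (pow_le_pow_right₀ hl1 hk).trans hlu
  have hu1 : 1000 ≤ u := hl.trans (by simpa using hlu' 1 (by norm_num))
  have hm0 : (0 : ℝ) < m := by exact_mod_cast h.pos
  have hcol : (m' : ℝ) ≤ 2 * m * l := hld ▸ h.col_le
  have hD' : (n : ℝ) - n' ≤ u ^ 11 * 2 := by
    calc (n : ℝ) - n' ≤ m' * l ^ 194 := hD.le
      _ ≤ 2 * m * l * l ^ 194 := by gcongr
      _ = 2 * m * l ^ 195 := by ring
      _ ≤ 2 * m * u := by gcongr; exact hlu' _ (by norm_num)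
      _ = _ := by rw [← hu]; ring
  have h4 : (4 : ℝ) * m' ≤ u ^ 13 := by
    calc (4 : ℝ) * m' ≤ 8 * (m * l) := by linarith
      _ ≤ u * (m * u) := by
        gcongr
        · linarith
        · simpa using hlu' 1 (by norm_num)
      _ = u ^ 12 := by rw [← hu]; ring
      _ ≤ u ^ 13 := pow_le_pow_right₀ (by linarith) (by norm_num)
  have h14 : 1000 * u ^ 13 ≤ u ^ 14 := by
    rw [pow_succ u 13, mul_comm]
    gcongr
  have h13 : u ^ 11 * 2 ≤ u ^ 13 := by
    have : (2 : ℝ) ≤ u ^ 2 := by nlinarith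
    calc u ^ 11 * 2 ≤ u ^ 11 * u ^ 2 := by gcongr
      _ = _ := by ring
  suffices (n' : ℝ) < u ^ 13 by
    have : 0 < u ^ 13 := by positivity
    linarith
  by_contra! hn
  have h5 := h.mul_le_of_four_mul_le (by exact_mod_cast h4.trans hn)
  have hlt : (m : ℝ) < m' := by exact_mod_cast h.lt
  have h6 : u ^ 9 * (u ^ 13 / 2) ≤ ((m' : ℝ) - m) * (n' - m) := by
    refine mul_le_mul hE ?_ (by positivity) (by linarith)
    linarith
  have h7 : ((n : ℝ) - n') * m ≤ u ^ 11 * 2 * u ^ 10 := by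
    rw [hu]
    gcongr
  have h8 : u ^ 9 * (u ^ 13 / 2) = u ^ 21 * (u / 2) := by ring
  have h9 : u ^ 11 * 2 * u ^ 10 = u ^ 21 * 2 := by ring
  have h10 : u ^ 21 * 2 < u ^ 21 * (u / 2) := by
    refine mul_lt_mul_of_pos_left ?_ (by positivity)
    linarith
  linarith

end SolPair

/-- In two distinct solutions, `m' - m` is small compared with `m`. -/
theorem eventually_col_sub_le :
    ∀ᶠ n : ℕ in Filter.atTop, ∀ m n' m' : ℕ, SolPair n m n' m' → ∀ u : ℝ, u ^ 10 = m →
      Real.log n ^ 2000 ≤ u → (n : ℝ) - n' < m' * Real.log n ^ 194 → (m' : ℝ) - m < u ^ 9 := by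
  filter_upwards [eventually_abs_sum_fract_le, eventually_abs_sum_cos_le,
    exists_log_le_imp (ε := 1 / 6) (by norm_num) eventually_le_sum_log_primeBlock,
    eventually_rpow_log_le 2,
    tendsto_log_natCast_atTop.eventually (Filter.eventually_ge_atTop (1000 : ℝ))]
    with n hfr hcos hmass hlog hl m n' m' h u hu hlu hD
  by_contra! hE
  have hn14 := h.lt_pow_of_le_sub rfl hu hl hlu hE hD
  have hu1 : 1000 ≤ u := hl.trans ((le_self_pow₀ (by linarith) (by norm_num)).trans hlu)
  have hu26 : Real.log n ^ 26 ≤ u := (pow_le_pow_right₀ (by linarith) (by norm_num)).trans hlu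
  have hrow := h.row_lt
  have hlt := h.lt
  have hll := h.le_left
  have hlr := h.le_right
  have hpos := h.pos
  obtain ⟨P, hPd⟩ : ∃ P, P = ⌊u ^ 8⌋₊ := ⟨_, rfl⟩
  have hP1 : (P : ℝ) ≤ u ^ 8 := hPd ▸ Nat.floor_le (by positivity)
  have hP2 : u ^ 8 < (P : ℝ) + 1 := hPd ▸ Nat.lt_floor_add_one _
  have hPu : (P : ℝ) * Real.log n ^ 26 ≤ u ^ 9 := by
    calc (P : ℝ) * Real.log n ^ 26 ≤ u ^ 8 * u := by gcongr
      _ = _ := by ring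
  have hum : u ^ 9 ≤ m := hu ▸ pow_le_pow_right₀ (by linarith) (by norm_num)
  have hP7 : u ^ 7 ≤ P := by
    have : 1000 * u ^ 7 ≤ u ^ 8 := by
      rw [pow_succ u 7, mul_comm]
      gcongr
    have : 1 ≤ u ^ 7 := one_le_pow₀ (by linarith)
    linarith
  have hPlog := hlog P (by
    have : (n : ℝ) ≤ (P : ℝ) ^ 2 := by
      calc (n : ℝ) ≤ u ^ 14 := hn14.le
        _ = (u ^ 7) ^ 2 := by ring
        _ ≤ _ := by gcongr
    exact_mod_cast this)
  have hmn : (m : ℝ) ≤ n := by exact_mod_cast (by omega : m ≤ n)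
  have hPn : P ≤ n := by
    have : (P : ℝ) ≤ n := by
      calc (P : ℝ) ≤ u ^ 8 := hP1
        _ ≤ u ^ 9 := pow_le_pow_right₀ (by linarith) (by norm_num)
        _ ≤ n := hum.trans hmn
    exact_mod_cast this
  obtain ⟨M, hM⟩ : ∃ M, M = ∑ p ∈ primeBlock P, Real.log p := ⟨_, rfl⟩
  have hM0 : 0 < M := by
    have : (0 : ℝ) < P := lt_of_lt_of_le (by positivity) hP7
    exact this.trans_le (hM ▸ hmass P hPlog)
  obtain ⟨A, hA⟩ : ∃ A : ℕ → ℝ, A = fun N : ℕ => ∑ p ∈ primeBlock P, Real.log p *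
      ((Int.fract ((N : ℝ) / p) - 1 / 2) * Real.sin (2 * Real.pi * ((m : ℝ) / p))) := ⟨_, rfl⟩
  obtain ⟨hβ, hβ1⟩ := le_sawCoeff
  have hAm : |A m + sawCoeff 4000 4001 * M| ≤ 1 / 50 * M := by
    have h1 := hfr P hPlog hPn m m le_rfl (by omega) (hPu.trans hum)
    simp only [sub_self, mul_zero, Real.cos_zero, mul_one] at h1
    rw [hA, hM]
    exact h1
  have hAN : ∀ N : ℕ, m' ≤ N → N ≤ n → |A N| ≤ 1 / 49 * M := by
    intro N h1 h2
    have hN1 : (m' : ℝ) ≤ N := by exact_mod_cast h1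
    have hN2 : (N : ℝ) ≤ n := by exact_mod_cast h2
    have hlt' : (m : ℝ) < m' := by exact_mod_cast hlt
    have hm0 : (0 : ℝ) ≤ m := Nat.cast_nonneg m
    have h3 := hfr P hPlog hPn m N (by omega) h2 (hPu.trans hum)
    have h4 := hcos P hPlog hPn (N - m) (by
      refine le_trans ?_ (le_abs_self _)
      linarith) (by
      rw [abs_of_nonneg (by linarith)]
      have : (1 : ℝ) ≤ n := by exact_mod_cast (by omega : 1 ≤ n)
      nlinarith)
    simp only [sub_div] at h4
    rw [← hM] at h3 h4
    have h5 : |sawCoeff 4000 4001 * ∑ p ∈ primeBlock P, Real.log p *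
          Real.cos (2 * Real.pi * ((N : ℝ) / p - (m : ℝ) / p))| ≤ 1 * (1 / 10 ^ 7 * M) := by
      rw [abs_mul, abs_of_nonneg (by linarith)]
      exact mul_le_mul hβ1 h4 (abs_nonneg _) zero_le_one
    rw [hA]
    rw [abs_le] at *
    constructor <;> linarith [h3.1, h3.2, h5.1, h5.2]
  have hsum : A m + A (n - m) - A n - (A m' + A (n' - m') - A n') = 0 := by
    rw [hA]
    simp only [← sum_add_distrib, ← sum_sub_distrib]
    refine sum_eq_zero fun p hp => ?_
    obtain ⟨⟨hp1, hp2⟩, hpp⟩ := mem_primeBlock.1 hp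
    have hpu : u ^ 8 ≤ (p : ℝ) := by
      have : (P : ℝ) + 1 ≤ p := by exact_mod_cast hp1
      linarith
    have hnp : (n : ℝ) < (p : ℝ) ^ 2 := by
      calc (n : ℝ) < u ^ 14 := hn14
        _ ≤ u ^ 16 := pow_le_pow_right₀ (by linarith) (by norm_num)
        _ = (u ^ 8) ^ 2 := by ring
        _ ≤ _ := by gcongr
    have h1 := h.fract_add_fract_sub hpp (by exact_mod_cast hnp)
    linear_combination Real.log p * Real.sin (2 * Real.pi * ((m : ℝ) / p)) * h1
  have a1 := hAN (n - m) (by omega) (by omega)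
  have a2 := hAN n (by omega) le_rfl
  have a3 := hAN m' le_rfl (by omega)
  have a4 := hAN (n' - m') (by omega) (by omega)
  have a5 := hAN n' (by omega) (by omega)
  have hβM : 15 / 100 * M ≤ sawCoeff 4000 4001 * M := by gcongr
  rw [abs_le] at hAm a1 a2 a3 a4 a5
  linarith [hAm.2, a1.2, a2.1, a3.1, a4.1, a5.2, hAm.1, a1.1, a2.2, a3.2, a4.2, a5.1]

/-- Two solutions in the interior of Pascal's triangle are very close to one another. -/
theorem eventually_solPair_close {ε : ℝ} (hε : 0 < ε) :
    ∀ᶠ n : ℕ in Filter.atTop, ∀ m n' m' : ℕ, SolPair n m n' m' →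
      Real.exp (Real.log n ^ ((2 : ℝ) / 3 + ε)) ≤ m → ((n - m) - (n' - m')) ^ 6 < m := by
  filter_upwards [eventually_row_sub_lt hε, eventually_col_sub_le, eventually_diff_pow_lt,
    eventually_pow_log_le_of_exp_le hε 1 20000] with n h1 h2 h3 h4 m n' m' h hm
  have hlog := Real.log_natCast_nonneg n
  have hm0 : (0 : ℝ) ≤ m := Nat.cast_nonneg m
  have hu : ((m : ℝ) ^ ((1 : ℝ) / 10)) ^ 10 = m := by
    rw [← Real.rpow_natCast, ← Real.rpow_mul hm0]
    norm_num
  have hlu : Real.log n ^ 2000 ≤ (m : ℝ) ^ ((1 : ℝ) / 10) := by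
    refine (pow_le_pow_iff_left₀ (by positivity) (by positivity) (show 10 ≠ 0 by norm_num)).1 ?_
    rw [hu, ← pow_mul]
    simpa using h4 m hm
  have hD := h1 m n' m' h hm
  exact h3 m n' m' h _ hu hlu (h2 m n' m' h _ hu hlu hD).le hD

namespace SolPair

variable {n₁ m₁ n₂ m₂ n₃ m₃ : ℕ}

/-- The slopes between consecutive solutions are strictly monotone. -/
theorem slope_lt (h : SolPair n₁ m₁ n₂ m₂) (h' : SolPair n₂ m₂ n₃ m₃) :
    ((n₂ : ℝ) - n₃) * (m₂ - m₁) < (n₁ - n₂) * (m₃ - m₂) := by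
  have hc := h.log_col_le
  have hr := h'.log_row_le
  have hm0 : (1 : ℝ) ≤ m₁ := by exact_mod_cast h.pos
  have hE : (m₁ : ℝ) < m₂ := by exact_mod_cast h.lt
  have hE' : (m₂ : ℝ) < m₃ := by exact_mod_cast h'.lt
  have hD : (n₂ : ℝ) < n₁ := by exact_mod_cast h.row_lt
  have hD' : (n₃ : ℝ) < n₂ := by exact_mod_cast h'.row_lt
  have hl : 2 * (m₂ : ℝ) ≤ n₂ := by exact_mod_cast h.le_right
  have hl' : 2 * (m₃ : ℝ) ≤ n₃ := by exact_mod_cast h'.le_right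
  have ha : Real.log (((n₃ : ℝ) - m₂) / (m₂ + 1)) < Real.log (((n₂ : ℝ) + 1 - m₂) / m₂) := by
    refine Real.log_lt_log (div_pos (by linarith) (by linarith)) ?_
    rw [div_lt_div_iff₀ (by linarith) (by linarith)]
    nlinarith
  have ha0 : 0 ≤ Real.log (((n₃ : ℝ) - m₂) / (m₂ + 1)) := by
    refine Real.log_nonneg ?_
    rw [le_div_iff₀ (by linarith)]
    have : (m₂ : ℝ) + 1 ≤ m₃ := by exact_mod_cast h'.lt
    linarith
  have hb : Real.log (((n₂ : ℝ) + 1) / (n₂ + 1 - m₁)) ≤ Real.log ((n₂ : ℝ) / (n₂ - m₂)) := by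
    refine Real.log_le_log (div_pos (by linarith) (by linarith)) ?_
    rw [div_le_div_iff₀ (by linarith) (by linarith)]
    nlinarith
  have hb0 : 0 < Real.log (((n₂ : ℝ) + 1) / (n₂ + 1 - m₁)) := by
    refine Real.log_pos ?_
    rw [lt_div_iff₀ (by linarith)]
    linarith
  generalize Real.log (((n₃ : ℝ) - m₂) / (m₂ + 1)) = a' at *
  generalize Real.log (((n₂ : ℝ) + 1 - m₂) / m₂) = a at *
  generalize Real.log (((n₂ : ℝ) + 1) / (n₂ + 1 - m₁)) = b at *
  generalize Real.log ((n₂ : ℝ) / (n₂ - m₂)) = b' at *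
  refine lt_of_mul_lt_mul_right ?_ hb0.le
  calc ((n₂ : ℝ) - n₃) * (m₂ - m₁) * b ≤ (n₂ - n₃) * (m₂ - m₁) * b' := by
        gcongr
    _ = (m₂ - m₁) * ((n₂ - n₃) * b') := by ring
    _ ≤ (m₂ - m₁) * ((m₃ - m₂) * a') := by
        gcongr
    _ < (m₂ - m₁) * ((m₃ - m₂) * a) := by
        refine mul_lt_mul_of_pos_left (mul_lt_mul_of_pos_left ha ?_) ?_ <;> linarith
    _ = (m₃ - m₂) * ((m₂ - m₁) * a) := by ring
    _ ≤ (m₃ - m₂) * ((n₁ - n₂) * b) := by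
        gcongr
    _ = _ := by ring

theorem row_le_mul (h : SolPair n₁ m₁ n₂ m₂) {H : ℝ} (hH : (n₁ : ℝ) - n₂ + (m₂ - m₁) ≤ H)
    (hHm : H ≤ m₁) : (n₁ : ℝ) ≤ 9 * H * m₁ := by
  have hm0 : (1 : ℝ) ≤ m₁ := by exact_mod_cast h.pos
  have hE : (m₁ : ℝ) + 1 ≤ m₂ := by exact_mod_cast h.lt
  have hD : (n₂ : ℝ) + 1 ≤ n₁ := by exact_mod_cast h.row_lt
  have hH2 : 2 ≤ H := by linarith
  have h2 : 2 * (m₁ : ℝ) ≤ H * m₁ := by gcongr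
  rcases le_total (4 * m₂) n₂ with h4 | h4
  · have h1 := h.mul_le_of_four_mul_le h4
    have h4' : 4 * (m₂ : ℝ) ≤ n₂ := by exact_mod_cast h4
    have h3 : 1 * ((n₂ : ℝ) - m₁) ≤ (m₂ - m₁) * (n₂ - m₁) := by
      gcongr
      · linarith
      · linarith
    have h5 : ((n₁ : ℝ) - n₂) * m₁ ≤ H * m₁ := by
      gcongr
      linarith
    linarith
  · have h4' : (n₂ : ℝ) ≤ 4 * m₂ := by exact_mod_cast h4
    linarith

theorem log_div_sub_sub_le {n m a b H : ℝ} (hm : 0 < m) (hmn : 2 * m ≤ n) (hb : m ≤ b)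
    (hab : 2 * b ≤ a) (han : a ≤ n) (hH : b - m + (n - a) ≤ H) :
    (Real.log (a / (a - b)) - Real.log (n / (n - m))) * m ≤
      2 * H * Real.log (a / (a - b)) := by
  have hy : b / a ≤ Real.log (a / (a - b)) := by
    have h1 := Real.one_sub_inv_le_log_of_pos (show 0 < a / (a - b) from
      div_pos (by linarith) (by linarith))
    rw [inv_div] at h1
    calc b / a = 1 - (a - b) / a := by
          rw [sub_div, div_self (by linarith : a ≠ 0)]
          ring
      _ ≤ _ := h1
  have h1 : Real.log (a / (a - b)) - Real.log (n / (n - m)) ≤ H / (a - b) := by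
    rw [← Real.log_div (div_pos (by linarith) (by linarith)).ne'
      (div_pos (by linarith) (by linarith)).ne']
    refine (Real.log_le_sub_one_of_pos (div_pos (div_pos (by linarith) (by linarith))
      (div_pos (by linarith) (by linarith)))).trans ?_
    have : n - m ≠ 0 := by linarith
    have : a - b ≠ 0 := by linarith
    have : n ≠ 0 := by linarith
    have e1 : a / (a - b) / (n / (n - m)) - 1 = (n * b - m * a) / n / (a - b) := by
      field_simp
      ring
    rw [e1]
    refine div_le_div_of_nonneg_right ?_ (by linarith)
    rw [div_le_iff₀ (by linarith)]
    nlinarith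
  have hH0 : 0 ≤ H := by linarith
  calc (Real.log (a / (a - b)) - Real.log (n / (n - m))) * m ≤ H / (a - b) * b := by
        refine mul_le_mul h1 hb hm.le (div_nonneg hH0 (by linarith))
    _ ≤ H / (a / 2) * b := by
        have : a / 2 ≤ a - b := by linarith
        have : 0 < a / 2 := by linarith
        gcongr
        linarith
    _ = 2 * H * (b / a) := by
        have : a ≠ 0 := by linarith
        field_simp
    _ ≤ _ := by gcongr

/-- The slopes between consecutive solutions are nearly equal. -/
theorem slope_sub_le (h : SolPair n₁ m₁ n₂ m₂) (h' : SolPair n₂ m₂ n₃ m₃) {H R : ℝ}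
    (hH : (n₁ : ℝ) - n₃ + (m₃ - m₁) ≤ H) (hR : (n₁ : ℝ) ≤ R * m₁) :
    (((n₁ : ℝ) - n₂) * (m₃ - m₂) - (n₂ - n₃) * (m₂ - m₁)) * m₁ ≤ 2 * H ^ 3 * R ^ 2 := by
  have hr := h.log_row_le
  have hc := h'.log_col_le
  have hm0 : (1 : ℝ) ≤ m₁ := by exact_mod_cast h.pos
  have hE : (m₁ : ℝ) + 1 ≤ m₂ := by exact_mod_cast h.lt
  have hE' : (m₂ : ℝ) + 1 ≤ m₃ := by exact_mod_cast h'.lt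
  have hD : (n₂ : ℝ) + 1 ≤ n₁ := by exact_mod_cast h.row_lt
  have hD' : (n₃ : ℝ) + 1 ≤ n₂ := by exact_mod_cast h'.row_lt
  have hl : 2 * (m₂ : ℝ) ≤ n₂ := by exact_mod_cast h.le_right
  have hl' : 2 * (m₃ : ℝ) ≤ n₃ := by exact_mod_cast h'.le_right
  have hH0 : 0 ≤ H := by linarith
  have hR2 : 2 ≤ R := by
    refine le_of_mul_le_mul_right ?_ (show (0 : ℝ) < m₁ by linarith)
    linarith
  have hx : (Real.log (((n₂ : ℝ) - m₁) / (m₁ + 1)) - Real.log (((n₃ : ℝ) + 1 - m₃) / m₃)) * m₁ ≤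
      2 * H := by
    have h1 : Real.log (((n₂ : ℝ) - m₁) / (m₁ + 1)) - Real.log (((n₃ : ℝ) + 1 - m₃) / m₃) =
        Real.log (((n₂ : ℝ) - m₁) / (n₃ + 1 - m₃)) + Real.log (m₃ / (m₁ + 1)) := by
      rw [Real.log_div, Real.log_div, Real.log_div, Real.log_div]
      · ring
      all_goals linarith
    have h2 : ∀ a b : ℝ, (m₁ : ℝ) ≤ b → 0 < a → a - b ≤ H → Real.log (a / b) ≤ H / m₁ := by
      intro a b hb ha hab
      refine (Real.log_le_sub_one_of_pos (div_pos ha (by linarith))).trans ?_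
      rw [div_sub_one (by linarith)]
      exact div_le_div₀ hH0 hab (by linarith) hb
    have h3 := h2 ((n₂ : ℝ) - m₁) (n₃ + 1 - m₃) (by linarith) (by linarith) (by linarith)
    have h4 := h2 m₃ (m₁ + 1) (by linarith) (by linarith) (by linarith)
    rw [h1]
    calc _ ≤ (H / m₁ + H / m₁) * m₁ := by gcongr
      _ = _ := by field_simp; ring
  have hx'0 : 0 ≤ Real.log (((n₃ : ℝ) + 1 - m₃) / m₃) := by
    refine Real.log_nonneg ?_
    rw [le_div_iff₀ (by linarith)]
    linarith
  have hx' : Real.log (((n₃ : ℝ) + 1 - m₃) / m₃) ≤ R - 1 := by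
    refine (Real.log_le_sub_one_of_pos (div_pos (by linarith) (by linarith))).trans ?_
    have : ((n₃ : ℝ) + 1 - m₃) / m₃ ≤ R := by
      rw [div_le_iff₀ (by linarith)]
      have : R * m₁ ≤ R * m₃ := by gcongr; exact (h.lt.trans h'.lt).le
      linarith
    linarith
  have hyy := log_div_sub_sub_le (n := n₁) (m := m₁) (a := n₃ + 1) (b := m₂) (H := H)
    (by linarith) (by linarith) (by linarith) (by linarith) (by linarith) (by linarith)
  have hy : 1 ≤ Real.log ((n₁ : ℝ) / (n₁ - m₁)) * R := by
    have h1 := Real.one_sub_inv_le_log_of_pos (show 0 < (n₁ : ℝ) / (n₁ - m₁) from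
      div_pos (by linarith) (by linarith))
    have h2 : 1 / R ≤ 1 - ((n₁ : ℝ) / (n₁ - m₁))⁻¹ := by
      rw [inv_div, one_sub_div (by linarith), sub_sub_cancel, div_le_div_iff₀ (by linarith)
        (by linarith)]
      linarith
    rw [← div_le_iff₀ (by linarith)]
    exact h2.trans h1
  have hy' : 0 < Real.log (((n₃ : ℝ) + 1) / (n₃ + 1 - m₂)) := by
    refine Real.log_pos ?_
    rw [lt_div_iff₀ (by linarith)]
    linarith
  have hlt := h.slope_lt h'
  generalize Real.log (((n₂ : ℝ) - m₁) / (m₁ + 1)) = x at *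
  generalize Real.log (((n₃ : ℝ) + 1 - m₃) / m₃) = x' at *
  generalize Real.log ((n₁ : ℝ) / (n₁ - m₁)) = y at *
  generalize Real.log (((n₃ : ℝ) + 1) / (n₃ + 1 - m₂)) = y' at *
  obtain ⟨E, hEd⟩ : ∃ E, E = (m₂ : ℝ) - m₁ := ⟨_, rfl⟩
  obtain ⟨E', hEd'⟩ : ∃ E, E = (m₃ : ℝ) - m₂ := ⟨_, rfl⟩
  obtain ⟨D, hDd⟩ : ∃ D, D = (n₁ : ℝ) - n₂ := ⟨_, rfl⟩
  obtain ⟨D', hDd'⟩ : ∃ D, D = (n₂ : ℝ) - n₃ := ⟨_, rfl⟩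
  rw [← hEd, ← hDd] at hr
  rw [← hEd', ← hDd'] at hc
  rw [← hEd, ← hDd, ← hEd', ← hDd'] at hlt ⊢
  have hE0 : 0 ≤ E := by linarith
  have hE0' : 0 ≤ E' := by linarith
  have hEE : E * E' ≤ H * H := mul_le_mul (by linarith) (by linarith) hE0' hH0
  have key : (D * E' - D' * E) * m₁ * y * y' ≤ E * E' * (2 * H * R) * y' := by
    calc (D * E' - D' * E) * m₁ * y * y' = m₁ * (E' * y' * (D * y) - E * y * (D' * y')) := by ring
      _ ≤ m₁ * (E' * y' * (E * x) - E * y * (E' * x')) := by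
          have : 0 ≤ y := by nlinarith
          gcongr
      _ = E * E' * (y' * ((x - x') * m₁) + x' * ((y' - y) * m₁)) := by ring
      _ ≤ E * E' * (y' * (2 * H) + (R - 1) * (2 * H * y')) := by
          gcongr ?_ * (?_ + ?_)
          · gcongr
          · exact (mul_le_mul_of_nonneg_left hyy hx'0).trans
              (mul_le_mul_of_nonneg_right hx' (by positivity))
      _ = _ := by ring
  have key' := le_of_mul_le_mul_right key hy'
  have hpos : 0 ≤ (D * E' - D' * E) * m₁ := mul_nonneg (by linarith) (by linarith)
  calc (D * E' - D' * E) * m₁ = (D * E' - D' * E) * m₁ * 1 := by ring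
    _ ≤ (D * E' - D' * E) * m₁ * (y * R) := by gcongr
    _ = (D * E' - D' * E) * m₁ * y * R := by ring
    _ ≤ E * E' * (2 * H * R) * R := by gcongr
    _ ≤ H * H * (2 * H * R) * R := by gcongr
    _ = 2 * H ^ 3 * R ^ 2 := by ring

/-- There are no three solutions which are very close to one another. -/
theorem not_three (h : SolPair n₁ m₁ n₂ m₂) (h' : SolPair n₂ m₂ n₃ m₃)
    (hH : ((n₁ - m₁) - (n₃ - m₃)) ^ 6 < m₁) (hm : 162 ^ 6 ≤ m₁) : False := by
  obtain ⟨H, hHd⟩ : ∃ H, H = (n₁ - m₁) - (n₃ - m₃) := ⟨_, rfl⟩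
  rw [← hHd] at hH
  have h1 := h.lt
  have h2 := h'.lt
  have h3 := h.row_lt
  have h4 := h'.row_lt
  have h5 := h.le_left
  have h6 := h'.le_right
  have hHr : (n₁ : ℝ) - n₃ + (m₃ - m₁) = H := by
    have : n₁ + m₃ = H + n₃ + m₁ := by omega
    have : (n₁ : ℝ) + m₃ = H + n₃ + m₁ := by exact_mod_cast this
    linarith
  have hH1 : 1 ≤ H := by omega
  have hHm : H ≤ m₁ := (Nat.le_self_pow (by norm_num) H).trans hH.le
  have c1 : (m₂ : ℝ) < m₃ := by exact_mod_cast h2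
  have c2 : (n₃ : ℝ) < n₂ := by exact_mod_cast h4
  have h7 := h.row_le_mul (H := H) (by linarith) (by exact_mod_cast hHm)
  have h8 := h.slope_sub_le h' hHr.le h7
  have h9 := h.slope_lt h'
  have h10 : (1 : ℝ) ≤ (n₁ - n₂) * (m₃ - m₂) - (n₂ - n₃) * (m₂ - m₁) := by
    have h11 : ((n₂ : ℤ) - n₃) * (m₂ - m₁) < (n₁ - n₂) * (m₃ - m₂) := by exact_mod_cast h9
    have h12 : (1 : ℤ) ≤ (n₁ - n₂) * (m₃ - m₂) - (n₂ - n₃) * (m₂ - m₁) := by omega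
    exact_mod_cast h12
  have h13 : (m₁ : ℝ) ≤ 162 * (H : ℝ) ^ 5 := by
    calc (m₁ : ℝ) = 1 * m₁ := (one_mul _).symm
      _ ≤ _ := mul_le_mul_of_nonneg_right h10 (Nat.cast_nonneg m₁)
      _ ≤ _ := h8
      _ = _ := by ring
  have h14 : m₁ ≤ 162 * H ^ 5 := by exact_mod_cast h13
  rcases le_or_gt 162 H with h15 | h15
  · have : 162 * H ^ 5 ≤ H * H ^ 5 := Nat.mul_le_mul_right _ h15
    have : H * H ^ 5 = H ^ 6 := by ring
    omega
  · have : H ^ 5 < 162 ^ 5 := Nat.pow_lt_pow_left h15 (by norm_num)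
    omega

end SolPair

theorem choose_lt_choose_left {n n' m : ℕ} (hm : 1 ≤ m) (hmn : m ≤ n) (h : n < n') :
    n.choose m < n'.choose m := by
  refine lt_of_lt_of_le ?_ (Nat.choose_le_choose m (Nat.succ_le_of_lt h))
  rw [Nat.succ_eq_add_one, Nat.choose_succ_left n m hm]
  have : 0 < n.choose (m - 1) := Nat.choose_pos (by omega)
  omega

theorem encard_le_two_of_forall {α : Type*} {s : Set α}
    (h : ∀ x ∈ s, ∀ y ∈ s, ∀ z ∈ s, x ≠ y → x ≠ z → y ≠ z → False) : s.encard ≤ 2 := by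
  by_contra! hs
  obtain ⟨t, hts, ht⟩ := Set.exists_subset_encard_eq (Order.add_one_le_of_lt hs)
  rw [show (2 : ℕ∞) + 1 = 3 by norm_num, Set.encard_eq_three] at ht
  obtain ⟨x, y, z, hxy, hxz, hyz, rfl⟩ := ht
  exact h x (hts (by simp)) y (hts (by simp)) z (hts (by simp)) hxy hxz hyz

end Singmaster

/-- Singmaster's conjecture in the interior of Pascal's triangle (left half):
for every `0 < ε < 1` there is `t₀` such that for all integers `t ≥ t₀`, the number
of pairs `(n, m)` with `1 ≤ m ≤ n/2`, `exp((log n)^(2/3+ε)) ≤ m` and `C(n,m) = t`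
is at most `2`. -/
theorem stmt_0 (ε : ℝ) (hε0 : 0 < ε) (hε1 : ε < 1) :
    ∃ t₀ : ℕ, ∀ t : ℕ, t₀ ≤ t →
      {p : ℕ × ℕ | 1 ≤ p.2 ∧ 2 * p.2 ≤ p.1 ∧
        Real.exp ((Real.log p.1) ^ ((2 : ℝ) / 3 + ε)) ≤ (p.2 : ℝ) ∧
        Nat.choose p.1 p.2 = t}.encard ≤ 2 := by
  obtain ⟨n₀, hn₀⟩ := Filter.eventually_atTop.1 ((Singmaster.eventually_solPair_close hε0).and
    (Singmaster.eventually_pow_log_le_of_exp_le hε0 (162 ^ 6) 0))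
  refine ⟨2 ^ n₀, fun t ht => Singmaster.encard_le_two_of_forall ?_⟩
  obtain ⟨s, hs⟩ : ∃ s : Set (ℕ × ℕ), s = {p : ℕ × ℕ | 1 ≤ p.2 ∧ 2 * p.2 ≤ p.1 ∧
        Real.exp ((Real.log p.1) ^ ((2 : ℝ) / 3 + ε)) ≤ (p.2 : ℝ) ∧
        Nat.choose p.1 p.2 = t} := ⟨_, rfl⟩
  rw [← hs]
  have hpair : ∀ x ∈ s, ∀ y ∈ s, x.2 < y.2 → Singmaster.SolPair x.1 x.2 y.1 y.2 := by
    rintro x hx y hy hxy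
    rw [hs] at hx hy
    exact ⟨hx.1, hxy, hx.2.1, hy.2.1, hx.2.2.2.trans hy.2.2.2.symm⟩
  have hchain : ∀ x ∈ s, ∀ y ∈ s, ∀ z ∈ s, x.2 < y.2 → y.2 < z.2 → False := by
    rintro x hx y hy z hz hxy hyz
    have hx' := hx
    rw [hs] at hx'
    obtain ⟨-, -, hexp, hch⟩ := hx'
    obtain ⟨h1, h2⟩ := hn₀ x.1 ((Nat.pow_le_pow_iff_right one_lt_two).1
      (ht.trans (hch ▸ Nat.choose_le_two_pow _ _)))
    refine (hpair x hx y hy hxy).not_three (hpair y hy z hz hyz)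
      (h1 _ _ _ (hpair x hx z hz (hxy.trans hyz)) hexp) ?_
    have := h2 _ hexp
    rw [pow_zero, mul_one] at this
    exact_mod_cast this
  have hne : ∀ x ∈ s, ∀ y ∈ s, x ≠ y → x.2 ≠ y.2 := by
    rintro x hx y hy hxy h
    rw [hs] at hx hy
    obtain ⟨hx1, hx2, -, hx3⟩ := hx
    obtain ⟨-, hy2, -, hy3⟩ := hy
    rw [← h] at hy2 hy3
    rcases lt_trichotomy x.1 y.1 with h1 | h1 | h1
    · have := Singmaster.choose_lt_choose_left hx1 (by omega) h1
      omega
    · exact hxy (Prod.ext h1 h)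
    · have := Singmaster.choose_lt_choose_left hx1 (by omega) h1
      omega
  intro x hx y hy z hz hxy hxz hyz
  rcases (hne x hx y hy hxy).lt_or_gt with h1 | h1 <;>
  rcases (hne x hx z hz hxz).lt_or_gt with h2 | h2 <;>
  rcases (hne y hy z hz hyz).lt_or_gt with h3 | h3
  · exact hchain x hx y hy z hz h1 h3
  · exact hchain x hx z hz y hy h2 h3
  · omega
  · exact hchain z hz x hx y hy h2 h1
  · exact hchain y hy x hx z hz h1 h2
  · omega
  · exact hchain y hy z hz x hx h3 h2
  · exact hchain z hz y hy x hx h3 h1
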